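/- Let k be an algebraically closed field of characteristic zero and let X be a proper scheme over k. Then the following are equivalent: (1) X is groupless modulo the empty subscheme; (2) X is groupless; (3) for every finite type connected group scheme G over k and every dense open subscheme V ⊂ G, every morphism V → X is constant. -/

import Mathlib

/-!
Formalization of a statement from "The Lang–Vojta conjectures on projective
pseudo-hyperbolic varieties" (Javanpeykar).

Notions not available in Mathlib (analytifications, genus, ample degrees, Hom-schemes, ...)
are encoded by explicit definitions or structures below; see the docstrings for the
conventions used.
-/

open CategoryTheory AlgebraicGeometry Limits

noncomputable section

/-- `Spec R` as a scheme, for a commutative ring `R`. -/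
abbrev SR (R : Type) [CommRing R] : Scheme := Spec (CommRingCat.of R)

/-- The category of schemes over `Spec R`. -/
abbrev OverR (R : Type) [CommRing R] := Over (SR R)

/-- A morphism of schemes over `Spec R` is constant if it factors through the base `Spec R`. -/
def IsConstant {R : Type} [CommRing R] {X Y : OverR R} (f : X ⟶ Y) : Prop :=
  ∃ y : SR R ⟶ Y.left, f.left = X.hom ≫ y

/-- A morphism `g : V ⟶ W` of schemes, where `V` has structure morphism `sV` to `Spec R`,
is constant if it factors through `Spec R`. -/
def IsConstantHom {R : Type} [CommRing R] {V W : Scheme} (sV : V ⟶ SR R) (g : V ⟶ W) : Prop :=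
  ∃ y : SR R ⟶ W, g = sV ≫ y

/-- A variety over `R`: a finite type, separated scheme over `Spec R`. -/
def IsVarietyOver {R : Type} [CommRing R] (X : OverR R) : Prop :=
  LocallyOfFiniteType X.hom ∧ QuasiCompact X.hom ∧ IsSeparated X.hom

/-- The multiplicative group scheme `𝔾ₘ` over `R`, i.e. the spectrum of the Laurent
polynomial ring over `R` (only its underlying scheme over `Spec R` is needed). -/
def GmO (R : Type) [CommRing R] : OverR R :=
  Over.mk (Spec.map (CommRingCat.ofHom (algebraMap R (LaurentPolynomial R))))

/-- The affine line over `R`. -/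
def A1O (R : Type) [CommRing R] : OverR R :=
  Over.mk (Spec.map (CommRingCat.ofHom (algebraMap R (Polynomial R))))

/-- `Spec R` as the terminal object of the category of schemes over `Spec R`. -/
def ptO (R : Type) [CommRing R] : OverR R := Over.mk (𝟙 (SR R))

/-- A group scheme over `R`, presented via a group structure on its functor of points:
by the Yoneda lemma this is the same as a group object in the category of schemes
over `Spec R`. -/
structure GroupScheme (R : Type) [CommRing R] where
  G : OverR R
  mul : ∀ {T : OverR R}, (T ⟶ G) → (T ⟶ G) → (T ⟶ G)
  one : ∀ (T : OverR R), T ⟶ G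
  inv : ∀ {T : OverR R}, (T ⟶ G) → (T ⟶ G)
  mul_assoc : ∀ {T : OverR R} (a b c : T ⟶ G), mul (mul a b) c = mul a (mul b c)
  one_mul : ∀ {T : OverR R} (a : T ⟶ G), mul (one T) a = a
  inv_mul : ∀ {T : OverR R} (a : T ⟶ G), mul (inv a) a = one T
  mul_natural : ∀ {T T' : OverR R} (f : T ⟶ T') (a b : T' ⟶ G),
    f ≫ mul a b = mul (f ≫ a) (f ≫ b)
  one_natural : ∀ {T T' : OverR R} (f : T ⟶ T'), f ≫ one T' = one T

/-- A finite type, connected group scheme over `R`. -/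
def GroupScheme.IsFiniteTypeConnected {R : Type} [CommRing R] (Γ : GroupScheme R) : Prop :=
  LocallyOfFiniteType Γ.G.hom ∧ QuasiCompact Γ.G.hom ∧ ConnectedSpace Γ.G.left

/-- An abelian variety over `R`: a connected finite type proper group scheme. (Over an
algebraically closed field of characteristic zero this agrees with the usual definition,
since group schemes are then automatically smooth by Cartier's theorem.) -/
def GroupScheme.IsAbelianVariety {R : Type} [CommRing R] (Γ : GroupScheme R) : Prop :=
  Γ.IsFiniteTypeConnected ∧ IsProper Γ.G.hom

/-- A scheme over `R` is groupless if every morphism to it from `𝔾ₘ` and from any abelian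
variety over `R` is constant. -/
def IsGroupless (R : Type) [CommRing R] (X : OverR R) : Prop :=
  (∀ f : GmO R ⟶ X, IsConstant f) ∧
  (∀ Γ : GroupScheme R, Γ.IsAbelianVariety → ∀ f : Γ.G ⟶ X, IsConstant f)

/-- A subset `Z` of a topological space has codimension at least two: every point of
`Z` admits a chain of two strict generizations (this computes the codimension of the
closure of each point of `Z` via the specialization order). -/
def CodimAtLeastTwo {T : Type} [TopologicalSpace T] (Z : Set T) : Prop :=
  ∀ z ∈ Z, ∃ x y : T, x ⤳ y ∧ y ⤳ z ∧ ¬(y ⤳ x) ∧ ¬(z ⤳ y)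

/-- `X` is groupless modulo the closed subset `Δ` if for every finite type connected group
scheme `G` over `R` and every dense open `U ⊆ G` whose complement has codimension at least
two, every non-constant morphism `U ⟶ X` over `R` factors over `Δ`. -/
def GrouplessModulo (R : Type) [CommRing R] (X : OverR R) (Δ : Set X.left) : Prop :=
  ∀ (Γ : GroupScheme R), Γ.IsFiniteTypeConnected →
    ∀ (U : Γ.G.left.Opens), Dense (U : Set Γ.G.left) →
      CodimAtLeastTwo ((U : Set Γ.G.left)ᶜ) →
      ∀ g : U.toScheme ⟶ X.left, g ≫ X.hom = U.ι ≫ Γ.G.hom →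
        ¬ IsConstantHom (U.ι ≫ Γ.G.hom) g → Set.range g.base ⊆ Δ

/-- `X` is pseudo-groupless if it is groupless modulo some proper closed subset. -/
def PseudoGroupless (R : Type) [CommRing R] (X : OverR R) : Prop :=
  ∃ Δ : Set X.left, IsClosed Δ ∧ Δ ≠ Set.univ ∧ GrouplessModulo R X Δ

section P0
variable (k : Type) [Field k]

/-- `Spec R` over `k`. -/
abbrev SO (R : Type) [CommRing R] [Algebra k R] : OverR k :=
  Over.mk (Spec.map (CommRingCat.ofHom (algebraMap k R)))

variable {k}

def SOmap {R S : Type} [CommRing R] [Algebra k R] [CommRing S] [Algebra k S] (f : R →ₐ[k] S) :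
    SO k S ⟶ SO k R :=
  Over.homMk (Spec.map (CommRingCat.ofHom f.toRingHom)) (by
    simp only [Over.mk_left, Over.mk_hom, ← Spec.map_comp, ← CommRingCat.ofHom_comp]
    congr 2
    exact f.comp_algebraMap)

abbrev Pt (X : OverR k) (R : Type) [CommRing R] [Algebra k R] := SO k R ⟶ X

variable {X Y Z : OverR k} {R S T : Type} [CommRing R] [Algebra k R] [CommRing S] [Algebra k S]
  [CommRing T] [Algebra k T]

def Pt.map (f : R →ₐ[k] S) (y : Pt X R) : Pt X S := SOmap f ≫ y

@[simp] lemma SOmap_left (f : R →ₐ[k] S) :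
  (SOmap f).left = Spec.map (CommRingCat.ofHom f.toRingHom) := rfl

lemma SOmap_comp (f : R →ₐ[k] S) (g : S →ₐ[k] T) : SOmap (g.comp f) = SOmap g ≫ SOmap f := by
  ext1
  simp only [SOmap_left, Over.comp_left, ← Spec.map_comp, ← CommRingCat.ofHom_comp]
  rfl

lemma SOmap_id : SOmap (AlgHom.id k R) = 𝟙 _ := by
  ext1
  simp only [SOmap_left, Over.id_left]
  exact Spec.map_id _

lemma Pt.map_map (f : R →ₐ[k] S) (g : S →ₐ[k] T) (y : Pt X R) :
    (y.map f).map g = y.map (g.comp f) := by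
  simp [Pt.map, SOmap_comp]

lemma Pt.map_id (y : Pt X R) : y.map (AlgHom.id k R) = y := by
  simp [Pt.map, SOmap_id]

lemma Pt.map_comp (f : R →ₐ[k] S) (y : Pt X R) (p : X ⟶ Y) :
    Pt.map f (y ≫ p : Pt Y R) = Pt.map f y ≫ p := by
  simp [Pt.map]

/-- every over-morphism between affine over-objects comes from an algebra map -/
def SOpre (p : SO k S ⟶ SO k R) : R →ₐ[k] S :=
  { (Spec.preimage p.left).hom with
    commutes' := by
      intro r
      have h := Over.w p
      have h2 : p.left = Spec.map (Spec.preimage p.left) := (Spec.map_preimage _).symm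
      rw [h2] at h
      have h3 : Spec.map (Spec.preimage p.left) ≫ Spec.map (CommRingCat.ofHom (algebraMap k R)) =
        Spec.map (CommRingCat.ofHom (algebraMap k S)) := h
      rw [← Spec.map_comp] at h3
      have h4 := Spec.map_injective h3
      exact congr($(h4) r) }

@[simp] lemma SOmap_SOpre (p : SO k S ⟶ SO k R) : SOmap (SOpre p) = p := by
  ext1
  exact Spec.map_preimage _

lemma SOmap_injective : Function.Injective (SOmap : (R →ₐ[k] S) → _) := by
  intro f g h
  have := Spec.map_injective (congr(($h).left))
  ext x
  exact congr($(this) x)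

/-- binary product over `k` -/
def prodO (X Y : OverR k) : OverR k := Over.mk (pullback.fst X.hom Y.hom ≫ X.hom)
def fstO (X Y : OverR k) : prodO X Y ⟶ X := Over.homMk (pullback.fst X.hom Y.hom) rfl
def sndO (X Y : OverR k) : prodO X Y ⟶ Y :=
  Over.homMk (pullback.snd X.hom Y.hom) pullback.condition.symm
def liftO {T : OverR k} (a : T ⟶ X) (b : T ⟶ Y) : T ⟶ prodO X Y :=
  Over.homMk (pullback.lift a.left b.left ((Over.w a).trans (Over.w b).symm))
    (by
      have : pullback.lift a.left b.left ((Over.w a).trans (Over.w b).symm) ≫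
        pullback.fst X.hom Y.hom ≫ X.hom = T.hom := by
        rw [pullback.lift_fst_assoc]; exact Over.w a
      exact this)

@[simp] lemma liftO_fst {T : OverR k} (a : T ⟶ X) (b : T ⟶ Y) :
    liftO a b ≫ fstO X Y = a := by
  ext1; exact pullback.lift_fst _ _ _
@[simp] lemma liftO_snd {T : OverR k} (a : T ⟶ X) (b : T ⟶ Y) :
    liftO a b ≫ sndO X Y = b := by
  ext1; exact pullback.lift_snd _ _ _
@[simp] lemma liftO_fst_assoc {T W : OverR k} (a : T ⟶ X) (b : T ⟶ Y) (c : X ⟶ W) :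
    liftO a b ≫ fstO X Y ≫ c = a ≫ c := by
  rw [← Category.assoc, liftO_fst]
@[simp] lemma liftO_snd_assoc {T W : OverR k} (a : T ⟶ X) (b : T ⟶ Y) (c : Y ⟶ W) :
    liftO a b ≫ sndO X Y ≫ c = b ≫ c := by
  rw [← Category.assoc, liftO_snd]
lemma prodO_ext {T : OverR k} {a b : T ⟶ prodO X Y} (h1 : a ≫ fstO X Y = b ≫ fstO X Y)
    (h2 : a ≫ sndO X Y = b ≫ sndO X Y) : a = b := by
  ext1
  exact pullback.hom_ext congr(($h1).left) congr(($h2).left)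
lemma comp_liftO {T T' : OverR k} (c : T' ⟶ T) (a : T ⟶ X) (b : T ⟶ Y) :
    c ≫ liftO a b = liftO (c ≫ a) (c ≫ b) := by
  apply prodO_ext <;> simp
lemma liftO_eta {T : OverR k} (a : T ⟶ prodO X Y) :
    liftO (a ≫ fstO X Y) (a ≫ sndO X Y) = a := by
  apply prodO_ext <;> simp
lemma liftO_inj {T : OverR k} {a a' : T ⟶ X} {b b' : T ⟶ Y} :
    liftO a b = liftO a' b' ↔ a = a' ∧ b = b' := by
  refine ⟨fun h => ⟨by simpa using congr($h ≫ fstO X Y), by simpa using congr($h ≫ sndO X Y)⟩, ?_⟩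
  rintro ⟨rfl, rfl⟩; rfl

namespace GroupScheme
variable (Γ : GroupScheme k)

lemma mul_inv' {T : OverR k} (a : T ⟶ Γ.G) : Γ.mul a (Γ.inv a) = Γ.one T := by
  have h : ∀ b : T ⟶ Γ.G, Γ.mul b b = b → b = Γ.one T := by
    intro b hb
    have : Γ.mul (Γ.inv b) (Γ.mul b b) = Γ.mul (Γ.inv b) b := by rw [hb]
    rwa [← Γ.mul_assoc, Γ.inv_mul, Γ.one_mul] at this
  apply h
  rw [Γ.mul_assoc, ← Γ.mul_assoc (Γ.inv a), Γ.inv_mul, Γ.one_mul]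

lemma mul_one' {T : OverR k} (a : T ⟶ Γ.G) : Γ.mul a (Γ.one T) = a := by
  rw [← Γ.inv_mul a, ← Γ.mul_assoc, mul_inv', Γ.one_mul]

abbrev grp (T : OverR k) : Group (T ⟶ Γ.G) where
  mul := Γ.mul
  one := Γ.one T
  inv := Γ.inv
  mul_assoc := Γ.mul_assoc
  one_mul := Γ.one_mul
  mul_one := Γ.mul_one'
  inv_mul_cancel := Γ.inv_mul

lemma inv_natural {T T' : OverR k} (f : T ⟶ T') (a : T' ⟶ Γ.G) :
    f ≫ Γ.inv a = Γ.inv (f ≫ a) := by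
  let := Γ.grp T
  have : Γ.mul (f ≫ Γ.inv a) (f ≫ a) = Γ.one T := by
    rw [← Γ.mul_natural, Γ.inv_mul, Γ.one_natural]
  exact eq_inv_of_mul_eq_one_left (a := f ≫ Γ.inv a) (b := f ≫ a) this

/-- multiplication as a morphism -/
def m : prodO Γ.G Γ.G ⟶ Γ.G := Γ.mul (fstO _ _) (sndO _ _)

lemma liftO_m {T : OverR k} (a b : T ⟶ Γ.G) : liftO a b ≫ Γ.m = Γ.mul a b := by
  simp [m, mul_natural]

end GroupScheme

end P0

section P1
variable {k : Type} [Field k] {X Y Z : OverR k} {R S T : Type} [CommRing R] [Algebra k R]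
  [CommRing S] [Algebra k S] [CommRing T] [Algebra k T]

lemma exists_chart (X : OverR k) (x : X.left) :
    ∃ (B : Type) (_ : CommRing B) (_ : Algebra k B) (j : SO k B ⟶ X),
      IsOpenImmersion j.left ∧ x ∈ Set.range j.left := by
  obtain ⟨U, hU, hx, -⟩ := exists_isAffineOpen_mem_and_subset
    (x := x) (U := ⊤) trivial
  let h : Spec Γ(X.left, U) ⟶ SR k := hU.fromSpec ≫ X.hom
  let a : k →+* Γ(X.left, U) := (Spec.preimage h).hom
  let : Algebra k Γ(X.left, U) := a.toAlgebra
  refine ⟨Γ(X.left, U), inferInstance, inferInstance, Over.homMk hU.fromSpec ?_, ?_, ?_⟩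
  · exact (Spec.map_preimage h).symm
  · exact inferInstanceAs (IsOpenImmersion hU.fromSpec)
  · change x ∈ Set.range hU.fromSpec
    rw [hU.range_fromSpec]
    exact hx

lemma chart_finiteType [LocallyOfFiniteType X.hom] {B : Type} [CommRing B] [Algebra k B]
    (j : SO k B ⟶ X) [IsOpenImmersion j.left] : Algebra.FiniteType k B := by
  have h : LocallyOfFiniteType (j.left ≫ X.hom) := inferInstance
  rw [Over.w j] at h
  have h2 : LocallyOfFiniteType (Spec.map (CommRingCat.ofHom (algebraMap k B))) := h
  rw [HasRingHomProperty.Spec_iff (P := @LocallyOfFiniteType)] at h2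
  exact RingHom.finiteType_algebraMap.1 h2

lemma liftChart {U T : OverR k} (j : U ⟶ X) [IsOpenImmersion j.left] (y : T ⟶ X)
    (h : Set.range y.left ⊆ Set.range j.left) : ∃ z : T ⟶ U, z ≫ j = y := by
  refine ⟨Over.homMk (IsOpenImmersion.lift j.left y.left h) ?_, ?_⟩
  · rw [← Over.w j, ← Category.assoc, IsOpenImmersion.lift_fac, Over.w]
  · ext1
    exact IsOpenImmersion.lift_fac _ _ _

/-- the closed point of a point with values in a local ring -/
def Pt.cl [IsLocalRing R] (y : Pt X R) : X.left := y.left (IsLocalRing.closedPoint R)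

lemma range_subset_of_cl [IsLocalRing R] (y : Pt X R) (U : Set X.left) (hU : IsOpen U)
    (h : y.cl ∈ U) : Set.range y.left ⊆ U := by
  rintro _ ⟨z, rfl⟩
  have h1 : z ⤳ IsLocalRing.closedPoint R := IsLocalRing.specializes_closedPoint z
  exact (h1.map y.left.continuous).mem_open hU h

lemma liftChart_local [IsLocalRing R] {U : OverR k} (j : U ⟶ X) [IsOpenImmersion j.left]
    (y : Pt X R) (h : y.cl ∈ Set.range j.left) : ∃ z : Pt U R, z ≫ j = y :=
  liftChart j y (range_subset_of_cl y _ j.left.isOpenEmbedding.isOpen_range h)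

lemma cl_comp [IsLocalRing R] (y : Pt X R) (p : X ⟶ Y) :
    Pt.cl (y ≫ p : Pt Y R) = p.left y.cl := by
  exact Scheme.Hom.comp_apply y.left p.left _

lemma isDominant_SOmap [IsReduced R] (f : R →ₐ[k] S) (hf : Function.Injective f) :
    IsDominant (SOmap f).left := by
  constructor
  have h := (PrimeSpectrum.denseRange_comap_iff_ker_le_nilRadical (f := f.toRingHom)).2 (by
    rw [(RingHom.injective_iff_ker_eq_bot f.toRingHom).1 hf]; exact bot_le)
  exact h

lemma ext_dominant {A B C : OverR k} [IsReduced B.left] [IsSeparated C.hom] (d : A ⟶ B)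
    [IsDominant d.left] {f g : B ⟶ C} (h : d ≫ f = d ≫ g) : f = g := by
  ext1
  exact ext_of_isDominant_of_isSeparated (f := f.left) (g := g.left) C.hom
    ((Over.w f).trans (Over.w g).symm) d.left congr(($h).left)

lemma Pt.map_injective [IsSeparated X.hom] [IsReduced R] (f : R →ₐ[k] S)
    (hf : Function.Injective f) : Function.Injective (Pt.map (X := X) f) := by
  intro a b h
  have := isDominant_SOmap f hf
  have : IsReduced (SO k R).left := inferInstanceAs (IsReduced (Spec (.of R)))
  exact ext_dominant (SOmap f) h

lemma Pt.exists_extend [IsProper X.hom] [IsDomain R] [ValuationRing R] {F : Type} [Field F]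
    [Algebra k F] [Algebra R F] [IsScalarTower k R F] [IsFractionRing R F] (y : Pt X F) :
    ∃ z : Pt X R, z.map (IsScalarTower.toAlgHom k R F) = y := by
  have hv := (IsProper.eq_valuativeCriterion ▸ (inferInstanceAs (IsProper X.hom)) :
    (ValuativeCriterion ⊓ @QuasiCompact ⊓ @QuasiSeparated ⊓ @LocallyOfFiniteType :
      MorphismProperty Scheme) X.hom)
  have hE := hv.1.1.1.existence
  have hsq : CommSq y.left (Spec.map (CommRingCat.ofHom (algebraMap R F))) X.hom
      (SO k R).hom := by
    constructor
    rw [Over.w y]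
    simp only [Over.mk_hom, ← Spec.map_comp, ← CommRingCat.ofHom_comp]
    congr 2
    exact IsScalarTower.algebraMap_eq k R F
  obtain ⟨⟨l⟩⟩ := hE { R := R, K := F, i₁ := y.left, i₂ := (SO k R).hom, commSq := hsq }
  refine ⟨Over.homMk l.l l.fac_right, ?_⟩
  ext1
  exact l.fac_left

lemma kpt_w (p : Pt X k) : p.left ≫ X.hom = 𝟙 _ := (Over.w p).trans (Spec.map_id (CommRingCat.of k))

section closed
variable [IsAlgClosed k] [LocallyOfFiniteType X.hom]

lemma exists_kpt (x : X.left) (hx : IsClosed {x}) : ∃ p : Pt X k, p.cl = x := by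
  refine ⟨Over.homMk (pointOfClosedPoint X.hom x hx) ?_, ?_⟩
  · rw [pointOfClosedPoint_comp]
    exact (Spec.map_id (CommRingCat.of k)).symm
  · exact pointOfClosedPoint_apply X.hom x hx _

lemma kpt_closed (p : Pt X k) : IsClosed {p.cl} :=
  ((pointEquivClosedPoint X.hom) ⟨p.left, kpt_w p⟩).2

lemma kpt_ext {p q : Pt X k} (h : p.cl = q.cl) : p = q := by
  ext1
  exact ext_of_apply_closedPoint_eq X.hom (kpt_w p) (kpt_w q) h
end closed

end P1

section P2
variable {k : Type} [Field k]

lemma derivation_nilpotent [CharZero k] {A : Type} [CommRing A] [Algebra k A]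
    (D : Derivation k A A) {f : A} (hf : IsNilpotent f) : IsNilpotent (D f) := by
  obtain ⟨n, hn⟩ := hf
  have key : ∀ j, j ≤ n → f ^ (n - j) * (D f) ^ (2 * j) = 0 := by
    intro j
    induction j with
    | zero => intro _; simpa using hn
    | succ j ih =>
      intro hj
      have h1 := ih (by omega)
      obtain ⟨m, hm⟩ : ∃ m, n - j = m + 1 := ⟨n - j - 1, by omega⟩
      have hm2 : n - (j + 1) = m := by omega
      rw [hm] at h1
      rw [hm2]
      have h2 := congrArg (fun z => D z * D f) h1
      simp only [Derivation.leibniz, Derivation.leibniz_pow, map_zero, zero_mul,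
        smul_eq_mul, nsmul_eq_mul] at h2
      have h3 : ((m + 1 : ℕ) : A) * (f ^ m * D f ^ (2 * (j + 1))) = 0 := by
        have h4 : f ^ (m + 1) * (((2 * j : ℕ) : A) * (D f ^ (2 * j - 1) * D (D f))) * D f = 0 := by
          rcases Nat.eq_zero_or_pos j with rfl | hjp
          · simp
          · have : D f ^ (2 * j - 1) * D f = D f ^ (2 * j) := by
              rw [← pow_succ]; congr 1; omega
            calc _ = ((2 * j : ℕ) : A) * D (D f) * (f ^ (m + 1) * (D f ^ (2 * j - 1) * D f)) := by
                  ring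
              _ = 0 := by rw [this, h1, mul_zero]
        have h5 : D f ^ (2 * j) * (((m + 1 : ℕ) : A) * (f ^ (m + 1 - 1) * D f)) * D f = 0 := by
          linear_combination h2 - h4
        rw [Nat.add_sub_cancel] at h5
        rw [← h5]; ring
      have hu : ((m + 1 : ℕ) : A) = algebraMap k A ((m + 1 : ℕ) : k) := by simp
      rw [hu, ← Algebra.smul_def] at h3
      have hne : ((m + 1 : ℕ) : k) ≠ 0 := by exact_mod_cast Nat.succ_ne_zero m
      exact (smul_eq_zero_iff_right hne).1 h3
  have := key n le_rfl
  rw [Nat.sub_self, pow_zero, one_mul] at this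
  exact ⟨_, this⟩

open IsLocalRing in
lemma cartier_alg [CharZero k] {A : Type} [CommRing A] [Algebra k A] [IsLocalRing A]
    [IsNoetherianRing A] {ι : Type} [Fintype ι] (D : ι → Derivation k A A) (x : ι → A)
    (hx : ∀ i, x i ∈ maximalIdeal A)
    (hE : ∀ y ∈ maximalIdeal A, (∑ i, x i * D i y) - y ∈ maximalIdeal A ^ 2) :
    IsReduced A := by
  set m := maximalIdeal A with hm
  let E : A → A := fun y => ∑ i, x i * D i y
  have Emul : ∀ a b, E (a * b) = a * E b + b * E a := by
    intro a b
    simp only [E, Derivation.leibniz, smul_eq_mul, mul_add, Finset.sum_add_distrib, Finset.mul_sum]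
    congr 1 <;> refine Finset.sum_congr rfl fun i _ => by ring
  have Eadd : ∀ a b, E (a + b) = E a + E b := by
    intro a b; simp [E, mul_add, Finset.sum_add_distrib]
  have key : ∀ d : ℕ, ∀ y ∈ m ^ (d + 1), E y - ((d + 1 : ℕ) : A) * y ∈ m ^ (d + 2) := by
    intro d
    induction d with
    | zero => intro y hy; simpa using hE y (by simpa using hy)
    | succ d ih =>
      intro y hy
      rw [pow_succ] at hy
      refine Submodule.mul_induction_on hy ?_ ?_
      · intro a ha b hb
        have h1 := Ideal.mul_mem_mul (ih a ha) hb
        have h2 := Ideal.mul_mem_mul ha (hE b hb)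
        rw [← pow_succ] at h1
        rw [← pow_add] at h2
        have : E (a * b) - ((d + 1 + 1 : ℕ) : A) * (a * b)
          = (E a - ((d + 1 : ℕ) : A) * a) * b + a * (E b - b) := by
          rw [Emul]; push_cast; ring
        rw [this]
        exact Ideal.add_mem _ h1 h2
      · intro a b ha hb
        have : E (a + b) - ((d + 1 + 1 : ℕ) : A) * (a + b) =
          (E a - ((d + 1 + 1 : ℕ) : A) * a) + (E b - ((d + 1 + 1 : ℕ) : A) * b) := by
          rw [Eadd]; ring
        rw [this]
        exact Ideal.add_mem _ ha hb
  have hN : ∀ d, nilradical A ≤ m ^ (d + 1) := by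
    intro d
    induction d with
    | zero =>
      rw [zero_add, pow_one]
      intro f hf
      exact (mem_maximalIdeal f).2 (fun hu => by
        obtain ⟨n, hn⟩ := (mem_nilradical.1 hf)
        have := hu.pow n
        rw [hn] at this
        exact not_isUnit_zero this)
    | succ d ih =>
      intro f hf
      have h1 := key d f (ih hf)
      have h2 : E f ∈ m ^ (d + 2) := by
        refine Ideal.sum_mem _ fun i _ => ?_
        rw [pow_succ' m (d + 1)]
        exact Ideal.mul_mem_mul (hx i) (ih (mem_nilradical.2
          (derivation_nilpotent (D i) (mem_nilradical.1 hf))))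
      have h3 : ((d + 1 : ℕ) : A) * f ∈ m ^ (d + 2) := by
        have := Ideal.sub_mem _ h2 h1
        simpa using this
      have h4 := Ideal.mul_mem_left (m ^ (d + 2)) (algebraMap k A (((d + 1 : ℕ) : k)⁻¹)) h3
      have hne : ((d + 1 : ℕ) : k) ≠ 0 := by exact_mod_cast Nat.succ_ne_zero d
      have hu : ((d + 1 : ℕ) : A) = algebraMap k A ((d + 1 : ℕ) : k) := by simp
      rwa [hu, ← mul_assoc, ← map_mul, inv_mul_cancel₀ hne, map_one, one_mul] at h4
  rw [← nilradical_eq_bot_iff, eq_bot_iff, ← Ideal.iInf_pow_eq_bot_of_isLocalRing m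
    (Ideal.IsPrime.ne_top')]
  refine le_iInf fun d => (hN d).trans (Ideal.pow_le_pow_right (Nat.le_succ d))

open IsLocalRing in
/-- existence of a good dual system in a local ring with residue field `k` -/
lemma exists_dual_system {A : Type} [CommRing A] [Algebra k A] [IsLocalRing A]
    [IsNoetherianRing A] (χ : A →ₐ[k] k) (hχ : ∀ a, a ∈ maximalIdeal A ↔ χ a = 0) :
    ∃ (n : ℕ) (x : Fin n → A) (δ : Fin n → (A →ₗ[k] k)),
      (∀ i, x i ∈ maximalIdeal A) ∧
      (∀ i a b, δ i (a * b) = χ a * δ i b + χ b * δ i a) ∧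
      (∀ y ∈ maximalIdeal A, (∑ i, x i * algebraMap k A (δ i y)) - y ∈ maximalIdeal A ^ 2) := by
  let m := maximalIdeal A
  let V := m.Cotangent
  have hsm : ∀ (a : A) (v : V), a • v = χ a • v := by
    intro a v
    have h1 : a - algebraMap k A (χ a) ∈ m := by rw [hχ]; simp
    have h2 := Ideal.Cotangent.smul_eq_zero_of_mem h1 v
    rw [sub_smul, sub_eq_zero] at h2
    rw [h2, algebraMap_smul]
  have hfin : Module.Finite k V := by
    obtain ⟨s, hs⟩ := (Module.Finite.of_surjective m.toCotangent m.toCotangent_surjective :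
      Module.Finite A V)
    refine ⟨s, ?_⟩
    rw [eq_top_iff]
    intro v _
    have hv : v ∈ Submodule.span A (s : Set V) := by rw [hs]; trivial
    induction hv using Submodule.span_induction with
    | mem x h => exact Submodule.subset_span h
    | zero => exact Submodule.zero_mem _
    | add x y _ _ hx hy => exact Submodule.add_mem _ (hx trivial) (hy trivial)
    | smul a x _ hx => rw [hsm]; exact Submodule.smul_mem _ _ (hx trivial)
  let b := Module.finBasis k V
  choose x hx using fun i => m.toCotangent_surjective (b i)
  let pr : A →ₗ[k] m :=
    { toFun := fun a => ⟨a - algebraMap k A (χ a), by rw [hχ]; simp⟩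
      map_add' := by intro a b; ext; simp; ring
      map_smul' := by
        intro c a; ext
        simp [Algebra.smul_def, mul_sub] }
  let tc : m →ₗ[k] V := m.toCotangent.restrictScalars k
  refine ⟨Module.finrank k V, fun i => (x i : A), fun i => (b.coord i) ∘ₗ tc ∘ₗ pr,
    fun i => (x i).2, ?_, ?_⟩
  · intro i a c
    have h : tc (pr (a * c)) = χ a • tc (pr c) + χ c • tc (pr a) := by
      have e1 : χ a • tc (pr c) + χ c • tc (pr a) = tc (χ a • pr c + χ c • pr a) := by simp
      rw [e1]
      refine (Ideal.toCotangent_eq m).2 ?_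
      have : ((pr (a * c) : A) - ((χ a • pr c + χ c • pr a : m) : A)) = (pr a : A) * pr c := by
        simp [pr, Algebra.smul_def]
        ring
      rw [this, pow_two]
      exact Ideal.mul_mem_mul (pr a).2 (pr c).2
    simp [h]
  · intro y hy
    have hpr : pr y = ⟨y, hy⟩ := by
      ext; simp [pr, (hχ y).1 hy]
    have h1 : tc (∑ i, (b.coord i (tc (pr y))) • x i) = tc ⟨y, hy⟩ := by
      rw [map_sum]
      simp only [map_smul]
      have : ∀ i, tc (x i) = b i := hx
      simp only [this, hpr]
      exact b.sum_repr _
    have h2 := (Ideal.toCotangent_eq m).1 h1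
    convert h2 using 2
    simp [Algebra.smul_def, mul_comm]

end P2

section P3
variable {k : Type} [Field k] {X : OverR k}

lemma cl_map {R S : Type} [CommRing R] [Algebra k R] [CommRing S] [Algebra k S] [IsLocalRing R]
    [IsLocalRing S] (f : R →ₐ[k] S) [IsLocalHom f.toRingHom] (y : Pt X R) :
    (y.map f).cl = y.cl := by
  have h := IsLocalRing.comap_closedPoint f.toRingHom
  have h2 : (y.map f).cl = y.left ((SOmap f).left (IsLocalRing.closedPoint S)) :=
    Scheme.Hom.comp_apply _ _ _
  rw [h2]
  exact congrArg y.left h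

/-- functoriality of dual numbers -/
def dnMap {A C : Type} [CommRing A] [Algebra k A] [CommRing C] [Algebra k C] (f : A →ₐ[k] C) :
    DualNumber A →ₐ[k] DualNumber C where
  toFun x := (f x.fst, f x.snd)
  map_one' := by ext <;> simp
  map_zero' := by ext <;> simp
  map_add' x y := by
    refine TrivSqZeroExt.ext ?_ ?_
    · exact (map_add f x.fst y.fst)
    · exact (map_add f x.snd y.snd)
  map_mul' x y := by
    refine TrivSqZeroExt.ext ?_ ?_
    · change f (x * y).fst = f x.fst * f y.fst
      simp
    · change f (x * y).snd = f x.fst • f y.snd + MulOpposite.op (f y.fst) • f x.snd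
      simp [TrivSqZeroExt.snd_mul]
  commutes' r := by
    refine TrivSqZeroExt.ext ?_ ?_
    · change f (algebraMap k A r) = algebraMap k C r
      simp
    · change f 0 = 0
      simp

instance dn_local {A : Type} [CommRing A] [IsLocalRing A] : IsLocalRing (DualNumber A) := by
  let f : DualNumber A →+* A := (TrivSqZeroExt.fstHom A A A).toRingHom
  have : IsLocalHom f := ⟨fun a ha => (TrivSqZeroExt.isUnit_iff_isUnit_fst (x := a)).2 ha⟩
  exact RingHom.domain_isLocalRing f

instance dn_fst_local {A : Type} [CommRing A] [Algebra k A] :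
    IsLocalHom (TrivSqZeroExt.fstHom k A A).toRingHom :=
  ⟨fun a ha => (TrivSqZeroExt.isUnit_iff_isUnit_fst (x := a)).2 ha⟩

/-- a local point with the right centre factors through the local ring of a chart -/
lemma factor_local {B : Type} [CommRing B] [Algebra k B] (j : SO k B ⟶ X) [IsOpenImmersion j.left]
    (m : Ideal B) [m.IsPrime] {R : Type} [CommRing R] [Algebra k R] [IsLocalRing R] (y : Pt X R)
    (h : y.cl = Pt.cl (SOmap (IsScalarTower.toAlgHom k B (Localization.AtPrime m)) ≫ j)) :
    ∃ ψ : Localization.AtPrime m →ₐ[k] R,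
      SOmap ψ ≫ SOmap (IsScalarTower.toAlgHom k B (Localization.AtPrime m)) ≫ j = y := by
  obtain ⟨z, hz⟩ := liftChart_local j y (by rw [h, cl_comp]; exact ⟨_, rfl⟩)
  subst hz
  obtain ⟨φ, rfl⟩ : ∃ φ, z = SOmap φ := ⟨SOpre z, (SOmap_SOpre z).symm⟩
  rw [cl_comp, cl_comp] at h
  have h1 := j.left.isOpenEmbedding.injective h
  have h2 : (IsLocalRing.maximalIdeal R).comap φ.toRingHom = m := by
    have h3 : PrimeSpectrum.comap φ.toRingHom (IsLocalRing.closedPoint R) =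
      PrimeSpectrum.comap (algebraMap B (Localization.AtPrime m)) (IsLocalRing.closedPoint _) := h1
    have h4 := congrArg PrimeSpectrum.asIdeal h3
    exact h4.trans (Localization.AtPrime.under_maximalIdeal (I := m))
  have hu : ∀ b : m.primeCompl, IsUnit (φ b) := by
    intro b
    by_contra hb
    have : (b : B) ∈ (IsLocalRing.maximalIdeal R).comap φ.toRingHom := hb
    rw [h2] at this
    exact b.2 this
  refine ⟨IsLocalization.liftAlgHom (M := m.primeCompl) (f := φ) hu, ?_⟩
  rw [← Category.assoc, ← SOmap_comp]
  congr 2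
  ext b
  simp

lemma residue_char {k : Type} [Field k] [IsAlgClosed k] {B : Type} [CommRing B] [Algebra k B]
    [Algebra.FiniteType k B] (m : Ideal B) [hm : m.IsMaximal] :
    ∃ χ : B →ₐ[k] k, RingHom.ker χ = m := by
  let : Field (B ⧸ m) := Ideal.Quotient.field m
  have : Module.Finite k (B ⧸ m) := finite_of_finite_type_of_isJacobsonRing k (B ⧸ m)
  have hb : Function.Bijective (algebraMap k (B ⧸ m)) :=
    IsAlgClosed.algebraMap_bijective_of_isIntegral
  let e : k ≃ₐ[k] (B ⧸ m) := AlgEquiv.ofBijective (Algebra.ofId k _) hb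
  refine ⟨(e.symm : (B ⧸ m) →ₐ[k] k).comp (Ideal.Quotient.mkₐ k m), ?_⟩
  ext b
  simp [RingHom.mem_ker, Ideal.Quotient.eq_zero_iff_mem]

variable [IsAlgClosed k] [CharZero k] (Γ : GroupScheme k) [LocallyOfFiniteType Γ.G.hom]

lemma cartier_chart {B : Type} [CommRing B] [Algebra k B] (j : SO k B ⟶ Γ.G)
    [IsOpenImmersion j.left] (m : Ideal B) [hm : m.IsMaximal] :
    IsReduced (Localization.AtPrime m) := by
  have : Algebra.FiniteType k B := chart_finiteType j
  have : IsNoetherianRing B := Algebra.FiniteType.isNoetherianRing k B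
  set A := Localization.AtPrime m with hA
  have : IsNoetherianRing A := IsLocalization.isNoetherianRing m.primeCompl A inferInstance
  obtain ⟨χ₀, hχ₀⟩ := residue_char (k := k) m
  let χ : A →ₐ[k] k := IsLocalization.liftAlgHom (M := m.primeCompl) (f := χ₀) (by
    intro b
    rw [isUnit_iff_ne_zero]
    intro h
    exact b.2 (hχ₀ ▸ h))
  have hχ : ∀ a, a ∈ IsLocalRing.maximalIdeal A ↔ χ a = 0 := by
    have hs : Function.Surjective χ.toRingHom := fun c => ⟨algebraMap k A c, χ.commutes c⟩
    have h1 : (RingHom.ker χ.toRingHom).IsMaximal := RingHom.ker_isMaximal_of_surjective _ hs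
    have h2 := IsLocalRing.eq_maximalIdeal h1
    intro a
    rw [← h2]; rfl
  have hχl : IsLocalHom χ.toRingHom := by
    constructor
    intro a ha
    by_contra hna
    have : a ∈ IsLocalRing.maximalIdeal A := hna
    rw [hχ] at this
    change IsUnit (χ a) at ha
    rw [this] at ha
    exact not_isUnit_zero ha
  obtain ⟨n, x, δ, hx, hδ, hE⟩ := exists_dual_system χ hχ
  let a : Pt Γ.G A := SOmap (IsScalarTower.toAlgHom k B A) ≫ j
  let p : Pt Γ.G k := a.map χ
  have hnat : ∀ {R S : Type} [CommRing R] [Algebra k R] [CommRing S] [Algebra k S]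
      (f : R →ₐ[k] S) (u v : Pt Γ.G R), Pt.map f (Γ.mul u v : Pt Γ.G R) = Γ.mul (u.map f) (v.map f) :=
    fun f u v => Γ.mul_natural _ _ _
  have hinv : ∀ {R S : Type} [CommRing R] [Algebra k R] [CommRing S] [Algebra k S]
      (f : R →ₐ[k] S) (u : Pt Γ.G R), Pt.map f (Γ.inv u : Pt Γ.G R) = Γ.inv (u.map f) :=
    fun f u => Γ.inv_natural _ _
  have key : ∀ i, ∃ D : Derivation k A A, ∀ f, χ (D f) = δ i f := by
    intro i
    have hδ1 : δ i 1 = 0 := by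
      have := hδ i 1 1
      simp at this
      exact this
    let β : A →ₐ[k] DualNumber k :=
      { toFun := fun f => (χ f, δ i f)
        map_one' := TrivSqZeroExt.ext (map_one χ) hδ1
        map_zero' := TrivSqZeroExt.ext (map_zero χ) (map_zero (δ i))
        map_add' := fun u v => TrivSqZeroExt.ext (map_add χ u v) (map_add (δ i) u v)
        map_mul' := fun u v => by
          refine TrivSqZeroExt.ext (map_mul χ u v) ?_
          change δ i (u * v) = χ u • δ i v + MulOpposite.op (χ v) • δ i u
          rw [hδ i u v]
          simp [mul_comm]
        commutes' := fun r => by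
          refine TrivSqZeroExt.ext (χ.commutes r) ?_
          change δ i (algebraMap k A r) = 0
          rw [Algebra.algebraMap_eq_smul_one, map_smul, hδ1, smul_zero] }
    let inl : A →ₐ[k] DualNumber A := TrivSqZeroExt.inlAlgHom k A A
    let inlk : k →ₐ[k] DualNumber A := Algebra.ofId k _
    let fs : DualNumber A →ₐ[k] A := TrivSqZeroExt.fstHom k A A
    let b : Pt Γ.G (DualNumber A) := (a.map β).map (dnMap (Algebra.ofId k A))
    let y : Pt Γ.G (DualNumber A) := Γ.mul (a.map inl) (Γ.mul (Γ.inv (p.map inlk)) b)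
    let := Γ.grp (SO k A)
    let := Γ.grp (SO k (DualNumber k))
    have hy1 : y.map fs = a := by
      have e1 : (a.map inl).map fs = a := by
        rw [Pt.map_map]; exact Pt.map_id a
      have e2 : b.map fs = (p.map inlk).map fs := by
        simp only [b, p, Pt.map_map]
        congr 1
      simp only [y, hnat, hinv, e1, e2]
      exact mul_eq_left.2 (inv_mul_cancel ((p.map inlk).map fs))
    have hy2 : y.map (dnMap χ) = a.map β := by
      have e1 : (a.map inl).map (dnMap χ) = (p.map inlk).map (dnMap χ) := by
        simp only [p, Pt.map_map]
        congr 1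
        refine AlgHom.ext fun f => ?_
        have : dnMap χ (inlk (χ f)) = algebraMap k (DualNumber k) (χ f) :=
          ((dnMap χ).comp inlk).commutes (χ f)
        change dnMap χ (inl f) = dnMap χ (inlk (χ f))
        rw [this]
        refine TrivSqZeroExt.ext rfl ?_
        change χ 0 = 0
        exact map_zero χ
      have e2 : b.map (dnMap χ) = a.map β := by
        simp only [b, Pt.map_map]
        congr 1
        refine AlgHom.ext fun f => ?_
        refine TrivSqZeroExt.ext ?_ ?_
        · change χ (algebraMap k A (χ f)) = χ f
          simp
        · change χ (algebraMap k A (δ i f)) = δ i f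
          simp
      simp only [y, hnat, hinv, e1, e2]
      exact mul_inv_cancel_left ((p.map inlk).map (dnMap χ)) (a.map β)
    have hcl : y.cl = a.cl := by rw [← cl_map fs y, hy1]
    obtain ⟨ψ, hψ⟩ := factor_local j m y hcl
    have hmono : ∀ {R : Type} [CommRing R] [Algebra k R] (u v : A →ₐ[k] R),
        a.map u = a.map v → u = v := by
      intro R _ _ u v huv
      have : Mono j.left := inferInstance
      have hj : Mono j := Over.mono_of_mono_left j
      simp only [Pt.map, a, ← Category.assoc, ← SOmap_comp] at huv
      have h1 := SOmap_injective ((cancel_mono j).1 huv)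
      have h2 : u.toRingHom.comp (algebraMap B A) = v.toRingHom.comp (algebraMap B A) := by
        ext b; exact congr($h1 b)
      have := IsLocalization.ringHom_ext m.primeCompl h2
      exact AlgHom.ext fun z => congr($this z)
    have hψ' : a.map ψ = y := hψ
    have h1 : fs.comp ψ = AlgHom.id k A := by
      apply hmono
      rw [← Pt.map_map, hψ', hy1, Pt.map_id]
    have h2 : (dnMap χ).comp ψ = β := by
      apply hmono
      rw [← Pt.map_map, hψ', hy2]
    have hfst : ∀ f, (ψ f).fst = f := fun f => congr($h1 f)
    refine ⟨Derivation.mk' ((TrivSqZeroExt.sndHom A A).restrictScalars k ∘ₗ ψ.toLinearMap) ?_, ?_⟩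
    · intro u v
      change (ψ (u * v)).snd = u • (ψ v).snd + v • (ψ u).snd
      rw [map_mul, TrivSqZeroExt.snd_mul, hfst, hfst]
      simp [mul_comm]
    · intro f
      have := congr(($h2 f).snd)
      exact this
  choose D hD using key
  refine cartier_alg D x hx ?_
  intro y hy
  have h1 := hE y hy
  have h2 : ∑ i, x i * (D i y - algebraMap k A (δ i y)) ∈ IsLocalRing.maximalIdeal A ^ 2 := by
    refine Ideal.sum_mem _ fun i _ => ?_
    rw [pow_two]
    refine Ideal.mul_mem_mul (hx i) ?_
    rw [hχ]
    simp [hD]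
  have := Ideal.add_mem _ h1 h2
  convert this using 1
  simp only [mul_sub, Finset.sum_sub_distrib]
  ring

/-- Cartier's theorem -/
theorem cartier : IsReduced Γ.G.left := by
  have hst : ∀ x : Γ.G.left, _root_.IsReduced (Γ.G.left.presheaf.stalk x) := by
    intro x
    obtain ⟨B, _, _, j, hj, z, rfl⟩ := exists_chart Γ.G x
    have hB : _root_.IsReduced B := by
      refine ⟨fun f hf => ?_⟩
      refine eq_zero_of_localization f (fun m hm => ?_)
      have := cartier_chart Γ j m
      exact (hf.map (algebraMap B (Localization.AtPrime m))).eq_zero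
    have hS : IsReduced (Spec (.of B)) := inferInstance
    have hS' : _root_.IsReduced ((SO k B).left.presheaf.stalk z) :=
      inferInstanceAs (_root_.IsReduced ((Spec (.of B)).presheaf.stalk z))
    have : IsIso (j.left.stalkMap z) := inferInstance
    exact isReduced_of_injective (j.left.stalkMap z).hom
      ((ConcreteCategory.bijective_of_isIso (j.left.stalkMap z)).1)
  exact isReduced_of_isReduced_stalk _

end P3

section P4
variable {k : Type} [Field k]

variable (k) in
/-- `k[[s]][[t]]` -/
abbrev DD := PowerSeries (PowerSeries k)

def cf (f : DD k) (i j : ℕ) : k := PowerSeries.coeff i (PowerSeries.coeff j f)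

lemma DD_ext {f g : DD k} (h : ∀ i j, cf f i j = cf g i j) : f = g := by
  ext j i
  exact h i j

lemma cf_mul (f g : DD k) (i j : ℕ) : cf (f * g) i j =
    ∑ b ∈ Finset.HasAntidiagonal.antidiagonal j, ∑ a ∈ Finset.HasAntidiagonal.antidiagonal i, cf f a.1 b.1 * cf g a.2 b.2 := by
  simp [cf, PowerSeries.coeff_mul]

lemma cf_add (f g : DD k) (i j : ℕ) : cf (f + g) i j = cf f i j + cf g i j := by simp [cf]

lemma cf_algebraMap (c : k) (i j : ℕ) : cf (algebraMap k (DD k) c) i j =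
    if i = 0 ∧ j = 0 then c else 0 := by
  have : algebraMap k (DD k) c = PowerSeries.C (PowerSeries.C c) := by
    rw [PowerSeries.algebraMap_apply, PowerSeries.algebraMap_apply]; rfl
  rw [this, cf, PowerSeries.coeff_C]
  split_ifs with h h1 h1
  · simp [PowerSeries.coeff_C, h1]
  · rw [PowerSeries.coeff_C, if_neg]; tauto
  · tauto
  · simp

lemma cf_zero (i j : ℕ) : cf (0 : DD k) i j = 0 := by simp [cf]

/-- exchanging the variables -/
def swapD : DD k →ₐ[k] DD k where
  toFun f := PowerSeries.mk fun j => PowerSeries.mk fun i => cf f j i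
  map_one' := DD_ext fun i j => by
    have := cf_algebraMap (1 : k)
    simp only [map_one] at this
    simp [cf] at this ⊢
    simp [this, and_comm]
  map_zero' := DD_ext fun i j => by simp [cf]
  map_add' f g := DD_ext fun i j => by simp [cf]
  map_mul' f g := DD_ext fun i j => by
    rw [cf_mul]
    have : cf (PowerSeries.mk fun j => PowerSeries.mk fun i => cf (f * g) j i) i j =
      cf (f * g) j i := by simp [cf]
    rw [this, cf_mul, Finset.sum_comm]
    simp [cf]
  commutes' c := DD_ext fun i j => by
    have := cf_algebraMap c
    rw [this]
    have h2 : cf (PowerSeries.mk fun j => PowerSeries.mk fun i => cf (algebraMap k (DD k) c) j i) i j =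
      cf (algebraMap k (DD k) c) j i := by simp [cf]
    rw [h2, this]
    simp [and_comm]

@[simp] lemma cf_swapD (f : DD k) (i j : ℕ) : cf (swapD f) i j = cf f j i := by
  simp [swapD, cf]

lemma swapD_swapD (f : DD k) : swapD (swapD f) = f := DD_ext fun i j => by simp

lemma swapD_injective : Function.Injective (swapD (k := k)) :=
  Function.LeftInverse.injective (g := swapD) swapD_swapD

/-! ### the monomial homomorphism -/

/-- weight -/
def wt (r : ℝ) (p : ℕ × ℕ) : ℝ := p.1 + r * p.2

lemma wt_add (r : ℝ) (p q : ℕ × ℕ) : wt r (p + q) = wt r p + wt r q := by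
  simp [wt]; ring

lemma wt_finite {r : ℝ} (hr : 0 < r) (ρ : ℝ) : {p : ℕ × ℕ | wt r p ≤ ρ}.Finite := by
  refine ((Finset.range (⌊ρ⌋₊ + 1)) ×ˢ (Finset.range (⌊ρ / r⌋₊ + 1))).finite_toSet.subset ?_
  rintro ⟨i, j⟩ h
  simp only [wt, Set.mem_ofPred_eq] at h
  have hi : (0 : ℝ) ≤ i := by positivity
  have hj : (0 : ℝ) ≤ r * j := by positivity
  simp only [Finset.coe_product, Set.mem_prod, Finset.coe_range, Set.mem_Iio]
  constructor
  · rw [Nat.lt_succ_iff]; exact Nat.le_floor (by linarith)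
  · rw [Nat.lt_succ_iff]; refine Nat.le_floor ?_
    rw [le_div_iff₀ hr]; linarith

/-- term -/
def tm (f : DD k) (p : ℕ × ℕ) : RatFunc k :=
  algebraMap (Polynomial k) (RatFunc k) (Polynomial.monomial p.2 (cf f p.1 p.2))

lemma tm_add (f g : DD k) (p : ℕ × ℕ) : tm (f + g) p = tm f p + tm g p := by
  simp [tm, cf_add]

lemma tm_mul (f g : DD k) (p : ℕ × ℕ) : tm (f * g) p =
    ∑ b ∈ Finset.HasAntidiagonal.antidiagonal p.2, ∑ a ∈ Finset.HasAntidiagonal.antidiagonal p.1,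
      tm f (a.1, b.1) * tm g (a.2, b.2) := by
  simp only [tm, cf_mul, map_sum]
  refine Finset.sum_congr rfl fun b hb => Finset.sum_congr rfl fun a ha => ?_
  rw [← map_mul, Polynomial.monomial_mul_monomial]
  rw [Finset.HasAntidiagonal.mem_antidiagonal] at hb
  rw [hb]

def fam {r : ℝ} (hr : 0 < r) (f : DD k) : HahnSeries.SummableFamily ℝ (RatFunc k) (ℕ × ℕ) where
  toFun p := HahnSeries.single (wt r p) (tm f p)
  isPWO_iUnion_support' := by
    refine Set.IsPWO.mono (t := Set.range (wt r)) ?_ ?_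
    · rw [← Set.image_univ]
      refine Set.IsPWO.image_of_monotone (Set.isPWO_of_wellQuasiOrderedLE _) ?_
      intro p q h
      have h1 : (p.1 : ℝ) ≤ q.1 := by exact_mod_cast h.1
      have h2 : (p.2 : ℝ) ≤ q.2 := by exact_mod_cast h.2
      simp only [wt]
      gcongr
    · refine Set.iUnion_subset fun p => ?_
      exact HahnSeries.support_single_subset.trans (by simp)
  finite_co_support' ρ := by
    refine (wt_finite hr ρ).subset ?_
    intro p hp
    by_contra h
    apply hp
    change ((HahnSeries.single (wt r p)) (tm f p)).coeff ρ = 0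
    rw [HahnSeries.coeff_single_of_ne]
    rintro rfl
    exact h (by simp)

lemma fam_apply {r : ℝ} (hr : 0 < r) (f : DD k) (p : ℕ × ℕ) :
    fam hr f p = HahnSeries.single (wt r p) (tm f p) := rfl

/-- level set -/
def lev {r : ℝ} (hr : 0 < r) (ρ : ℝ) : Finset (ℕ × ℕ) :=
  ((wt_finite hr ρ).subset (t := {p | wt r p = ρ}) fun _ h => by
    simp only [Set.mem_ofPred_eq] at h ⊢; exact h.le).toFinset

lemma mem_lev {r : ℝ} (hr : 0 < r) (ρ : ℝ) (p : ℕ × ℕ) : p ∈ lev hr ρ ↔ wt r p = ρ := by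
  simp [lev]

lemma coeff_fam {r : ℝ} (hr : 0 < r) (f : DD k) (ρ : ℝ) :
    (fam hr f).hsum.coeff ρ = ∑ p ∈ lev hr ρ, tm f p := by
  rw [HahnSeries.SummableFamily.coeff_hsum, finsum_eq_sum_of_support_subset (s := lev hr ρ)]
  · refine Finset.sum_congr rfl fun p hp => ?_
    rw [mem_lev] at hp
    rw [fam_apply, ← hp, HahnSeries.coeff_single_same]
  · intro p hp
    simp only [Finset.mem_coe, mem_lev]
    by_contra h
    apply hp
    change (fam hr f p).coeff ρ = 0
    rw [fam_apply, HahnSeries.coeff_single_of_ne]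
    exact fun h' => h h'.symm

lemma coeff_fam_mul {r : ℝ} (hr : 0 < r) (f g : DD k) (ρ : ℝ) :
    (fam hr (f * g)).hsum.coeff ρ = ((fam hr f).hsum * (fam hr g).hsum).coeff ρ := by
  classical
  let Q : Finset ((ℕ × ℕ) × (ℕ × ℕ)) :=
    (((wt_finite hr ρ).toFinset) ×ˢ ((wt_finite hr ρ).toFinset)).filter
      fun q => wt r q.1 + wt r q.2 = ρ
  have hw : ∀ p, 0 ≤ wt r p := fun p => by unfold wt; positivity
  have hQ : ∀ q, q ∈ Q ↔ wt r q.1 + wt r q.2 = ρ := by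
    intro q
    simp only [Q, Finset.mem_filter, Finset.mem_product, Set.Finite.mem_toFinset, Set.mem_ofPred_eq]
    have := hw q.1
    have := hw q.2
    constructor
    · exact fun h => h.2
    · intro h; exact ⟨⟨by linarith, by linarith⟩, h⟩
  have hR : ((fam hr f).hsum * (fam hr g).hsum).coeff ρ = ∑ q ∈ Q, tm f q.1 * tm g q.2 := by
    rw [← HahnSeries.SummableFamily.hsum_mul, HahnSeries.SummableFamily.coeff_hsum,
      finsum_eq_sum_of_support_subset (s := Q)]
    · refine Finset.sum_congr rfl fun q hq => ?_
      rw [hQ] at hq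
      rw [HahnSeries.SummableFamily.mul_toFun, fam_apply, fam_apply, HahnSeries.single_mul_single,
        ← hq, HahnSeries.coeff_single_same]
    · intro q hq
      simp only [Finset.mem_coe, hQ]
      by_contra h
      apply hq
      change (((fam hr f).mul (fam hr g)) q).coeff ρ = 0
      rw [HahnSeries.SummableFamily.mul_toFun, fam_apply, fam_apply, HahnSeries.single_mul_single,
        HahnSeries.coeff_single_of_ne]
      exact fun h' => h h'.symm
  rw [hR, coeff_fam]
  rw [← Finset.sum_fiberwise_of_maps_to (s := Q) (t := lev hr ρ) (g := fun q => q.1 + q.2)]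
  · refine Finset.sum_congr rfl fun p hp => ?_
    rw [mem_lev] at hp
    rw [tm_mul, ← Finset.sum_product' (f := fun (b a : ℕ × ℕ) => tm f (a.1, b.1) * tm g (a.2, b.2))]
    refine Finset.sum_bij' (fun x _ => ((x.2.1, x.1.1), (x.2.2, x.1.2)))
      (fun q _ => ((q.1.2, q.2.2), (q.1.1, q.2.1))) ?_ ?_ ?_ ?_ ?_
    · rintro ⟨⟨b1, b2⟩, ⟨a1, a2⟩⟩ hx
      simp only [Finset.mem_product, Finset.HasAntidiagonal.mem_antidiagonal] at hx
      simp only [Finset.mem_filter, hQ, ← wt_add]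
      have : ((a1, b1) + (a2, b2) : ℕ × ℕ) = p := by
        ext <;> simp [hx]
      exact ⟨by rw [this, hp], this⟩
    · rintro ⟨⟨a1, b1⟩, ⟨a2, b2⟩⟩ hx
      simp only [Finset.mem_filter] at hx
      simp only [Finset.mem_product, Finset.HasAntidiagonal.mem_antidiagonal]
      rw [← hx.2]
      simp
    · intros; rfl
    · intros; rfl
    · intros; rfl
  · intro q hq
    rw [hQ] at hq
    rw [mem_lev, wt_add, hq]

lemma hs_algebraMap {G A : Type} [Semiring G] [PartialOrder G] [IsStrictOrderedRing G]
    [CommRing A] [Algebra k A] (c : k) :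
    algebraMap k (HahnSeries G A) c = HahnSeries.C (algebraMap k A c) := by
  rw [HahnSeries.algebraMap_apply', PowerSeries.algebraMap_apply, HahnSeries.ofPowerSeries_C]

lemma coeff_fam_algebraMap {r : ℝ} (hr : 0 < r) (c : k) (ρ : ℝ) :
    (fam hr (algebraMap k (DD k) c)).hsum.coeff ρ =
      (algebraMap k (HahnSeries ℝ (RatFunc k)) c).coeff ρ := by
  have h2 : ∀ p : ℕ × ℕ, tm (algebraMap k (DD k) c) p =
      if p = 0 then algebraMap k (RatFunc k) c else 0 := by
    rintro ⟨i, j⟩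
    rw [tm, cf_algebraMap]
    by_cases h : i = 0 ∧ j = 0
    · obtain ⟨rfl, rfl⟩ := h
      simp
    · have : (i, j) ≠ 0 := fun h' => h (by simpa [Prod.ext_iff] using h')
      rw [if_neg h, if_neg this]
      simp
  rw [coeff_fam, hs_algebraMap, HahnSeries.C_apply, HahnSeries.coeff_single]
  simp only [h2, Finset.sum_ite_eq', mem_lev]
  simp [wt, eq_comm]

def phi {r : ℝ} (hr : 0 < r) : DD k →ₐ[k] HahnSeries ℝ (RatFunc k) where
  toFun f := (fam hr f).hsum
  map_add' f g := by
    ext ρ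
    rw [HahnSeries.coeff_add]
    simp only [coeff_fam, tm_add, Finset.sum_add_distrib]
  map_mul' f g := by
    ext ρ
    exact coeff_fam_mul hr f g ρ
  map_one' := by
    ext ρ
    have := coeff_fam_algebraMap (k := k) hr 1 ρ
    rwa [map_one, map_one] at this
  map_zero' := by
    ext ρ
    have := coeff_fam_algebraMap (k := k) hr 0 ρ
    rwa [map_zero, map_zero] at this
  commutes' c := by
    ext ρ
    exact coeff_fam_algebraMap hr c ρ

lemma coeff_phi {r : ℝ} (hr : 0 < r) (f : DD k) (ρ : ℝ) :
    (phi hr f).coeff ρ = ∑ p ∈ lev hr ρ, tm f p := coeff_fam hr f ρ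

lemma coeff_phi_ne {r : ℝ} (hr : 0 < r) (f : DD k) (p : ℕ × ℕ) (h : cf f p.1 p.2 ≠ 0) :
    (phi hr f).coeff (wt r p) ≠ 0 := by
  rw [coeff_phi]
  simp only [tm]
  rw [← map_sum]
  intro h0
  rw [map_eq_zero_iff _ (IsFractionRing.injective _ _)] at h0
  have h1 := congrArg (fun q => Polynomial.coeff q p.2) h0
  simp only [Polynomial.finsetSum_coeff, Polynomial.coeff_monomial, Polynomial.coeff_zero] at h1
  rw [Finset.sum_eq_single p] at h1
  · simp at h1; exact h h1
  · intro q hq hne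
    rw [if_neg]
    intro h2
    apply hne
    rw [mem_lev] at hq
    simp only [wt, h2] at hq
    ext
    · have : (q.1 : ℝ) = p.1 := by linarith
      exact_mod_cast this
    · exact h2
  · intro hp
    exact absurd ((mem_lev hr _ _).2 rfl) hp

/-- every monomial of `f` has weight at least `ρ` -/
def WGe (a b : ℝ) (f : DD k) (ρ : ℝ) : Prop := ∀ i j, cf f i j ≠ 0 → ρ ≤ a * i + b * j

/-- the order of `g` is less than the order of `f` -/
def WLt (a b : ℝ) (g f : DD k) : Prop :=
  ∃ i j ρ, cf g i j ≠ 0 ∧ a * i + b * j < ρ ∧ WGe a b f ρ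

lemma le_orderTop_phi {r : ℝ} (hr : 0 < r) (f : DD k) (ρ : ℝ) (h : WGe 1 r f ρ) :
    (ρ : WithTop ℝ) ≤ (phi hr f).orderTop := by
  refine HahnSeries.le_orderTop_iff_forall.2 fun σ hσ => ?_
  rw [coeff_phi]
  refine Finset.sum_eq_zero fun p hp => ?_
  by_cases hc : cf f p.1 p.2 = 0
  · simp [tm, hc]
  · rw [mem_lev] at hp
    have := h _ _ hc
    simp only [wt] at hp
    have h3 : σ < ρ := by exact_mod_cast hσ
    linarith

lemma orderTop_phi_le {r : ℝ} (hr : 0 < r) (f : DD k) (i j : ℕ) (h : cf f i j ≠ 0) :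
    (phi hr f).orderTop ≤ ((1 * i + r * j : ℝ) : WithTop ℝ) := by
  refine HahnSeries.orderTop_le_of_coeff_ne_zero ?_
  rw [one_mul]
  exact coeff_phi_ne hr f (i, j) h

lemma phi_lt {r : ℝ} (hr : 0 < r) {g f : DD k} (h : WLt 1 r g f) :
    (phi hr g).orderTop < (phi hr f).orderTop := by
  obtain ⟨i, j, ρ, h1, h2, h3⟩ := h
  exact (orderTop_phi_le hr g i j h1).trans_lt
    (lt_of_lt_of_le (by exact_mod_cast h2) (le_orderTop_phi hr f ρ h3))

lemma phi_injective {r : ℝ} (hr : 0 < r) : Function.Injective (phi (k := k) hr) := by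
  rw [injective_iff_map_eq_zero]
  intro f hf
  refine DD_ext fun i j => ?_
  by_contra h
  rw [cf_zero] at h
  have := coeff_phi_ne hr f (i, j) h
  rw [hf] at this
  simp at this

lemma lt_phi {r : ℝ} (hr : 0 < r) {g f : DD k} (h : (phi hr g).orderTop < (phi hr f).orderTop) :
    WLt 1 r g f := by
  have hg : phi hr g ≠ 0 := by
    intro h0
    rw [h0, HahnSeries.orderTop_zero] at h
    exact not_top_lt h
  set ρ := (phi hr g).order with hρ
  have h1 : (phi hr g).coeff ρ ≠ 0 := HahnSeries.coeff_order_eq_zero.not.2 hg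
  rw [coeff_phi] at h1
  obtain ⟨p, hp, hne⟩ := Finset.exists_ne_zero_of_sum_ne_zero h1
  rw [mem_lev] at hp
  have hc : cf g p.1 p.2 ≠ 0 := by
    intro h0; apply hne; simp [tm, h0]
  rw [← HahnSeries.order_eq_orderTop_of_ne_zero hg, ← hρ] at h
  by_cases hf : f = 0
  · refine ⟨p.1, p.2, ρ + 1, hc, ?_, ?_⟩
    · simp only [wt] at hp; linarith
    · intro i j hij; rw [hf, cf_zero] at hij; exact absurd rfl hij
  · have hf' : phi hr f ≠ 0 := fun h0 => hf (phi_injective hr (by rw [h0, map_zero]))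
    rw [← HahnSeries.order_eq_orderTop_of_ne_zero hf'] at h
    refine ⟨p.1, p.2, (phi hr f).order, hc, ?_, ?_⟩
    · simp only [wt] at hp
      have : ρ < (phi hr f).order := by exact_mod_cast h
      linarith
    · intro i j hij
      have h2 := coeff_phi_ne hr f (i, j) hij
      have h3 := HahnSeries.order_le_of_coeff_ne_zero h2
      simpa [wt] using h3

lemma WLt_swap {a b : ℝ} {g f : DD k} (h : WLt a b (swapD g) (swapD f)) : WLt b a g f := by
  obtain ⟨i, j, ρ, h1, h2, h3⟩ := h
  refine ⟨j, i, ρ, by simpa using h1, by linarith, ?_⟩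
  intro i' j' h'
  have := h3 j' i' (by simpa using h')
  linarith

lemma WLt_open {r : ℝ} (hr : 0 < r) {g f : DD k} (h : WLt 1 r g f) :
    ∀ᶠ r' in nhds r, WLt 1 r' g f := by
  obtain ⟨i, j, ρ, h1, h2, h3⟩ := h
  obtain ⟨ρ1, h4, h5⟩ := exists_between h2
  have hρ : 0 < ρ := lt_of_le_of_lt (by positivity) h2
  have c1 : Continuous fun r' : ℝ => 1 * (i : ℝ) + r' * j := by fun_prop
  have c2 : Continuous fun r' : ℝ => min 1 (r' / r) * ρ := by fun_prop
  have e1 := c1.continuousAt.eventually_lt (continuousAt_const (y := ρ1)) h4 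
  have e2 := (continuousAt_const (y := ρ1)).eventually_lt (c2.continuousAt (x := r))
    (by rw [div_self hr.ne']; simpa using h5)
  filter_upwards [e1, e2, lt_mem_nhds hr] with r' h6 h7 h8
  refine ⟨i, j, ρ1, h1, h6, ?_⟩
  intro i' j' h'
  have h9 := h3 i' j' h'
  have hm : 0 ≤ min 1 (r' / r) := le_min zero_le_one (by positivity)
  have h10 : min 1 (r' / r) * ρ ≤ min 1 (r' / r) * (1 * i' + r * j') := by gcongr
  have h11 : min 1 (r' / r) * i' ≤ 1 * i' := by
    gcongr; exact min_le_left _ _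
  have h12 : min 1 (r' / r) * (r * j') ≤ r' * j' := by
    calc min 1 (r' / r) * (r * j') ≤ (r' / r) * (r * j') := by
          gcongr; exact min_le_right _ _
      _ = r' * j' := by field_simp
  nlinarith

lemma WLt_large {g f : DD k} (hg : g ≠ 0) (h : PowerSeries (LaurentSeries k)) (h0 : PowerSeries k)
    (e : PowerSeries.map (algebraMap (PowerSeries k) (LaurentSeries k)) f =
      PowerSeries.map (algebraMap (PowerSeries k) (LaurentSeries k)) g * h)
    (e0 : PowerSeries.constantCoeff h = algebraMap _ _ h0) (hs : PowerSeries.constantCoeff h0 = 0) :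
    ∃ r0 : ℝ, 0 < r0 ∧ ∀ a b : ℝ, 0 < a → 0 < b → r0 * a ≤ b → WLt a b g f := by
  obtain ⟨m, g', hm, hg'⟩ : ∃ (m : ℕ) (g' : DD k), g = PowerSeries.X ^ m * g' ∧
      PowerSeries.constantCoeff g' ≠ 0 := by
    refine ⟨g.order.toNat, _, (PowerSeries.X_pow_order_mul_divXPowOrder (f := g)).symm, ?_⟩
    rw [PowerSeries.constantCoeff_divXPowOrder]
    exact PowerSeries.coeff_order hg
  set d := (PowerSeries.constantCoeff g').order.toNat with hd
  have hgd : PowerSeries.coeff d (PowerSeries.constantCoeff g') ≠ 0 := PowerSeries.coeff_order hg'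
  have hmap : PowerSeries.map (algebraMap (PowerSeries k) (LaurentSeries k)) f =
      PowerSeries.X ^ m * (PowerSeries.map (algebraMap (PowerSeries k) (LaurentSeries k)) g' * h) := by
    rw [e, hm]; simp [mul_assoc]
  have inj : Function.Injective (algebraMap (PowerSeries k) (LaurentSeries k)) :=
    IsFractionRing.injective _ _
  have hlow : ∀ j, j < m → PowerSeries.coeff j f = 0 := by
    intro j hj
    apply inj
    rw [← PowerSeries.coeff_map, hmap, PowerSeries.coeff_X_pow_mul', if_neg (by omega), map_zero]
  have hfm : PowerSeries.coeff m f = PowerSeries.constantCoeff g' * h0 := by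
    apply inj
    rw [← PowerSeries.coeff_map, hmap, PowerSeries.coeff_X_pow_mul', if_pos le_rfl, Nat.sub_self,
      PowerSeries.coeff_zero_eq_constantCoeff_apply, map_mul, e0, map_mul]
    congr 1
  have hfm2 : ∀ i, i ≤ d → cf f i m = 0 := by
    intro i hi
    rw [cf, hfm, PowerSeries.coeff_mul]
    refine Finset.sum_eq_zero fun q hq => ?_
    rw [Finset.HasAntidiagonal.mem_antidiagonal] at hq
    rcases Nat.lt_or_ge q.1 d with h1 | h1
    · rw [PowerSeries.coeff_of_lt_order_toNat q.1 h1, zero_mul]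
    · have : q.2 = 0 := by omega
      rw [this, PowerSeries.coeff_zero_eq_constantCoeff_apply, hs, mul_zero]
  refine ⟨d + 1, by positivity, fun a b ha hb hab => ?_⟩
  refine ⟨d, m, b * m + a * (d + 1), ?_, by linarith, ?_⟩
  · rw [cf, hm, PowerSeries.coeff_X_pow_mul', if_pos le_rfl, Nat.sub_self,
      PowerSeries.coeff_zero_eq_constantCoeff_apply]
    exact hgd
  · intro i j hij
    have hj : m ≤ j := by
      by_contra hj
      apply hij
      rw [cf, hlow j (by omega), map_zero]
    rcases hj.eq_or_lt with rfl | hj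
    · have hi : d + 1 ≤ i := by
        by_contra hi
        exact hij (hfm2 i (by omega))
      have : (d + 1 : ℝ) ≤ i := by exact_mod_cast hi
      nlinarith
    · have : (m + 1 : ℝ) ≤ j := by exact_mod_cast hj
      have h5 : 0 ≤ a * i := by positivity
      nlinarith

end P4

section P5
variable {k : Type} [Field k] {X : OverR k}

/-- valuation subalgebras -/
def valSub {F : Type} [Field F] [Algebra k F] (A : Subalgebra k F) (h : ∀ x, x ∈ A ∨ x⁻¹ ∈ A) :
    ValuationSubring F := { A.toSubring with mem_or_inv_mem' := h }

lemma valSub_ring {F : Type} [Field F] [Algebra k F] (A : Subalgebra k F)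
    (h : ∀ x, x ∈ A ∨ x⁻¹ ∈ A) : ValuationRing A :=
  inferInstanceAs (ValuationRing (valSub A h))

lemma valSub_frac {F : Type} [Field F] [Algebra k F] (A : Subalgebra k F)
    (h : ∀ x, x ∈ A ∨ x⁻¹ ∈ A) : IsFractionRing A F :=
  inferInstanceAs (IsFractionRing (valSub A h) F)

/-! ### centres -/
section
variable {B R : Type} [CommRing B] [Algebra k B] [CommRing R] [Algebra k R] [IsLocalRing R]
  (j : SO k B ⟶ X) [IsOpenImmersion j.left]

lemma kpt_chart (x : Pt X k) (h : x.cl ∈ Set.range j.left) : ∃ χ : B →ₐ[k] k, SOmap χ ≫ j = x := by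
  obtain ⟨z, hz⟩ := liftChart_local j x h
  exact ⟨SOpre z, by rw [SOmap_SOpre, hz]⟩

lemma over_mono : Mono j := by
  have : Mono j.left := inferInstance
  exact Over.mono_of_mono_left j

lemma chart_inj {T : Type} [CommRing T] [Algebra k T] {u v : B →ₐ[k] T}
    (h : SOmap u ≫ j = SOmap v ≫ j) : u = v := by
  have := over_mono j
  exact SOmap_injective ((cancel_mono j).1 h)

lemma centre_to (χ : B →ₐ[k] k) (z : Pt X R) (h : z.cl = Pt.cl (SOmap χ ≫ j)) :
    ∃ β : B →ₐ[k] R, SOmap β ≫ j = z ∧ ∀ b, χ b = 0 → β b ∈ IsLocalRing.maximalIdeal R := by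
  obtain ⟨z, rfl⟩ := liftChart_local j z (by rw [h, cl_comp]; exact ⟨_, rfl⟩)
  obtain ⟨φ, rfl⟩ : ∃ φ, z = SOmap φ := ⟨SOpre z, (SOmap_SOpre z).symm⟩
  refine ⟨φ, rfl, fun b hb => ?_⟩
  rw [cl_comp, cl_comp] at h
  have h1 := j.left.isOpenEmbedding.injective h
  have h3 : PrimeSpectrum.comap φ.toRingHom (IsLocalRing.closedPoint R) =
      PrimeSpectrum.comap χ.toRingHom (IsLocalRing.closedPoint _) := h1
  have h4 : Ideal.comap φ.toRingHom (IsLocalRing.maximalIdeal R) =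
    Ideal.comap χ.toRingHom (IsLocalRing.maximalIdeal k) := congrArg PrimeSpectrum.asIdeal h3
  have : b ∈ Ideal.comap χ.toRingHom (IsLocalRing.maximalIdeal k) := by
    change χ b ∈ IsLocalRing.maximalIdeal k
    rw [hb]
    exact Ideal.zero_mem _
  rw [← h4] at this
  exact this

lemma centre_of (χ : B →ₐ[k] k) (β : B →ₐ[k] R)
    (h : ∀ b, χ b = 0 → β b ∈ IsLocalRing.maximalIdeal R) :
    Pt.cl (SOmap β ≫ j) = Pt.cl (SOmap χ ≫ j) := by
  rw [cl_comp, cl_comp]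
  congr 1
  have h3 : PrimeSpectrum.comap β.toRingHom (IsLocalRing.closedPoint R) =
      PrimeSpectrum.comap χ.toRingHom (IsLocalRing.closedPoint _) := by
    ext1
    change Ideal.comap β.toRingHom (IsLocalRing.maximalIdeal R) =
      Ideal.comap χ.toRingHom (IsLocalRing.maximalIdeal k)
    have hs : Function.Surjective χ.toRingHom := fun c => ⟨algebraMap k B c, χ.commutes c⟩
    have hmx : (Ideal.comap χ.toRingHom (IsLocalRing.maximalIdeal k)).IsMaximal :=
      Ideal.comap_isMaximal_of_surjective _ hs
    refine (hmx.eq_of_le ?_ ?_).symm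
    · exact (Ideal.IsPrime.comap β.toRingHom (hK := inferInstance)).ne_top
    · intro b hb
      have hb' : χ b ∈ IsLocalRing.maximalIdeal k := hb
      rw [IsLocalRing.maximalIdeal_eq_bot, Ideal.mem_bot] at hb'
      exact h b hb'
  exact h3

lemma field_chart {F F' : Type} [Field F] [Algebra k F] [Field F'] [Algebra k F'] (f : F →ₐ[k] F')
    (y : Pt X F) (h : Set.range (y.map f).left ⊆ Set.range j.left) :
    ∃ β : B →ₐ[k] F, SOmap β ≫ j = y := by
  obtain ⟨z, hz⟩ := liftChart j y (by
    rintro _ ⟨a, rfl⟩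
    have ha : a = (SOmap f).left (IsLocalRing.closedPoint F') := Subsingleton.elim (α := PrimeSpectrum F) _ _
    apply h
    refine ⟨IsLocalRing.closedPoint F', ?_⟩
    rw [ha]
    exact Scheme.Hom.comp_apply _ _ _)
  exact ⟨SOpre z, by rw [SOmap_SOpre, hz]⟩

lemma field_chart' {F F' : Type} [Field F] [Algebra k F] [Field F'] [Algebra k F'] (f : F →ₐ[k] F')
    (y : Pt X F) (β' : B →ₐ[k] F') (h : y.map f = SOmap β' ≫ j) :
    ∃ β : B →ₐ[k] F, SOmap β ≫ j = y ∧ f.comp β = β' := by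
  obtain ⟨β, hβ⟩ := field_chart j f y (by
    rw [h]
    rintro _ ⟨a, rfl⟩
    exact ⟨_, (Scheme.Hom.comp_apply _ _ _).symm⟩)
  refine ⟨β, hβ, chart_inj j ?_⟩
  rw [← h, ← hβ, SOmap_comp, Pt.map, Category.assoc]
end

/-! ### Hahn valuation ring -/
variable (k) in
abbrev HH := HahnSeries ℝ (RatFunc k)

lemma oT_mul (x y : HH k) : (x * y).orderTop = x.orderTop + y.orderTop :=
  (HahnSeries.addVal ℝ (RatFunc k)).map_mul x y

lemma oT_add {x y : HH k} {c : WithTop ℝ} (hx : c < x.orderTop) (hy : c < y.orderTop) :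
    c < (x + y).orderTop :=
  lt_of_lt_of_le (lt_min hx hy) HahnSeries.min_orderTop_le_orderTop_add

lemma oT_const (c : k) : 0 ≤ (algebraMap k (HH k) c).orderTop := by
  rw [hs_algebraMap]
  exact HahnSeries.orderTop_single_le

variable (k) in
def HO : Subalgebra k (HH k) where
  carrier := {x | 0 ≤ x.orderTop}
  mul_mem' {x y} hx hy := by
    simp only [Set.mem_ofPred_eq] at hx hy ⊢
    rw [oT_mul]; exact add_nonneg hx hy
  add_mem' {x y} hx hy := by
    simp only [Set.mem_ofPred_eq] at hx hy ⊢
    exact (le_min hx hy).trans HahnSeries.min_orderTop_le_orderTop_add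
  algebraMap_mem' c := by
    simp only [Set.mem_ofPred_eq]
    exact oT_const c

lemma mem_HO (x : HH k) : x ∈ HO k ↔ 0 ≤ x.orderTop := by
  change x ∈ {x : HH k | 0 ≤ x.orderTop} ↔ _
  simp

lemma HO_val (x : HH k) : x ∈ HO k ∨ x⁻¹ ∈ HO k := by
  by_cases hx : x = 0
  · left; rw [hx]; exact zero_mem _
  simp only [mem_HO]
  by_contra! h
  have h1 : (x * x⁻¹).orderTop = 0 := by rw [mul_inv_cancel₀ hx]; exact HahnSeries.orderTop_one
  rw [oT_mul] at h1
  have := WithTop.add_lt_add h.1 h.2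
  rw [h1, add_zero] at this
  exact lt_irrefl _ this

instance : ValuationRing (HO k) := valSub_ring _ HO_val
instance : IsLocalRing (HO k) := ValuationRing.isLocalRing (HO k)
instance : IsFractionRing (HO k) (HH k) := valSub_frac _ HO_val

lemma HO_max (x : HO k) : x ∈ IsLocalRing.maximalIdeal (HO k) ↔ 0 < (x : HH k).orderTop := by
  rw [IsLocalRing.mem_maximalIdeal, mem_nonunits_iff]
  have hx := (mem_HO _).1 x.2
  by_cases h0 : (x : HH k) = 0
  · have : x = 0 := Subtype.ext h0
    simp [this]
  rw [lt_iff_le_and_ne, and_iff_right hx, not_iff_comm, not_ne_iff]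
  have h1 : (x : HH k).orderTop + ((x : HH k)⁻¹).orderTop = 0 := by
    rw [← oT_mul, mul_inv_cancel₀ h0]; exact HahnSeries.orderTop_one
  constructor
  · intro h
    have h2 : (x : HH k)⁻¹ ∈ HO k := by
      rw [mem_HO]
      rw [← h, zero_add] at h1
      exact h1.ge
    exact ⟨⟨x, ⟨_, h2⟩, Subtype.ext (mul_inv_cancel₀ h0), Subtype.ext (inv_mul_cancel₀ h0)⟩, rfl⟩
  · rintro ⟨u, rfl⟩
    have h3 : ((u : HO k) : HH k)⁻¹ = ((u⁻¹ : (HO k)ˣ) : HO k) := by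
      exact inv_eq_of_mul_eq_one_right (congrArg Subtype.val u.mul_inv)
    have h4 := (mem_HO _).1 ((u⁻¹ : (HO k)ˣ) : HO k).2
    rw [← h3] at h4
    refine le_antisymm hx ?_
    calc _ ≤ ((u : HO k) : HH k).orderTop + (((u : HO k) : HH k)⁻¹).orderTop := le_add_of_nonneg_right h4
      _ = 0 := h1

variable (k) in
/-- constants -/
def HOc : RatFunc k →ₐ[k] HO k where
  toFun c := ⟨HahnSeries.C c, by rw [mem_HO]; exact HahnSeries.orderTop_single_le⟩
  map_one' := Subtype.ext (map_one HahnSeries.C)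
  map_zero' := Subtype.ext (map_zero HahnSeries.C)
  map_add' a b := Subtype.ext (map_add HahnSeries.C a b)
  map_mul' a b := Subtype.ext (map_mul HahnSeries.C a b)
  commutes' c := Subtype.ext (hs_algebraMap c).symm

lemma HO_res (x : HO k) : ∃ c : RatFunc k, x - HOc k c ∈ IsLocalRing.maximalIdeal (HO k) := by
  refine ⟨(x : HH k).coeff 0, ?_⟩
  rw [HO_max]
  have hx := (mem_HO _).1 x.2
  change 0 < ((x : HH k) - HahnSeries.C ((x : HH k).coeff 0)).orderTop
  by_contra h
  rw [not_lt] at h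
  set z := (x : HH k) - HahnSeries.C ((x : HH k).coeff 0) with hz
  have hz0 : z ≠ 0 := by
    intro h0; rw [h0, HahnSeries.orderTop_zero] at h; exact absurd h (by simp)
  have hc := HahnSeries.coeff_order_eq_zero.not.2 hz0
  rw [← HahnSeries.order_eq_orderTop_of_ne_zero hz0] at h
  have h' : z.order ≤ 0 := by exact_mod_cast h
  apply hc
  generalize z.order = o at h'
  rcases h'.eq_or_lt with h1 | h1
  · rw [h1, hz]
    simp [HahnSeries.C_apply]
  · rw [hz, HahnSeries.coeff_sub, HahnSeries.C_apply, HahnSeries.coeff_single_of_ne h1.ne, sub_zero]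
    exact HahnSeries.coeff_eq_zero_of_lt_orderTop (lt_of_lt_of_le (by exact_mod_cast h1) hx)

/-- no rational curves -/
def NR (X : OverR k) : Prop := ∀ y : Pt X (RatFunc k), ∃ x : Pt X k, y = x.map (Algebra.ofId k _)

lemma cl_map_field {R F : Type} [CommRing R] [Algebra k R] [IsLocalRing R] [Field F] [Algebra k F]
    (f : R →ₐ[k] F) (hf : ∀ a, a ∈ IsLocalRing.maximalIdeal R → f a = 0) (y : Pt X R) :
    (y.map f).cl = y.cl := by
  have : IsLocalHom f.toRingHom := by
    constructor
    intro a ha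
    by_contra hna
    have h0 : f a = 0 := hf a hna
    change IsUnit (f a) at ha
    rw [h0] at ha
    exact not_isUnit_zero ha
  exact cl_map f y

lemma gen_centre {R : Type} [CommRing R] [Algebra k R] [IsLocalRing R] (d : RatFunc k →ₐ[k] R)
    (hd : ∀ x : R, ∃ c : RatFunc k, x - d c ∈ IsLocalRing.maximalIdeal R)
    (h : NR X) (z : Pt X R) : ∃ x : Pt X k, z.cl = x.cl := by
  let Q := IsLocalRing.ResidueField R
  let ρ : R →ₐ[k] Q := IsScalarTower.toAlgHom k R Q
  let κ : RatFunc k →ₐ[k] Q := ρ.comp d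
  have hκ : Function.Bijective κ := by
    refine ⟨κ.toRingHom.injective, fun q => ?_⟩
    obtain ⟨x, rfl⟩ := IsLocalRing.residue_surjective q
    obtain ⟨c, hc⟩ := hd x
    refine ⟨c, ?_⟩
    have := (IsLocalRing.residue_eq_zero_iff _).2 hc
    rw [map_sub, sub_eq_zero] at this
    exact this.symm
  let e : RatFunc k ≃ₐ[k] Q := AlgEquiv.ofBijective κ hκ
  obtain ⟨x, hx⟩ := h (Pt.map (e.symm : Q →ₐ[k] RatFunc k) (Pt.map ρ z))
  refine ⟨x, ?_⟩
  have h1 : (Pt.map ρ z).cl = z.cl := cl_map_field ρ (fun a ha => (IsLocalRing.residue_eq_zero_iff _).2 ha) z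
  have h2 : (Pt.map (e.symm : Q →ₐ[k] RatFunc k) (Pt.map ρ z)).cl = (Pt.map ρ z).cl := by
    refine cl_map_field _ (fun a ha => ?_) _
    rw [IsLocalRing.maximalIdeal_eq_bot, Ideal.mem_bot] at ha
    rw [ha, map_zero]
  rw [← h1, ← h2, hx]
  refine cl_map_field _ (fun a ha => ?_) _
  rw [IsLocalRing.maximalIdeal_eq_bot, Ideal.mem_bot] at ha
  rw [ha, map_zero]

set_option maxHeartbeats 1000000 in
lemma HO_centre (h : NR X) (z : Pt X (HO k)) : ∃ x : Pt X k, z.cl = x.cl :=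
  gen_centre (X := X) (R := HO k) (HOc k) (HO_res (k := k)) h z

variable (k) in
abbrev LL := FractionRing (DD k)


set_option synthInstance.maxHeartbeats 400000 in
set_option maxHeartbeats 1000000 in
def phiL {r : ℝ} (hr : 0 < r) : LL k →ₐ[k] HH k :=
  IsFractionRing.liftAlgHom (g := phi (k := k) hr) (phi_injective hr)

lemma phiL_lt {r : ℝ} (hr : 0 < r) (z : LL k) (p q : DD k) (hq : q ≠ 0)
    (h : z * algebraMap _ _ q = algebraMap _ _ p) :
    0 < (phiL hr z).orderTop ↔ WLt 1 r q p := by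
  have h1 : phiL hr z * phi hr q = phi hr p := by
    have := congrArg (phiL hr) h
    rw [map_mul] at this
    simpa [phiL] using this
  have h2 : (phiL hr z).orderTop + (phi hr q).orderTop = (phi hr p).orderTop := by
    rw [← oT_mul, h1]
  have h3 : (phi hr q).orderTop ≠ ⊤ := by
    rw [Ne, HahnSeries.orderTop_eq_top]
    intro h0; exact hq (phi_injective hr (by rw [h0, map_zero]))
  have h4 : 0 < (phiL hr z).orderTop ↔ (phi hr q).orderTop < (phi hr p).orderTop := by
    have h5 := WithTop.add_lt_add_iff_right h3 (x := 0) (y := (phiL hr z).orderTop)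
    rw [zero_add, h2] at h5
    exact h5.symm
  rw [h4]
  exact ⟨lt_phi hr, phi_lt hr⟩

end P5

section P6
variable {k : Type} [Field k] {X : OverR k}

section
variable {A B : Type} [CommRing A] [Algebra k A] [CommRing B] [Algebra k B]

variable (k A) in
def ccA : PowerSeries A →ₐ[k] A :=
  { PowerSeries.constantCoeff (R := A) with
    commutes' c := by
      change PowerSeries.constantCoeff (algebraMap k (PowerSeries A) c) = _
      rw [PowerSeries.algebraMap_apply, PowerSeries.constantCoeff_C] }

@[simp] lemma ccA_apply (f : PowerSeries A) : ccA k A f = PowerSeries.constantCoeff f := rfl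

def mapA (g : A →ₐ[k] B) : PowerSeries A →ₐ[k] PowerSeries B :=
  { PowerSeries.map g.toRingHom with
    commutes' c := by
      change PowerSeries.map g.toRingHom (algebraMap k (PowerSeries A) c) = _
      rw [PowerSeries.algebraMap_apply, PowerSeries.algebraMap_apply, PowerSeries.map_C]
      congr 1
      exact g.commutes c }

lemma mapA_apply (g : A →ₐ[k] B) (f : PowerSeries A) : mapA g f = PowerSeries.map g.toRingHom f := rfl

lemma mapA_injective (g : A →ₐ[k] B) (h : Function.Injective g) : Function.Injective (mapA g) :=
  PowerSeries.map_injective _ h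

variable (k A) in
def psL : PowerSeries A →ₐ[k] LaurentSeries A :=
  { algebraMap (PowerSeries A) (LaurentSeries A) with
    commutes' c := by
      change algebraMap (PowerSeries A) (LaurentSeries A) (algebraMap k (PowerSeries A) c) = _
      rw [hs_algebraMap, PowerSeries.algebraMap_apply, LaurentSeries.coe_algebraMap,
        HahnSeries.ofPowerSeries_C] }

lemma psL_apply (f : PowerSeries A) : psL k A f = algebraMap _ _ f := rfl

lemma psL_injective : Function.Injective (psL k A) := by
  have h : Function.Injective (HahnSeries.ofPowerSeries ℤ A) := HahnSeries.ofPowerSeries_injective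
  exact h

end

/-- `k[[s,t]] → k((s))[[t]]` -/
def sideD : DD k →ₐ[k] PowerSeries (LaurentSeries k) := mapA (psL k k)

lemma sideD_injective : Function.Injective (sideD (k := k)) := mapA_injective _ psL_injective

def liftF {F : Type} [Field F] [Algebra k F] (g : DD k →ₐ[k] F) (hg : Function.Injective g) :
    LL k →ₐ[k] F := IsFractionRing.liftAlgHom (g := g) hg

lemma liftF_algebraMap {F : Type} [Field F] [Algebra k F] (g : DD k →ₐ[k] F)
    (hg : Function.Injective g) (f : DD k) : liftF g hg (algebraMap _ (LL k) f) = g f :=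
  IsFractionRing.lift_algebraMap (g := g.toRingHom) hg f

def sideL' : DD k →ₐ[k] LaurentSeries (LaurentSeries k) := (psL k (LaurentSeries k)).comp sideD

lemma sideL'_apply (f : DD k) : sideL' f = psL k (LaurentSeries k) (sideD f) := rfl

lemma sideL'_injective : Function.Injective (sideL' (k := k)) := by
  intro a b h
  exact sideD_injective (psL_injective (k := k) (A := LaurentSeries k) h)

def sideL : LL k →ₐ[k] LaurentSeries (LaurentSeries k) := liftF sideL' sideL'_injective

lemma sideL_algebraMap (f : DD k) : sideL (algebraMap _ (LL k) f) = psL k _ (sideD f) := 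
  liftF_algebraMap _ _ f

def swapL' : DD k →ₐ[k] LL k := (IsScalarTower.toAlgHom k (DD k) (LL k)).comp swapD

lemma swapL'_injective : Function.Injective (swapL' (k := k)) := by
  intro a b h
  exact swapD_injective (IsFractionRing.injective (DD k) (LL k) h)

def swapL : LL k →ₐ[k] LL k := liftF swapL' swapL'_injective

lemma swapL_algebraMap (f : DD k) : swapL (algebraMap _ (LL k) f) = algebraMap _ _ (swapD f) :=
  liftF_algebraMap _ _ f

variable (k) in
/-- the Hahn valuation ring as a type -/
def HOR : Type := HO k

instance : CommRing (HOR k) := inferInstanceAs (CommRing (HO k))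
instance : Algebra k (HOR k) := inferInstanceAs (Algebra k (HO k))
instance : IsDomain (HOR k) := inferInstanceAs (IsDomain (HO k))
instance : ValuationRing (HOR k) := inferInstanceAs (ValuationRing (HO k))
instance : IsLocalRing (HOR k) := inferInstanceAs (IsLocalRing (HO k))
instance : Algebra (HOR k) (HH k) := inferInstanceAs (Algebra (HO k) (HH k))
instance : @IsScalarTower k (HOR k) (HH k) Algebra.toSMul Algebra.toSMul Algebra.toSMul :=
  IsScalarTower.of_algebraMap_eq (R := k) (S := HOR k) (A := HH k) fun _ => rfl
instance : IsFractionRing (HOR k) (HH k) := inferInstanceAs (IsFractionRing (HO k) (HH k))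

variable (k) in
def HOv : HOR k →ₐ[k] HH k := IsScalarTower.toAlgHom k (HOR k) (HH k)

lemma HOv_injective : Function.Injective (HOv k) := IsFractionRing.injective (HOR k) (HH k)

lemma HOR_max (x : HOR k) : x ∈ IsLocalRing.maximalIdeal (HOR k) ↔ 0 < (HOv k x).orderTop :=
  HO_max x

lemma HOR_lift {B : Type} [CommRing B] [Algebra k B] (ψ : B →ₐ[k] HH k)
    (h : ∀ b, 0 ≤ (ψ b).orderTop) : ∃ β : B →ₐ[k] HOR k, (HOv k).comp β = ψ :=
  ⟨(ψ.codRestrict (HO k) fun b => (mem_HO _).2 (h b) : B →ₐ[k] HO k), rfl⟩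

lemma HOR_centre (h : NR X) (z : Pt X (HOR k)) : ∃ x : Pt X k, z.cl = x.cl := HO_centre h z

lemma Pt.map_SOmap {B R S : Type} [CommRing B] [Algebra k B] [CommRing R] [Algebra k R] [CommRing S]
    [Algebra k S] (f : R →ₐ[k] S) (b : B →ₐ[k] R) (j : SO k B ⟶ X) :
    Pt.map f (SOmap b ≫ j : Pt X R) = SOmap (f.comp b) ≫ j := by
  rw [SOmap_comp, Pt.map, Category.assoc]

def Ctr {r : ℝ} (hr : 0 < r) (y : Pt X (LL k)) (x : Pt X k) : Prop :=
  ∃ z : Pt X (HOR k), z.map (HOv k) = y.map (phiL hr) ∧ z.cl = x.cl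

lemma ctr_exists [IsProper X.hom] (h : NR X) {r : ℝ} (hr : 0 < r) (y : Pt X (LL k)) :
    ∃ x, Ctr hr y x := by
  obtain ⟨z, hz⟩ := Pt.exists_extend (R := HOR k) (F := HH k) (y.map (phiL hr))
  obtain ⟨x, hx⟩ := HOR_centre h z
  exact ⟨x, z, hz, hx⟩

lemma ctr_unique [IsAlgClosed k] [IsProper X.hom] {r : ℝ} {hr : 0 < r} {y : Pt X (LL k)} {x x' : Pt X k}
    (h : Ctr hr y x) (h' : Ctr hr y x') : x = x' := by
  obtain ⟨z, hz, hx⟩ := h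
  obtain ⟨z', hz', hx'⟩ := h'
  have : z = z' := Pt.map_injective (HOv k) HOv_injective (hz.trans hz'.symm)
  subst this
  exact kpt_ext (hx.symm.trans hx')

section
variable {B : Type} [CommRing B] [Algebra k B] (j : SO k B ⟶ X) [IsOpenImmersion j.left]

lemma ctr_chart_to {r : ℝ} {hr : 0 < r} {y : Pt X (LL k)} (χ : B →ₐ[k] k)
    (h : Ctr hr y (SOmap χ ≫ j)) :
    ∃ β : B →ₐ[k] LL k, SOmap β ≫ j = y ∧ ∀ b, χ b = 0 → 0 < (phiL hr (β b)).orderTop := by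
  obtain ⟨z, hz, hx⟩ := h
  obtain ⟨β', h1, h2⟩ := centre_to j χ z hx
  obtain ⟨β, h3, h4⟩ := field_chart' j (phiL hr) y ((HOv k).comp β') (by
    rw [← hz, ← h1, Pt.map_SOmap])
  refine ⟨β, h3, fun b hb => ?_⟩
  have := (HOR_max _).1 (h2 b hb)
  rw [← AlgHom.comp_apply, h4]
  exact this

lemma ctr_chart_of {r : ℝ} {hr : 0 < r} {y : Pt X (LL k)} (χ : B →ₐ[k] k)
    (β : B →ₐ[k] LL k) (h1 : SOmap β ≫ j = y) (S : Set B) (hS : Algebra.adjoin k S = ⊤)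
    (h2 : ∀ b ∈ S, 0 < (phiL hr (β (b - algebraMap k B (χ b)))).orderTop) :
    Ctr hr y (SOmap χ ≫ j) := by
  have key : ∀ b, 0 < (phiL hr (β (b - algebraMap k B (χ b)))).orderTop := by
    intro b
    have hb : b ∈ Algebra.adjoin k S := by rw [hS]; trivial
    induction hb using Algebra.adjoin_induction with
    | mem b hb => exact h2 b hb
    | algebraMap c =>
      rw [χ.commutes]
      simp
    | add a b _ _ ha hb =>
      rw [map_add χ, map_add (algebraMap k B), add_sub_add_comm, map_add, map_add]
      exact oT_add ha hb
    | mul a b _ _ ha hb =>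
      have e : a * b - algebraMap k B (χ (a * b)) =
        (a - algebraMap k B (χ a)) * (b - algebraMap k B (χ b)) +
        (algebraMap k B (χ a) * (b - algebraMap k B (χ b)) +
         algebraMap k B (χ b) * (a - algebraMap k B (χ a))) := by
        rw [map_mul χ, map_mul (algebraMap k B)]; ring
      rw [e]
      simp only [map_add, map_mul, AlgHom.commutes]
      have hc : ∀ (c : k) (z : HH k), 0 < z.orderTop → 0 < (algebraMap k (HH k) c * z).orderTop := by
        intro c z hz
        rw [oT_mul]
        exact lt_of_lt_of_le hz (le_add_of_nonneg_left (oT_const c))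
      refine oT_add ?_ (oT_add (hc _ _ hb) (hc _ _ ha))
      rw [oT_mul]
      exact lt_of_lt_of_le hb (le_add_of_nonneg_left ha.le)
  have hmem : ∀ b, 0 ≤ (((phiL hr).comp β) b).orderTop := by
    intro b
    have e : ((phiL hr).comp β) b = phiL hr (β (b - algebraMap k B (χ b))) + algebraMap k (HH k) (χ b) := by
      simp
    rw [e]
    exact (le_min (key b).le (oT_const _)).trans HahnSeries.min_orderTop_le_orderTop_add
  obtain ⟨β', hβ'⟩ := HOR_lift _ hmem
  refine ⟨SOmap β' ≫ j, ?_, ?_⟩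
  · rw [← h1, Pt.map_SOmap, Pt.map_SOmap, hβ']
  · apply centre_of
    intro b hb
    rw [HOR_max, ← AlgHom.comp_apply, hβ']
    have := key b
    rw [hb, map_zero, sub_zero] at this
    exact this

end

lemma LL_frac (z : LL k) : ∃ p q : DD k, q ≠ 0 ∧ z * algebraMap _ _ q = algebraMap _ _ p := by
  obtain ⟨p, q, hq, rfl⟩ := IsFractionRing.div_surjective (A := DD k) z
  have hq0 : q ≠ 0 := nonZeroDivisors.ne_zero hq
  refine ⟨p, q, hq0, ?_⟩
  rw [div_mul_cancel₀]
  simpa using hq0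

lemma ctr_open [IsAlgClosed k] [LocallyOfFiniteType X.hom] {r : ℝ} {hr : 0 < r} {y : Pt X (LL k)}
    {x : Pt X k} (h : Ctr hr y x) : ∀ᶠ r' in nhds r, ∀ hr' : 0 < r', Ctr hr' y x := by
  obtain ⟨B, _, _, j, _, hj⟩ := exists_chart X x.cl
  obtain ⟨χ, rfl⟩ := kpt_chart j x hj
  obtain ⟨S, hS⟩ := (chart_finiteType j).out
  obtain ⟨β, h1, h2⟩ := ctr_chart_to j χ h
  have : ∀ b ∈ S, ∀ᶠ r' in nhds r, ∀ hr' : 0 < r',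
      0 < (phiL hr' (β (b - algebraMap k B (χ b)))).orderTop := by
    intro b hb
    obtain ⟨p, q, hq, e⟩ := LL_frac (β (b - algebraMap k B (χ b)))
    have h3 := (phiL_lt hr _ p q hq e).1 (h2 _ (by simp))
    filter_upwards [WLt_open hr h3] with r' h4 hr'
    exact (phiL_lt hr' _ p q hq e).2 h4
  rw [← Filter.eventually_all_finset] at this
  filter_upwards [this] with r' h3 hr'
  exact ctr_chart_of j χ β h1 S hS fun b hb => h3 b hb hr'

def Lim (y : Pt X (LL k)) (x : Pt X k) : Prop :=
  ∃ (y1 : Pt X (PowerSeries (LaurentSeries k))) (e : Pt X (PowerSeries k)),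
    y1.map (psL k _) = y.map sideL ∧ y1.map (ccA k _) = e.map (psL k k) ∧ e.cl = x.cl

lemma lim_large {y : Pt X (LL k)} {x : Pt X k} [LocallyOfFiniteType X.hom] (h : Lim y x) :
    ∃ (B : Type) (_ : CommRing B) (_ : Algebra k B) (j : SO k B ⟶ X) (_ : IsOpenImmersion j.left)
      (χ : B →ₐ[k] k) (β : B →ₐ[k] LL k) (S : Finset B) (r0 : ℝ), x = SOmap χ ≫ j ∧ y = SOmap β ≫ j ∧
      Algebra.adjoin k (S : Set B) = ⊤ ∧ 0 < r0 ∧ ∀ b ∈ S, ∃ p q : DD k, q ≠ 0 ∧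
        β (b - algebraMap k B (χ b)) * algebraMap _ _ q = algebraMap _ _ p ∧
        ∀ a b : ℝ, 0 < a → 0 < b → r0 * a ≤ b → WLt a b q p := by
  obtain ⟨y1, e, hy, he, hx⟩ := h
  obtain ⟨B, _, _, j, _, hj⟩ := exists_chart X x.cl
  obtain ⟨χ, rfl⟩ := kpt_chart j x hj
  obtain ⟨S, hS⟩ := (chart_finiteType j).out
  obtain ⟨ε, h1, h2⟩ := centre_to j χ e hx
  have hcl : (y1.map (ccA k _)).cl = y1.cl := by
    apply cl_map_field
    intro a ha
    by_contra h0
    exact ha (PowerSeries.isUnit_iff_constantCoeff.2 (isUnit_iff_ne_zero.2 h0))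
  obtain ⟨b1, hb1⟩ := liftChart_local j y1 (by
    rw [← hcl, he, ← h1]
    rw [Pt.map, ← Category.assoc, cl_comp]
    exact ⟨_, rfl⟩)
  obtain ⟨β1, rfl⟩ : ∃ φ, b1 = SOmap φ := ⟨SOpre b1, (SOmap_SOpre b1).symm⟩
  have h3 : (ccA k _).comp β1 = (psL k k).comp ε := by
    apply chart_inj j
    rw [SOmap_comp, SOmap_comp, Category.assoc, Category.assoc, hb1, h1]
    exact he
  obtain ⟨β, h4, h5⟩ := field_chart' j sideL y ((psL k _).comp β1) (by
    rw [← hy, ← hb1, Pt.map_SOmap])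
  have key : ∀ b : B, ∃ r0 : ℝ, 0 < r0 ∧ ∃ p q : DD k, q ≠ 0 ∧
        β (b - algebraMap k B (χ b)) * algebraMap _ _ q = algebraMap _ _ p ∧
        ∀ a b : ℝ, 0 < a → 0 < b → r0 * a ≤ b → WLt a b q p := by
    intro b
    set b0 := b - algebraMap k B (χ b) with hb0
    have hχ : χ b0 = 0 := by simp [hb0]
    have hq := h2 _ hχ
    obtain ⟨p0, q0, hq0, e0⟩ := LL_frac (β b0)
    have main : ∀ p q : DD k, β b0 * algebraMap _ _ q = algebraMap _ _ p →
        sideD p = sideD q * β1 b0 := by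
      intro p q e
      have e1 := congrArg sideL e
      rw [map_mul, sideL_algebraMap, sideL_algebraMap, ← AlgHom.comp_apply sideL β, h5,
        AlgHom.comp_apply, ← map_mul] at e1
      have := psL_injective e1
      rw [← this, mul_comm]
    obtain ⟨r0, hr0, H⟩ := WLt_large hq0 (β1 b0) (ε b0) (main p0 q0 e0)
      (DFunLike.congr_fun h3 b0) (by
        by_contra h0
        exact hq (PowerSeries.isUnit_iff_constantCoeff.2 (isUnit_iff_ne_zero.2 h0)))
    exact ⟨r0, hr0, p0, q0, hq0, e0, H⟩
  choose r hr p q hq e H using key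
  refine ⟨B, _, _, j, inferInstance, χ, β, S, ∑ b ∈ S, r b + 1, rfl, h4.symm, hS, ?_, ?_⟩
  · have := Finset.sum_nonneg (s := S) (f := r) fun b _ => (hr b).le
    linarith
  · intro b hb
    refine ⟨p b, q b, hq b, e b, fun a c ha hc hac => H b a c ha hc (le_trans ?_ hac)⟩
    have := Finset.single_le_sum (f := r) (fun b _ => (hr b).le) hb
    exact mul_le_mul_of_nonneg_right (by linarith) ha.le

lemma ctr_large {y : Pt X (LL k)} {x : Pt X k} [LocallyOfFiniteType X.hom] (h : Lim y x) :
    ∃ r0 : ℝ, 0 < r0 ∧ ∀ (r : ℝ) (hr : 0 < r), r0 ≤ r → Ctr hr y x := by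
  obtain ⟨B, _, _, j, _, χ, β, S, r0, rfl, rfl, hS, hr0, H⟩ := lim_large h
  refine ⟨r0, hr0, fun r hr hrr => ctr_chart_of j χ β rfl S hS fun b hb => ?_⟩
  obtain ⟨p, q, hq, e, H⟩ := H b hb
  exact (phiL_lt hr _ p q hq e).2 (H 1 r one_pos hr (by simpa using hrr))

lemma ctr_small {y : Pt X (LL k)} {x : Pt X k} [LocallyOfFiniteType X.hom] (h : Lim (y.map swapL) x) :
    ∃ r0 : ℝ, 0 < r0 ∧ ∀ (r : ℝ) (hr : 0 < r), r ≤ r0 → Ctr hr y x := by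
  obtain ⟨B, _, _, j, _, χ, β', S, r0, rfl, hy, hS, hr0, H⟩ := lim_large h
  obtain ⟨β, h4, h5⟩ := field_chart' j swapL y β' hy
  refine ⟨r0⁻¹, inv_pos.2 hr0, fun r hr hrr => ctr_chart_of j χ β h4 S hS fun b hb => ?_⟩
  obtain ⟨p, q, hq, e, H⟩ := H b hb
  have hq' : swapD q ≠ 0 := fun h0 => hq (swapD_injective (by rw [h0, map_zero]))
  refine (phiL_lt hr _ (swapD p) (swapD q) hq' ?_).2 ?_
  · apply (swapL (k := k)).toRingHom.injective
    change swapL _ = swapL _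
    rw [map_mul, swapL_algebraMap, swapL_algebraMap, swapD_swapD, swapD_swapD, ← e, ← h5]
    rfl
  · apply WLt_swap
    rw [swapD_swapD, swapD_swapD]
    refine H r 1 hr one_pos ?_
    calc r0 * r ≤ r0 * r0⁻¹ := by gcongr
      _ = 1 := mul_inv_cancel₀ hr0.ne'

/-- two iterated limits agree -/
theorem lemmaS [IsAlgClosed k] [IsProper X.hom] (hX : NR X) {y : Pt X (LL k)} {x x' : Pt X k}
    (h : Lim y x) (h' : Lim (y.map swapL) x') : x = x' := by
  obtain ⟨r1, hr1, H1⟩ := ctr_large h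
  obtain ⟨r2, hr2, H2⟩ := ctr_small h'
  choose c hc using fun r : Set.Ioi (0 : ℝ) => ctr_exists hX (r := r.1) r.2 y
  have hlc : IsLocallyConstant c := by
    rw [IsLocallyConstant.iff_eventually_eq]
    intro r
    have := ctr_open (hc r)
    have h2 := (continuous_subtype_val (p := fun x : ℝ => x ∈ Set.Ioi 0)).continuousAt (x := r) |>.eventually this
    filter_upwards [h2] with r' hr'
    exact ctr_unique (hc r') (hr' r'.2)
  have : PreconnectedSpace (Set.Ioi (0 : ℝ)) := Subtype.preconnectedSpace isPreconnected_Ioi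
  have h3 := hlc.apply_eq_of_isPreconnected isPreconnected_univ (x := ⟨r1, hr1⟩) (y := ⟨r2, hr2⟩)
    trivial trivial
  rw [ctr_unique (H1 r1 hr1 le_rfl) (hc ⟨r1, hr1⟩), ctr_unique (H2 r2 hr2 le_rfl) (hc ⟨r2, hr2⟩), h3]

end P6

section P7
variable {k : Type} [Field k]

lemma extend_curve {Z : OverR k} {X : OverR k} [IsIntegral Z.left] [IsProper X.hom]
    (hZ : ∀ z : Z.left, ValuationRing (Z.left.presheaf.stalk z))
    (y : Spec Z.left.functionField ⟶ X.left)
    (hy : y ≫ X.hom = Z.left.fromSpecStalk _ ≫ Z.hom) :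
    ∃ g : Z ⟶ X, Z.left.fromSpecStalk (genericPoint Z.left) ≫ g.left = y := by
  let f : Z.left ⤏ X.left := Scheme.RationalMap.ofFunctionField Z.hom X.hom y hy
  have hf : f.fromFunctionField = y := Scheme.RationalMap.fromFunctionField_ofFunctionField _ _ _ _
  have hsep : X.left.IsSeparated := by
    constructor
    have : terminal.from X.left = X.hom ≫ terminal.from _ := Subsingleton.elim _ _
    rw [this]
    infer_instance
  have hdom : f.domain = ⊤ := by
    rw [eq_top_iff]
    intro z _
    rw [Scheme.RationalMap.mem_domain]
    have hv := (IsProper.eq_valuativeCriterion ▸ (inferInstanceAs (IsProper X.hom)) :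
      (ValuativeCriterion ⊓ @QuasiCompact ⊓ @QuasiSeparated ⊓ @LocallyOfFiniteType :
        MorphismProperty Scheme) X.hom)
    have hE := hv.1.1.1.existence
    have hsp : genericPoint Z.left ⤳ z := (genericPoint_spec Z.left).specializes trivial
    have hsq : CommSq y (Spec.map (CommRingCat.ofHom (algebraMap (Z.left.presheaf.stalk z) Z.left.functionField))) X.hom
      (Z.left.fromSpecStalk z ≫ Z.hom) := by
      constructor
      rw [hy, ← Category.assoc]
      congr 1
      exact (Scheme.SpecMap_stalkSpecializes_fromSpecStalk hsp).symm
    have := hZ z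
    obtain ⟨⟨l⟩⟩ := hE { R := Z.left.presheaf.stalk z, K := Z.left.functionField, i₁ := y, i₂ := _, commSq := hsq }
    refine ⟨Scheme.PartialMap.ofFromSpecStalk Z.hom X.hom l.l l.fac_right,
      Scheme.PartialMap.mem_domain_ofFromSpecStalk _ _ _ _, ?_⟩
    apply Scheme.RationalMap.eq_of_fromFunctionField_eq
    rw [hf, Scheme.RationalMap.fromFunctionField_toRationalMap]
    have h1 := l.fac_left
    have h2 := Scheme.PartialMap.fromSpecStalkOfMem_ofFromSpecStalk Z.hom X.hom l.l l.fac_right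
    refine Eq.trans ?_ h1
    dsimp only
    refine Eq.trans ?_ (congrArg (fun q => Spec.map (CommRingCat.ofHom (algebraMap (Z.left.presheaf.stalk z) Z.left.functionField)) ≫ q) h2)
    dsimp only [Scheme.PartialMap.fromFunctionField, Scheme.PartialMap.fromSpecStalkOfMem]
    rw [← Category.assoc]
    congr 1
    rw [← cancel_mono (Scheme.Opens.ι _)]
    rw [Category.assoc, Scheme.Opens.fromSpecStalkOfMem_ι, Scheme.Opens.fromSpecStalkOfMem_ι]
    exact (Scheme.SpecMap_stalkSpecializes_fromSpecStalk hsp).symm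
  let p := f.toPartialMap
  have hp : p.domain = ⊤ := hdom
  let g0 : Z.left ⟶ X.left := Z.left.topIso.inv ≫ (Z.left.isoOfEq hp).inv ≫ p.hom
  have hg0 : Z.left.fromSpecStalk (genericPoint Z.left) ≫ g0 = y := by
    have h1 : p.fromFunctionField = y := by
      rw [← hf, ← Scheme.RationalMap.fromFunctionField_toRationalMap]
      congr 1
      exact Scheme.RationalMap.toRationalMap_toPartialMap _
    rw [← h1]
    dsimp only [Scheme.PartialMap.fromFunctionField, Scheme.PartialMap.fromSpecStalkOfMem]
    simp only [g0]
    simp only [← Category.assoc]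
    congr 1
    rw [← cancel_mono (Scheme.Opens.ι _)]
    rw [Scheme.Opens.fromSpecStalkOfMem_ι]
    simp
  have hov : g0 ≫ X.hom = Z.hom := by
    have hd : IsDominant (Z.left.fromSpecStalk (genericPoint Z.left)) := by
      constructor
      have : genericPoint Z.left ∈ Set.range (Z.left.fromSpecStalk (genericPoint Z.left)) := by
        rw [Scheme.range_fromSpecStalk]
        exact specializes_rfl
      rw [DenseRange, dense_iff_closure_eq]
      refine eq_top_iff.mpr (le_trans ?_ (closure_mono (Set.singleton_subset_iff.mpr this)))
      exact (genericPoint_spec Z.left).ge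
    have h3 : Z.left.fromSpecStalk (genericPoint Z.left) ≫ g0 ≫ X.hom = Z.left.fromSpecStalk (genericPoint Z.left) ≫ Z.hom := by
      rw [← hy, ← Category.assoc, hg0]
    exact ext_of_isDominant (Z.left.fromSpecStalk (genericPoint Z.left)) h3
  exact ⟨Over.homMk g0 hov, hg0⟩

lemma A1_integral : AlgebraicGeometry.IsIntegral (SO k (Polynomial k)).left := by
  change AlgebraicGeometry.IsIntegral (Spec (CommRingCat.of (Polynomial k)))
  infer_instance

lemma val_of_localization {R S : Type} [CommRing R] [IsDomain R] [IsPrincipalIdealRing R]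
    [CommRing S] [IsDomain S] [Algebra R S] (p : Ideal R) [p.IsPrime] [IsLocalization.AtPrime S p] :
    ValuationRing S := by
  rw [ValuationRing.iff_dvd_total]
  constructor
  intro a b
  obtain ⟨⟨r, s⟩, hr⟩ := IsLocalization.surj p.primeCompl a
  obtain ⟨⟨r', s'⟩, hr'⟩ := IsLocalization.surj p.primeCompl b
  have hs := IsLocalization.map_units S s
  have hs' := IsLocalization.map_units S s'
  suffices h : algebraMap R S r ∣ algebraMap R S r' ∨ algebraMap R S r' ∣ algebraMap R S r by
    dsimp only at hr hr'
    rw [← hr, ← hr'] at h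
    rwa [hs.mul_right_dvd, hs'.dvd_mul_right, hs'.mul_right_dvd, hs.dvd_mul_right] at h
  obtain ⟨g, hg⟩ := (IsBezout.span_pair_isPrincipal r r').principal
  have h1 : r ∈ Ideal.span {g} := hg.le (Ideal.subset_span (by simp))
  have h2 : r' ∈ Ideal.span {g} := hg.le (Ideal.subset_span (by simp))
  have h3 : g ∈ Ideal.span {r, r'} := hg.ge (Ideal.mem_span_singleton_self g)
  obtain ⟨u, rfl⟩ := Ideal.mem_span_singleton'.mp h1
  obtain ⟨v, rfl⟩ := Ideal.mem_span_singleton'.mp h2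
  obtain ⟨c, d, h⟩ := Ideal.mem_span_pair.mp h3
  by_cases g0 : g = 0
  · subst g0; simp
  have h4 : c * u + d * v = 1 := by
    apply mul_right_cancel₀ g0
    linear_combination h
  by_cases hu : u ∈ p
  · have hv : v ∉ p := fun hv => (‹p.IsPrime›).ne_top ((Ideal.eq_top_iff_one _).mpr
      (h4 ▸ p.add_mem (p.mul_mem_left _ hu) (p.mul_mem_left _ hv)))
    right
    have := IsLocalization.map_units S (⟨v, hv⟩ : p.primeCompl)
    rw [map_mul, map_mul, this.mul_left_dvd]
    exact dvd_mul_left _ _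
  · left
    have := IsLocalization.map_units S (⟨u, hu⟩ : p.primeCompl)
    rw [map_mul, map_mul, this.mul_left_dvd]
    exact dvd_mul_left _ _

lemma ff_affine (P : CommRingCat.{0}) [IsDomain P] : (Spec P).fromSpecStalk (genericPoint (Spec P)) =
    Spec.map (CommRingCat.ofHom (algebraMap P (Spec P).functionField)) :=
  Spec.fromSpecStalk_eq' _ _

lemma ff_affine' (P : CommRingCat.{0}) [IsDomain P] (F : Type) [Field F] [Algebra P F] [IsFractionRing P F] :
    ∃ E : CommRingCat.of F ≅ (Spec P).functionField,
      (Spec P).fromSpecStalk (genericPoint (Spec P)) =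
      Spec.map E.hom ≫ Spec.map (CommRingCat.ofHom (algebraMap P F)) := by
  have h := ff_affine P
  let e : F ≃ₐ[P] (Spec P).functionField :=
    IsLocalization.algEquiv (nonZeroDivisors P) F (Spec P).functionField
  refine ⟨e.toRingEquiv.toCommRingCatIso, h.trans ?_⟩
  rw [← Spec.map_comp]
  congr 1
  ext r
  exact (e.commutes _).symm

lemma extend_affine_aux (P : CommRingCat.{0}) [IsDomain P] (F : Type) [Field F] [Algebra P F] [IsFractionRing P F]
    {X : OverR k} [IsProper X.hom] (a : Spec P ⟶ SR k)
    (hR : ∀ z : PrimeSpectrum P, ValuationRing (Localization.AtPrime z.asIdeal)) (y : Spec (CommRingCat.of F) ⟶ X.left)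
    (hy : y ≫ X.hom = Spec.map (CommRingCat.ofHom (algebraMap P F)) ≫ a) :
    ∃ g : Over.mk a ⟶ X, Spec.map (CommRingCat.ofHom (algebraMap P F)) ≫ g.left = y := by
  obtain ⟨E, hE⟩ := ff_affine' P F
  have hI : AlgebraicGeometry.IsIntegral (Over.mk a).left := by
    change AlgebraicGeometry.IsIntegral (Spec P)
    infer_instance
  obtain ⟨g, hg⟩ := extend_curve (Z := Over.mk a) (X := X) (by
    intro z
    have : IsDomain ((Spec P).presheaf.stalk z) := inferInstance
    let z' : PrimeSpectrum P := z
    have := hR z'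
    let e2 : (Spec P).presheaf.stalk z' ≃+* Localization.AtPrime z'.asIdeal :=
      (Spec.stalkIso P z').commRingCatIsoToRingEquiv
    suffices h : ValuationRing ((Spec P).presheaf.stalk z') from h
    rw [ValuationRing.iff_dvd_total]
    constructor
    intro a b
    rw [← map_dvd_iff e2, ← map_dvd_iff e2]
    exact ValuationRing.dvd_total _ _)
    (Spec.map E.hom ≫ y) (by
      refine Eq.trans ?_ (congrArg (· ≫ a) hE).symm
      exact (Category.assoc _ _ _).trans ((congrArg (Spec.map E.hom ≫ ·) hy).trans (Category.assoc _ _ _).symm))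
  refine ⟨g, ?_⟩
  have h1 := (congrArg (· ≫ g.left) hE).symm.trans hg
  rw [← cancel_epi (Spec.map E.hom)]
  exact (Category.assoc _ _ _).symm.trans h1

lemma extend_affine {R F : Type} [CommRing R] [IsDomain R] [Field F] [Algebra R F] [IsFractionRing R F]
    [Algebra k R] [Algebra k F] [IsScalarTower k R F]
    {X : OverR k} [IsProper X.hom]
    (hR : ∀ z : PrimeSpectrum R, ValuationRing (Localization.AtPrime z.asIdeal)) (y : Pt X F) :
    ∃ g : Pt X R, g.map (IsScalarTower.toAlgHom k R F) = y := by
  have i2 : IsDomain (CommRingCat.of R) := inferInstanceAs (IsDomain R)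
  have i3 : IsFractionRing (CommRingCat.of R) F := inferInstanceAs (IsFractionRing R F)
  obtain ⟨g, hg⟩ := extend_affine_aux (CommRingCat.of R) F (X := X)
    (Spec.map (CommRingCat.ofHom (algebraMap k R))) hR y.left (by
      rw [Over.w y, ← Spec.map_comp, ← CommRingCat.ofHom_comp]
      simp only [Over.mk_hom]
      congr 2
      exact IsScalarTower.algebraMap_eq k R F)
  exact ⟨g, Over.OverMorphism.ext hg⟩

lemma nr_of_gm [IsAlgClosed k] {X : OverR k} [IsProper X.hom] (h : ∀ f : GmO k ⟶ X, IsConstant f) : NR X := by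
  intro y
  obtain ⟨g, hg⟩ := extend_affine (R := Polynomial k) (fun z => val_of_localization z.asIdeal) y
  let ι : Polynomial k →ₐ[k] LaurentPolynomial k := Polynomial.toLaurentAlg
  obtain ⟨x0, hx0⟩ := h (SOmap ι ≫ g)
  have hu : ∀ z : Submonoid.powers (Polynomial.X : Polynomial k), IsUnit (algebraMap (Polynomial k) (RatFunc k) z) := by
    rintro ⟨_, n, rfl⟩
    simp only [map_pow]
    refine IsUnit.pow _ (IsUnit.mk0 _ ?_)
    simpa using RatFunc.X_ne_zero
  let j : LaurentPolynomial k →ₐ[k] RatFunc k :=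
    { IsLocalization.lift (M := Submonoid.powers (Polynomial.X : Polynomial k)) hu with
      commutes' := by
        intro r
        have : algebraMap k (LaurentPolynomial k) r = algebraMap (Polynomial k) _ (Polynomial.C r) := by
          rw [LaurentPolynomial.algebraMap_eq_toLaurent, Polynomial.toLaurent_C]
          rfl
        rw [this]
        refine (IsLocalization.lift_eq hu _).trans ?_
        rfl }
  have hj : j.comp ι = IsScalarTower.toAlgHom k (Polynomial k) (RatFunc k) := by
    ext1
    exact IsLocalization.lift_eq hu Polynomial.X
  let a : LaurentPolynomial k →ₐ[k] k := AddMonoidAlgebra.lift k k ℤ 1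
  let x : Pt X k := Pt.map (a.comp ι) g
  have hx : x.left = x0 := by
    have h2 : x.left = (SOmap a).left ≫ (SOmap ι ≫ g).left := by
      rw [← Over.comp_left, ← Category.assoc, ← SOmap_comp]
      rfl
    refine h2.trans ((congrArg ((SOmap a).left ≫ ·) hx0).trans ?_)
    refine (Category.assoc _ _ _).symm.trans ((congrArg (· ≫ x0) (Over.w (SOmap a))).trans ?_)
    refine (congrArg (· ≫ x0) (Spec.map_id (CommRingCat.of k))).trans (Category.id_comp _)
  refine ⟨x, ?_⟩
  rw [← hg, ← hj, ← Pt.map_map]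
  ext1
  have h2 : (Pt.map j (Pt.map ι g)).left = (SOmap j).left ≫ (SOmap ι ≫ g).left := rfl
  refine h2.trans ((congrArg ((SOmap j).left ≫ ·) hx0).trans ?_)
  refine (Category.assoc _ _ _).symm.trans ?_
  rw [← hx]
  refine congrArg (· ≫ x.left) ?_
  exact Over.w (SOmap j)
end P7

section P8
variable {k : Type} [Field k]

lemma intclos_finite [CharZero k] (B K L : Type) [CommRing B] [IsDomain B] [Algebra k B]
    [Algebra.FiniteType k B] [Field K] [Algebra B K] [IsFractionRing B K] [Field L] [Algebra K L]
    [Algebra B L] [IsScalarTower B K L] [FiniteDimensional K L] :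
    Module.Finite B (integralClosure B L) := by
  obtain ⟨s, g, ginj, gfin⟩ := exists_finite_inj_algHom_of_fg k B
  let P := MvPolynomial (Fin s) k
  let : Algebra P B := g.toRingHom.toAlgebra
  let : Algebra P L := ((algebraMap B L).comp (algebraMap P B)).toAlgebra
  let : Algebra P K := ((algebraMap B K).comp (algebraMap P B)).toAlgebra
  have t1 : IsScalarTower P B L := IsScalarTower.of_algebraMap_eq fun _ => rfl
  have t2 : IsScalarTower P B K := IsScalarTower.of_algebraMap_eq fun _ => rfl
  have t3 : IsScalarTower P K L := IsScalarTower.of_algebraMap_eq fun x => by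
    change algebraMap B L _ = algebraMap K L (algebraMap B K _)
    rw [IsScalarTower.algebraMap_apply B K L]
  have hfin : Module.Finite P B := gfin
  have hPB : Function.Injective (algebraMap P B) := ginj
  have hBK := IsFractionRing.injective B K
  have f1 : FaithfulSMul P B := (faithfulSMul_iff_algebraMap_injective P B).mpr hPB
  have f2 : FaithfulSMul P K := (faithfulSMul_iff_algebraMap_injective P K).mpr (hBK.comp hPB)
  have f3 : FaithfulSMul P L := (faithfulSMul_iff_algebraMap_injective P L).mpr
    (by rw [IsScalarTower.algebraMap_eq P K L]; exact (algebraMap K L).injective.comp (hBK.comp hPB))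
  let KP := FractionRing P
  let : Algebra KP K := FractionRing.liftAlgebra P K
  let : Algebra KP L := ((algebraMap K L).comp (algebraMap KP K)).toAlgebra
  have t4 : IsScalarTower KP K L := IsScalarTower.of_algebraMap_eq fun _ => rfl
  have t5 : IsScalarTower P KP K := inferInstance
  have t6 : IsScalarTower P KP L := IsScalarTower.of_algebraMap_eq fun x => by
    change algebraMap P L x = algebraMap K L (algebraMap KP K (algebraMap P KP x))
    rw [← IsScalarTower.algebraMap_apply P KP K, ← IsScalarTower.algebraMap_apply P K L]
  have : FiniteDimensional KP K := by
    have : IsLocalization (Algebra.algebraMapSubmonoid B (nonZeroDivisors P)) K := inferInstance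
    exact .of_isLocalization P B (nonZeroDivisors P)
  have : FiniteDimensional KP L := FiniteDimensional.trans KP K L
  have c0 : CharZero KP := by
    have : CharZero P := MvPolynomial.instCharZero _ _
    exact charZero_of_injective_algebraMap (IsFractionRing.injective P KP)
  have : Algebra.IsSeparable KP L := inferInstance
  have h := IsIntegralClosure.finite P KP L (integralClosure P L)
  have hle : ∀ x : L, x ∈ integralClosure B L ↔ x ∈ integralClosure P L := by
    intro x
    have : Algebra.IsIntegral P B := inferInstance
    exact ⟨fun hx => isIntegral_trans x hx, fun hx => hx.tower_top⟩
  let e : integralClosure P L →ₗ[P] integralClosure B L :=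
    { toFun := fun x => ⟨x.1, (hle _).mpr x.2⟩
      map_add' := fun _ _ => rfl
      map_smul' := fun c x => rfl }
  have h2 : Module.Finite P (integralClosure B L) :=
    Module.Finite.of_surjective e fun x => ⟨⟨x.1, (hle _).mp x.2⟩, rfl⟩
  exact Module.Finite.of_restrictScalars_finite P B _

lemma intclosed_locus [CharZero k] (B : Type) [CommRing B] [IsDomain B] [Algebra k B]
    [Algebra.FiniteType k B] : ∃ f : B, f ≠ 0 ∧ ∀ (C : Type) [CommRing C] [Algebra B C]
      [IsLocalization.Away f C], IsIntegrallyClosed C := by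
  let K := FractionRing B
  have h := intclos_finite (k := k) B K K
  have hfr : IsFractionRing (integralClosure B K) K := inferInstance
  classical
  obtain ⟨S, hS⟩ := h.1
  obtain ⟨f, hf⟩ := IsLocalization.exist_integer_multiples_of_finset (nonZeroDivisors B) (S.image (fun x : integralClosure B K => (x : K)))
  have hf2 : ∀ x : K, IsIntegral B x → ∃ b, algebraMap B K b = algebraMap B K f * x := by
    intro x hx
    have : (⟨x, hx⟩ : integralClosure B K) ∈ Submodule.span B (S : Set (integralClosure B K)) := hS ▸ trivial
    refine Submodule.span_induction (p := fun (y : integralClosure B K) _ => ∃ b, algebraMap B K b = algebraMap B K f * y) ?_ ?_ ?_ ?_ this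
    · intro y hy
      obtain ⟨b, hb⟩ := hf (y : K) (Finset.mem_image_of_mem _ hy)
      exact ⟨b, by rw [hb, Algebra.smul_def]⟩
    · exact ⟨0, by simp⟩
    · rintro y z _ _ ⟨b, hb⟩ ⟨c, hc⟩
      exact ⟨b + c, by rw [map_add, hb, hc]; push_cast; ring⟩
    · rintro r y _ ⟨b, hb⟩
      exact ⟨r * b, by rw [map_mul, hb, Subalgebra.coe_smul, Algebra.smul_def]; ring⟩
  refine ⟨f, nonZeroDivisors.coe_ne_zero f, ?_⟩
  intro Bp _ _ _
  let M := Submonoid.powers (f : B)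
  have hM : M ≤ nonZeroDivisors B := Submonoid.powers_le.mpr f.2
  have hD : IsDomain Bp := IsLocalization.isDomain_of_le_nonZeroDivisors (M := M) (R := B) (S := Bp) hM
  let : Algebra Bp K := (IsLocalization.lift (M := M) (S := Bp) (g := algebraMap B K)
    (fun y => IsLocalization.map_units K (⟨y, hM y.2⟩ : nonZeroDivisors B))).toAlgebra
  have : IsScalarTower B Bp K := IsScalarTower.of_algebraMap_eq' (IsLocalization.lift_comp _).symm
  have : IsFractionRing Bp K := IsFractionRing.isFractionRing_of_isDomain_of_isLocalization M Bp K
  rw [isIntegrallyClosed_iff K]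
  intro x hx
  obtain ⟨m, hm⟩ := IsIntegral.exists_multiple_integral_of_isLocalization M x hx
  obtain ⟨b, hb⟩ := hf2 _ hm
  let f' : M := ⟨f, Submonoid.mem_powers _⟩
  refine ⟨IsLocalization.mk' Bp b (f' * m), ?_⟩
  have hne : ∀ m : M, algebraMap B K m ≠ 0 := fun m =>
    (map_ne_zero_iff _ (IsFractionRing.injective B K)).mpr (nonZeroDivisors.ne_zero (hM m.2))
  have h3 := congrArg (algebraMap Bp K) (IsLocalization.mk'_spec Bp b (f' * m))
  rw [map_mul, ← IsScalarTower.algebraMap_apply, ← IsScalarTower.algebraMap_apply, hb] at h3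
  apply mul_right_cancel₀ (hne (f' * m))
  rw [h3]
  simp only [Submonoid.coe_mul, map_mul]
  rw [Submonoid.smul_def, Algebra.smul_def]
  ring
end P8

section P9
variable {k : Type} [Field k]

def Homog (Z : OverR k) : Prop := ∀ x y : Pt Z k, ∃ e : Z ⟶ Z, IsIso e.left ∧ x ≫ e = y

lemma homog_pt [IsAlgClosed k] {Z : OverR k} [LocallyOfFiniteType Z.hom] (hZ : Homog Z)
    (U : Set Z.left) (hinv : ∀ e : Z ⟶ Z, IsIso e.left → ∀ x, e.left x ∈ U → x ∈ U)
    {y : Z.left} (hy : y ∈ U) (hyc : IsClosed {y}) {x : Z.left} (hx : IsClosed {x}) : x ∈ U := by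
  obtain ⟨p, rfl⟩ := exists_kpt x hx
  obtain ⟨q, rfl⟩ := exists_kpt y hyc
  obtain ⟨e, he, hpq⟩ := hZ p q
  apply hinv e he
  rw [← cl_comp, hpq]
  exact hy

lemma exists_closed [LocallyOfFiniteType (Z : OverR k).hom] (U : Set Z.left) (hU : IsLocallyClosed U)
    (hne : U.Nonempty) : ∃ x ∈ U, IsClosed {x} := by
  have := LocallyOfFiniteType.jacobsonSpace Z.hom
  obtain ⟨x, hx, hc⟩ := nonempty_inter_closedPoints hne hU
  exact ⟨x, hx, hc⟩

lemma homog_open [IsAlgClosed k] {Z : OverR k} [LocallyOfFiniteType Z.hom] (hZ : Homog Z)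
    (U : Set Z.left) (hinv : ∀ e : Z ⟶ Z, IsIso e.left → ∀ x, e.left x ∈ U → x ∈ U)
    (hU : IsOpen U) (hne : U.Nonempty) (x : Z.left) : x ∈ U := by
  by_contra hx
  obtain ⟨y, hy, hyc⟩ := exists_closed U hU.isLocallyClosed hne
  obtain ⟨z, hz, hzc⟩ := exists_closed Uᶜ hU.isClosed_compl.isLocallyClosed ⟨x, hx⟩
  exact hz (homog_pt hZ U hinv hy hyc hzc)

lemma homog_irreducible [IsAlgClosed k] {Z : OverR k} [LocallyOfFiniteType Z.hom] [QuasiCompact Z.hom]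
    [ConnectedSpace Z.left] (hZ : Homog Z) : IrreducibleSpace Z.left := by
  have : IsLocallyNoetherian Z.left := LocallyOfFiniteType.isLocallyNoetherian Z.hom
  have : CompactSpace Z.left := QuasiCompact.compactSpace_of_compactSpace Z.hom
  have : IsNoetherian Z.left := {}
  let U : Set Z.left := {x | ∃ N : Set Z.left, IsOpen N ∧ x ∈ N ∧ IsIrreducible N}
  have hUo : IsOpen U := by
    rw [isOpen_iff_forall_mem_open]
    rintro x ⟨N, hN, hx, hi⟩
    exact ⟨N, fun y hy => ⟨N, hN, hy, hi⟩, hN, hx⟩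
  have hne : U.Nonempty := by
    obtain ⟨x⟩ := (inferInstance : Nonempty Z.left)
    obtain ⟨o, ho, hoe, hle⟩ := TopologicalSpace.NoetherianSpace.exists_isOpen_nonempty_subset_irreducibleComponent
      (irreducibleComponent x) (irreducibleComponent_mem_irreducibleComponents x)
    obtain ⟨y, hy⟩ := hoe
    exact ⟨y, o, ho, hy, ⟨y, hy⟩, isIrreducible_irreducibleComponent.2.open_subset ho hle⟩
  have hU := homog_open hZ U (by
    rintro e he x ⟨N, hN, hx, hi⟩
    have hh : IsHomeomorph e.left := ⟨e.left.continuous, e.left.isOpenEmbedding.isOpenMap, e.left.homeomorph.bijective⟩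
    refine ⟨e.left ⁻¹' N, hN.preimage e.left.continuous, hx, ?_⟩
    refine ⟨⟨x, hx⟩, hi.2.preimage e.left.isOpenEmbedding⟩) hUo hne
  obtain ⟨x⟩ := (inferInstance : Nonempty Z.left)
  obtain ⟨N, hN, hx, hi⟩ := hU x
  have hcl : IsClopen (closure N) := by
    refine ⟨isClosed_closure, ?_⟩
    rw [isOpen_iff_forall_mem_open]
    intro y hy
    obtain ⟨N', hN', hy', hi'⟩ := hU y
    refine ⟨N', ?_, hN', hy'⟩
    obtain ⟨z, hz, hz'⟩ := mem_closure_iff.mp hy N' hN' hy'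
    have h1 : N' ⊆ closure (N' ∩ N) := subset_closure_inter_of_isPreirreducible_of_isOpen hi'.2 hN ⟨z, hz, hz'⟩
    exact h1.trans (closure_mono Set.inter_subset_right)
  have h2 : closure N = Set.univ := hcl.eq_univ ⟨x, subset_closure hx⟩
  have h3 : IsIrreducible (Set.univ : Set Z.left) := h2 ▸ hi.closure
  exact (irreducibleSpace_def _).mpr h3

lemma homog_smooth [IsAlgClosed k] {Z : OverR k} [LocallyOfFiniteType Z.hom] [IsReduced Z.left]
    [Nonempty Z.left] (hZ : Homog Z) : Smooth Z.hom := by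
  have := LocallyOfFiniteType.isLocallyNoetherian Z.hom
  have : LocallyOfFinitePresentation Z.hom := inferInstance
  rw [← Scheme.Hom.smoothLocus_eq_top_iff, ← TopologicalSpace.Opens.coe_eq_univ, Set.eq_univ_iff_forall]
  refine homog_open hZ _ ?_ Z.hom.smoothLocus.2 (Z.hom.dense_smoothLocus_of_perfectField.nonempty)
  intro e he x hx
  have h : e.left ⁻¹ᵁ Z.hom.smoothLocus = Z.hom.smoothLocus := by
    rw [Scheme.Hom.preimage_smoothLocus_eq]
    congr 1
    exact Over.w e
  have h2 : x ∈ e.left ⁻¹ᵁ Z.hom.smoothLocus := hx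
  rw [h] at h2
  exact h2

lemma homog_normal [IsAlgClosed k] [CharZero k] {Z : OverR k} [LocallyOfFiniteType Z.hom]
    [AlgebraicGeometry.IsIntegral Z.left] (hZ : Homog Z) (x : Z.left) :
    ∃ U : Z.left.Opens, IsAffineOpen U ∧ x ∈ U ∧ IsIntegrallyClosed Γ(Z.left, U) := by
  refine homog_open hZ {x | ∃ U : Z.left.Opens, IsAffineOpen U ∧ x ∈ U ∧ IsIntegrallyClosed Γ(Z.left, U)} ?_ ?_ ?_ x
  · rintro e he x ⟨U, hU, hx, hn⟩
    exact ⟨e.left ⁻¹ᵁ U, hU.preimage_of_isIso _, hx,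
      IsIntegrallyClosed.of_equiv (asIso (e.left.app U)).commRingCatIsoToRingEquiv⟩
  · rw [isOpen_iff_forall_mem_open]
    rintro x ⟨N, hN, hx, hi⟩
    exact ⟨N, fun y hy => ⟨N, hN, hy, hi⟩, N.2, hx⟩
  obtain ⟨U, hU, hx, -⟩ := exists_isAffineOpen_mem_and_subset (x := x) (U := ⊤) trivial
  let h : Spec Γ(Z.left, U) ⟶ SR k := hU.fromSpec ≫ Z.hom
  let a : k →+* Γ(Z.left, U) := (Spec.preimage h).hom
  let : Algebra k Γ(Z.left, U) := a.toAlgebra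
  have hft : Algebra.FiniteType k Γ(Z.left, U) := by
    have h0 : LocallyOfFiniteType h := inferInstance
    have h2 : LocallyOfFiniteType (Spec.map (CommRingCat.ofHom a)) := by
      have h3 : Spec.map (CommRingCat.ofHom a) = h := Spec.map_preimage h
      rw [h3]; exact h0
    rw [HasRingHomProperty.Spec_iff (P := @LocallyOfFiniteType)] at h2
    exact RingHom.finiteType_algebraMap.1 h2
  have : Nonempty U := ⟨⟨x, hx⟩⟩
  obtain ⟨f, hf0, hf⟩ := intclosed_locus (k := k) Γ(Z.left, U)
  have h1 := hU.isLocalization_basicOpen f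
  have h2 : (Z.left.basicOpen f : Set Z.left).Nonempty := by
    by_contra hc
    rw [Set.not_nonempty_iff_eq_empty] at hc
    apply hf0
    apply (basicOpen_eq_bot_iff f).mp
    ext1
    exact hc
  obtain ⟨y, hy⟩ := h2
  exact ⟨y, Z.left.basicOpen f, hU.basicOpen f, hy, hf _⟩

/-- the constant map -/
def constO (T : OverR k) {X : OverR k} (p : Pt X k) : T ⟶ X :=
  Over.homMk (U := T) (V := SO k k) T.hom (by
    change T.hom ≫ Spec.map (CommRingCat.ofHom (RingHom.id k)) = T.hom
    rw [CommRingCat.ofHom_id, Spec.map_id, Category.comp_id]) ≫ p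

lemma comp_constO {T T' X : OverR k} (f : T ⟶ T') (p : Pt X k) : f ≫ constO T' p = constO T p := by
  rw [constO, constO, ← Category.assoc]
  congr 1
  ext1
  exact Over.w f

lemma constO_comp {T X Y : OverR k} (f : X ⟶ Y) (p : Pt X k) : constO T p ≫ f = constO T (p ≫ f : Pt Y k) :=
  Category.assoc _ _ _

lemma constO_k {X : OverR k} (p : Pt X k) : constO (SO k k) p = p := by
  rw [constO]
  convert Category.id_comp p
  ext1
  exact (congrArg Spec.map CommRingCat.ofHom_id).trans (Spec.map_id _)

lemma constO_pt {R : Type} [CommRing R] [Algebra k R] {X : OverR k} (p : Pt X k) :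
    constO (SO k R) p = p.map (Algebra.ofId k R) := by
  conv_rhs => rw [Pt.map, ← constO_k p, comp_constO]

namespace GroupScheme
variable (Γ : GroupScheme k)

/-- left translation by a point -/
def tr (a : Pt Γ.G k) : Γ.G ⟶ Γ.G := Γ.mul (constO _ a) (𝟙 _)

lemma comp_tr {T : OverR k} (t : T ⟶ Γ.G) (a : Pt Γ.G k) : t ≫ Γ.tr a = Γ.mul (constO T a) t := by
  rw [tr, Γ.mul_natural, comp_constO, Category.comp_id]

lemma tr_tr (a b : Pt Γ.G k) (h : Γ.mul b a = Γ.one _) : Γ.tr a ≫ Γ.tr b = 𝟙 _ := by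
  rw [comp_tr, tr, ← Γ.mul_assoc]
  have h2 : Γ.mul (constO Γ.G b) (constO Γ.G a) = Γ.one _ := by
    unfold constO
    rw [← Γ.mul_natural, h, Γ.one_natural]
  rw [h2, Γ.one_mul]

lemma tr_iso (a : Pt Γ.G k) : IsIso (Γ.tr a) :=
  ⟨Γ.tr (Γ.inv a), Γ.tr_tr _ _ (Γ.inv_mul a), Γ.tr_tr _ _ (Γ.mul_inv' a)⟩

lemma homog : Homog Γ.G := by
  intro x y
  refine ⟨Γ.tr (Γ.mul y (Γ.inv x)), ?_, ?_⟩
  · have := Γ.tr_iso (Γ.mul y (Γ.inv x))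
    exact inferInstanceAs (IsIso ((Over.forget _).map (Γ.tr (Γ.mul y (Γ.inv x)))))
  · rw [comp_tr, constO_k, Γ.mul_assoc, Γ.inv_mul, Γ.mul_one']

end GroupScheme
end P9

section P10
open TensorProduct
variable {k : Type} [Field k]

lemma eq_zero_of_chars [IsAlgClosed k] {B : Type} [CommRing B] [Algebra k B] [Algebra.FiniteType k B]
    [_root_.IsReduced B] (b : B) (h : ∀ χ : B →ₐ[k] k, χ b = 0) : b = 0 := by
  have hJ : IsJacobsonRing B := isJacobsonRing_of_finiteType (A := k)
  have h1 : b ∈ Ideal.jacobson (⊥ : Ideal B) := by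
    rw [Ideal.jacobson, Ideal.mem_sInf]
    rintro m ⟨-, hm⟩
    obtain ⟨χ, hχ⟩ := residue_char (k := k) m
    rw [← hχ]
    exact h χ
  rw [(isJacobsonRing_iff.mp hJ ⊥ (fun x hx => (nilradical_eq_zero B).le (show x ∈ nilradical B from hx)))] at h1
  exact h1

lemma tensor_reduced [IsAlgClosed k] {B C : Type} [CommRing B] [Algebra k B] [Algebra.FiniteType k B]
    [_root_.IsReduced B] [CommRing C] [Algebra k C] [_root_.IsReduced C] : _root_.IsReduced (B ⊗[k] C) := by
  let b := Module.Basis.ofVectorSpace k C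
  let b' := Algebra.TensorProduct.basis B b
  constructor
  intro x hx
  apply b'.repr.injective
  rw [map_zero]
  ext i
  rw [Finsupp.zero_apply]
  apply eq_zero_of_chars (k := k)
  intro χ
  let φ : B ⊗[k] C →ₐ[k] C := Algebra.TensorProduct.lift ((Algebra.ofId k C).comp χ) (AlgHom.id k C) (fun _ _ => Commute.all _ _)
  have h0 : φ x = 0 := (hx.map φ).eq_zero
  have h1 : φ x = (b'.repr x).sum (fun i r => χ r • b i) := by
    conv_lhs => rw [← b'.linearCombination_repr x, Finsupp.linearCombination_apply, Finsupp.sum, map_sum]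
    refine Finset.sum_congr rfl fun i _ => ?_
    rw [Algebra.TensorProduct.basis_apply, TensorProduct.smul_tmul', smul_eq_mul, mul_one]
    simp only [φ, Algebra.TensorProduct.lift_tmul, Algebra.smul_def]
    rfl
  have h2 := linearIndependent_iff'.mp b.linearIndependent (b'.repr x).support (fun i => χ (b'.repr x i)) (h1.symm.trans h0)
  by_cases hi : i ∈ (b'.repr x).support
  · exact h2 i hi
  · rw [Finsupp.notMem_support_iff.mp hi, map_zero]

variable {X Y Z : OverR k}

lemma prod_reduced [IsAlgClosed k] [LocallyOfFiniteType X.hom] [LocallyOfFiniteType Y.hom]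
    [IsReduced X.left] [IsReduced Y.left] : IsReduced (prodO X Y).left := by
  have key : ∀ z : (prodO X Y).left, _root_.IsReduced ((prodO X Y).left.presheaf.stalk z) := by
    intro z
    obtain ⟨B, _, _, j, hj, hx⟩ := exists_chart X ((fstO X Y).left z)
    obtain ⟨C, _, _, i, hi, hy⟩ := exists_chart Y ((sndO X Y).left z)
    have := chart_finiteType j
    have hB0 : IsReduced (SO k B).left := isReduced_of_isOpenImmersion j.left
    have : IsReduced (SO k C).left := isReduced_of_isOpenImmersion i.left
    have hB : _root_.IsReduced B := (affine_isReduced_iff (CommRingCat.of B)).mp hB0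
    have hC : _root_.IsReduced C := (affine_isReduced_iff (CommRingCat.of C)).mp ‹_›
    have hT : _root_.IsReduced (B ⊗[k] C) := tensor_reduced
    have hT' : IsReduced (Spec (CommRingCat.of (B ⊗[k] C))) := (affine_isReduced_iff (CommRingCat.of (B ⊗[k] C))).mpr hT
    let g : pullback (SO k B).hom (SO k C).hom ⟶ (prodO X Y).left :=
      pullback.map (SO k B).hom (SO k C).hom X.hom Y.hom j.left i.left (𝟙 _)
        (by rw [Over.w, Category.comp_id]) (by rw [Over.w, Category.comp_id])
    have hg : IsOpenImmersion g := inferInstanceAs (IsOpenImmersion (pullback.map _ _ _ _ _ _ _ _ _))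
    have hr : z ∈ Set.range g := by
      have h2 := Scheme.Pullback.range_map (SO k B).hom (SO k C).hom X.hom Y.hom j.left i.left (𝟙 _)
        (by rw [Over.w, Category.comp_id]) (by rw [Over.w, Category.comp_id])
      exact h2.ge ⟨hx, hy⟩
    obtain ⟨w, rfl⟩ := hr
    have hP : IsReduced (pullback (SO k B).hom (SO k C).hom) := by
      let e := pullbackSpecIso k B C
      exact isReduced_of_isOpenImmersion (X := pullback (SO k B).hom (SO k C).hom) (Y := Spec (CommRingCat.of (B ⊗[k] C))) e.hom
    have : _root_.IsReduced ((pullback (SO k B).hom (SO k C).hom).presheaf.stalk w) := inferInstance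
    exact isReduced_of_injective (g.stalkMap w).hom
      ((ConcreteCategory.isIso_iff_bijective (g.stalkMap w)).mp inferInstance).1
  exact isReduced_of_isReduced_stalk _

lemma prod_irreducible [IsAlgClosed k] [LocallyOfFiniteType X.hom] [LocallyOfFiniteType Y.hom]
    [IrreducibleSpace X.left] [IrreducibleSpace Y.left] : IrreducibleSpace (prodO X Y).left := by
  have hl : LocallyOfFiniteType (prodO X Y).hom := by
    change LocallyOfFiniteType (pullback.fst X.hom Y.hom ≫ X.hom); infer_instance
  have hmeet : ∀ (Z : OverR k) [LocallyOfFiniteType Z.hom] [IrreducibleSpace Z.left] (U V : Set Z.left),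
      IsOpen U → IsOpen V → U.Nonempty → V.Nonempty → ∃ p : Pt Z k, p.cl ∈ U ∧ p.cl ∈ V := by
    intro Z _ _ U V hU hV hU' hV'
    obtain ⟨x, hx, hc⟩ := exists_closed (U ∩ V) (hU.inter hV).isLocallyClosed
      (nonempty_preirreducible_inter hU hV hU' hV')
    obtain ⟨p, rfl⟩ := exists_kpt x hc
    exact ⟨p, hx⟩
  have hpt : ∀ (Z : OverR k) [LocallyOfFiniteType Z.hom] (U : Set Z.left),
      IsOpen U → U.Nonempty → ∃ p : Pt Z k, p.cl ∈ U := by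
    intro Z _ U hU hU'
    obtain ⟨x, hx, hc⟩ := exists_closed U hU.isLocallyClosed hU'
    obtain ⟨p, rfl⟩ := exists_kpt x hc
    exact ⟨p, hx⟩
  have hne : Nonempty (prodO X Y).left := by
    obtain ⟨x, -⟩ := hpt X Set.univ isOpen_univ ⟨Classical.arbitrary _, trivial⟩
    obtain ⟨y, -⟩ := hpt Y Set.univ isOpen_univ ⟨Classical.arbitrary _, trivial⟩
    exact ⟨Pt.cl (liftO x y : Pt (prodO X Y) k)⟩
  have hp : PreirreducibleSpace (prodO X Y).left := by
    constructor
    rintro U V hU hV hU' hV'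
    rw [Set.univ_inter] at hU' hV' ⊢
    obtain ⟨p, hp⟩ := hpt _ U hU hU'
    obtain ⟨q, hq⟩ := hpt _ V hV hV'
    let sX : Pt (prodO X Y) k → (X ⟶ prodO X Y) := fun p => liftO (𝟙 X) (constO X (p ≫ sndO X Y : Pt Y k))
    have hsX : ∀ p : Pt (prodO X Y) k, ∀ x : Pt X k, x ≫ sX p = liftO x (p ≫ sndO X Y) := by
      intro p x
      rw [comp_liftO, Category.comp_id, comp_constO, constO_k]
    have hs : ∀ (p : Pt (prodO X Y) k) (U : Set (prodO X Y).left), p.cl ∈ U → ((sX p).left ⁻¹' U).Nonempty := by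
      intro p U hp
      refine ⟨Pt.cl (p ≫ fstO X Y : Pt X k), ?_⟩
      rw [Set.mem_preimage, ← cl_comp, hsX, liftO_eta]
      exact hp
    obtain ⟨x, hx1, hx2⟩ := hmeet X _ _ (hU.preimage (sX p).left.continuous) (hV.preimage (sX q).left.continuous)
      (hs p U hp) (hs q V hq)
    rw [Set.mem_preimage, ← cl_comp, hsX] at hx1 hx2
    let sY : Y ⟶ prodO X Y := liftO (constO Y x) (𝟙 Y)
    have hsY : ∀ y : Pt Y k, y ≫ sY = liftO x y := by
      intro y
      rw [comp_liftO, Category.comp_id, comp_constO, constO_k]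
    obtain ⟨y, hy1, hy2⟩ := hmeet Y _ _ (hU.preimage sY.left.continuous) (hV.preimage sY.left.continuous)
      ⟨Pt.cl (p ≫ sndO X Y : Pt Y k), by rw [Set.mem_preimage, ← cl_comp, hsY]; exact hx1⟩
      ⟨Pt.cl (q ≫ sndO X Y : Pt Y k), by rw [Set.mem_preimage, ← cl_comp, hsY]; exact hx2⟩
    exact ⟨_, hy1, hy2⟩
  exact { hp with toNonempty := hne }

lemma constO_apply {T X : OverR k} (p : Pt X k) (t : T.left) : (constO T p).left t = p.cl := by
  have h : ∀ s : SR k, p.left s = p.cl := by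
    intro s
    have : Subsingleton (PrimeSpectrum k) := inferInstance
    have h2 : s = IsLocalRing.closedPoint k := Subsingleton.elim (α := PrimeSpectrum k) _ _
    rw [h2]; rfl
  exact h _

namespace GroupScheme
variable (Γ : GroupScheme k)

lemma separated [IsAlgClosed k] [LocallyOfFiniteType Γ.G.hom] : IsSeparated Γ.G.hom := by
  have : IsLocallyNoetherian Γ.G.left := LocallyOfFiniteType.isLocallyNoetherian Γ.G.hom
  have : QuasiSeparated Γ.G.hom := inferInstance
  apply IsSeparated.of_valuativeCriterion
  intro S
  constructor
  intro l1 l2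
  let φ : k →+* S.R := (Spec.preimage S.i₂).hom
  let : Algebra k S.R := φ.toAlgebra
  have hφ : (SO k S.R).hom = S.i₂ := Spec.map_preimage S.i₂
  let : Algebra k S.K := ((algebraMap S.R S.K).comp φ).toAlgebra
  have : IsScalarTower k S.R S.K := IsScalarTower.of_algebraMap_eq' rfl
  let y1 : Pt Γ.G S.R := Over.homMk l1.l (l1.fac_right.trans hφ.symm)
  let y2 : Pt Γ.G S.R := Over.homMk l2.l (l2.fac_right.trans hφ.symm)
  let ι : S.R →ₐ[k] S.K := IsScalarTower.toAlgHom k S.R S.K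
  have hι : Function.Injective ι := IsFractionRing.injective S.R S.K
  have h12 : SOmap ι ≫ y1 = SOmap ι ≫ y2 := by
    ext1
    exact l1.fac_left.trans l2.fac_left.symm
  suffices h : y1 = y2 by
    have h3 : l1.l = l2.l := congr(($h).left)
    exact CommSq.LiftStruct.ext h3
  let z : Pt Γ.G S.R := Γ.mul (Γ.inv y1) y2
  have hz : SOmap ι ≫ z = Γ.one _ := by
    rw [Γ.mul_natural, Γ.inv_natural, h12, Γ.inv_mul]
  let e : Pt Γ.G k := Γ.one _
  obtain ⟨B, _, _, j, hj, hx⟩ := exists_chart Γ.G e.cl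
  have he : ∀ T : OverR k, Γ.one T = constO T e := by
    intro T
    rw [constO, Γ.one_natural]
  have hcl : z.cl = e.cl := by
    have hd := isDominant_SOmap ι hι
    have hc : IsClosed (z.left ⁻¹' {e.cl}) := (kpt_closed e).preimage z.left.continuous
    have hsub : Set.range (SOmap ι).left ⊆ z.left ⁻¹' {e.cl} := by
      rintro _ ⟨t, rfl⟩
      have h4 : (SOmap ι ≫ z).left t = e.cl := by rw [hz, he, constO_apply]
      exact h4
    have := hc.closure_subset_iff.mpr hsub
    rw [hd.denseRange.closure_range] at this
    exact this (Set.mem_univ (IsLocalRing.closedPoint S.R))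
  obtain ⟨w, hw⟩ := liftChart_local j z (hcl ▸ hx)
  obtain ⟨w', hw'⟩ := liftChart_local j (Γ.one (SO k S.R) : Pt Γ.G S.R) (by
    rw [he]
    refine Set.mem_of_eq_of_mem ?_ hx
    exact constO_apply _ _)
  have hmono := over_mono j
  have hsep : IsSeparated (SO k B).hom := inferInstanceAs (IsSeparated (Spec.map _))
  have hww : w = w' := by
    apply Pt.map_injective ι hι
    rw [Pt.map, Pt.map, ← cancel_mono j, Category.assoc, Category.assoc, hw, hw', hz, Γ.one_natural]
  have hz1 : Γ.mul (Γ.inv y1) y2 = Γ.one _ := by rw [← hw', ← hww, hw]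
  let := Γ.grp (SO k S.R)
  exact (eq_of_inv_mul_eq_one hz1)

end GroupScheme
end P10

section P11

lemma isIso_of_affine {X Y : Scheme.{0}} {f : X ⟶ Y} (hX : IsAffine X) (hY : IsAffine Y) (h : IsIso f.appTop) : IsIso f := by
  have h1 := Scheme.toSpecΓ_naturality f
  have : f = X.toSpecΓ ≫ Spec.map f.appTop ≫ inv Y.toSpecΓ := by
    rw [← Category.assoc, ← h1]; simp
  rw [this]; infer_instance

lemma norm_open_iso {Z : Scheme.{0}} [AlgebraicGeometry.IsIntegral Z]
    (hn : ∀ x : Z, ∃ U : Z.Opens, IsAffineOpen U ∧ x ∈ U ∧ IsIntegrallyClosed Γ(Z, U)) (V : Z.Opens) [hV : Nonempty V]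
    [QuasiCompact V.ι] [QuasiSeparated V.ι] : IsIso V.ι.fromNormalization := by
  choose U hU hxU hcl using hn
  rw [← MorphismProperty.isomorphisms.iff]
  refine IsZariskiLocalAtTarget.of_iSup_eq_top (P := MorphismProperty.isomorphisms Scheme.{0}) U
      (by ext x; simp only [TopologicalSpace.Opens.coe_iSup, Set.mem_iUnion, TopologicalSpace.Opens.coe_top, Set.mem_univ, iff_true]; exact ⟨x, hxU x⟩) ?_
  intro x
  refine isIso_of_affine ((hU x).preimage V.ι.fromNormalization) (hU x) ?_
  have : Nonempty (U x) := ⟨⟨x, hxU x⟩⟩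
  suffices h : IsIso (V.ι.fromNormalization.app (U x)) by
    rw [Scheme.Hom.appTop, morphismRestrict_app]
    have : IsIso (V.ι.fromNormalization.app ((U x).ι ''ᵁ ⊤)) := by
      have h3 : (U x).ι ''ᵁ ⊤ = U x := by simp
      rw [h3]; exact h
    refine IsIso.comp_isIso' this ?_
    refine @Functor.map_isIso _ _ _ _ _ _ _ _ ?_
    refine @isIso_op _ _ _ _ _ ?_
    exact (eqToIso (image_morphismRestrict_preimage V.ι.fromNormalization (U x) ⊤)).isIso_hom
  rw [Scheme.Hom.fromNormalization_app _ (hU x)]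
  suffices h : Function.Bijective (CommRingCat.ofHom (@algebraMap Γ(Z, U x) (@integralClosure Γ(Z, U x) Γ(V, V.ι ⁻¹ᵁ U x) _ _ (V.ι.app (U x)).hom.toAlgebra) _ _ _)).hom by
    have := (ConcreteCategory.isIso_iff_bijective (CommRingCat.ofHom (@algebraMap Γ(Z, U x) (@integralClosure Γ(Z, U x) Γ(V, V.ι ⁻¹ᵁ U x) _ _ (V.ι.app (U x)).hom.toAlgebra) _ _ _))).mpr h
    exact inferInstance
  let W : Z.Opens := V.ι ''ᵁ (V.ι ⁻¹ᵁ U x)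
  have hW : W ≤ U x := by
    rintro _ ⟨y, hy, rfl⟩
    exact hy
  have hWne : Nonempty W := by
    obtain ⟨v⟩ := hV
    obtain ⟨y, hy, hy'⟩ := nonempty_preirreducible_inter (U x).2 V.2 ⟨x, hxU x⟩ ⟨v.1, v.2⟩
    exact ⟨⟨y, ⟨y, hy'⟩, hy, rfl⟩⟩
  let K := Z.functionField
  let c : Γ(V, V.ι ⁻¹ᵁ U x) →+* K := (Z.germToFunctionField W).hom
  have hc : Function.Injective c := Z.germToFunctionField_injective W
  have hcomp : ∀ a, c ((V.ι.app (U x)).hom a) = algebraMap Γ(Z, U x) K a := by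
    intro a
    rw [Scheme.Opens.ι_app]
    exact congr(($(Z.presheaf.germ_res (homOfLE hW) (genericPoint Z) _)).hom a)
  have := functionField_isFractionRing_of_isAffineOpen Z (U x) (hU x)
  have hcl := hcl x
  let : Algebra Γ(Z, U x) Γ(V, V.ι ⁻¹ᵁ U x) := (V.ι.app (U x)).hom.toAlgebra
  constructor
  · intro a b hab
    apply IsFractionRing.injective Γ(Z, U x) K
    rw [← hcomp, ← hcomp]
    have : (V.ι.app (U x)).hom a = (V.ι.app (U x)).hom b := congrArg Subtype.val hab
    rw [this]
  · rintro ⟨b, hb⟩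
    have hb2 : IsIntegral Γ(Z, U x) (c b) := by
      let c' : Γ(V, V.ι ⁻¹ᵁ U x) →ₐ[Γ(Z, U x)] K := { c with commutes' := hcomp }
      exact IsIntegral.map c' hb
    obtain ⟨a, ha⟩ := IsIntegrallyClosed.isIntegral_iff.mp hb2
    refine ⟨a, Subtype.ext ?_⟩
    apply hc
    rw [← ha]
    exact hcomp a

end P11

section P12
open TensorProduct
variable {k : Type} [Field k]

lemma dvr_embed {R : Type} [CommRing R] [IsDomain R] [IsDiscreteValuationRing R] [Algebra k R] (χ : R →ₐ[k] k)
    (hχ : RingHom.ker χ = IsLocalRing.maximalIdeal R) :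
    ∃ ψ : R →ₐ[k] PowerSeries k, Function.Injective ψ ∧ ∀ a, PowerSeries.constantCoeff (ψ a) = χ a := by
  obtain ⟨p, hp⟩ := IsDiscreteValuationRing.exists_irreducible R
  have hp0 : p ≠ 0 := hp.ne_zero
  have hdiv : ∀ a : R, ∃ b, a = algebraMap k R (χ a) + p * b := by
    intro a
    have : a - algebraMap k R (χ a) ∈ IsLocalRing.maximalIdeal R := by
      rw [← hχ, RingHom.mem_ker]; simp
    rw [hp.maximalIdeal_eq, Ideal.mem_span_singleton] at this
    obtain ⟨b, hb⟩ := this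
    exact ⟨b, by rw [← hb]; ring⟩
  choose d hd using hdiv
  have hχp : χ p = 0 := by
    have : p ∈ RingHom.ker χ := by rw [hχ, hp.maximalIdeal_eq]; exact Ideal.mem_span_singleton_self p
    exact this
  have huniq : ∀ (a b : R) (r : k), a = algebraMap k R r + p * b → χ a = r ∧ d a = b := by
    intro a b r h
    have h1 : χ a = r := by rw [h]; simp [hχp]
    refine ⟨h1, ?_⟩
    have h2 := hd a
    rw [h1] at h2
    rw [h2] at h
    exact mul_left_cancel₀ hp0 (add_left_cancel h)
  have hadd : ∀ a b, d (a + b) = d a + d b := fun a b =>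
    (huniq (a + b) (d a + d b) (χ a + χ b) (by rw [map_add]; nth_rw 1 [hd a, hd b]; ring)).2
  have halg : ∀ r, d (algebraMap k R r) = 0 := fun r => (huniq _ 0 r (by simp)).2
  have hmul : ∀ a b, d (a * b) = algebraMap k R (χ a) * d b + d a * b := fun a b =>
    (huniq (a * b) _ (χ a * χ b) (by
      rw [map_mul]
      calc a * b = (algebraMap k R (χ a) + p * d a) * b := by rw [← hd a]
        _ = algebraMap k R (χ a) * b + p * (d a * b) := by ring
        _ = algebraMap k R (χ a) * (algebraMap k R (χ b) + p * d b) + p * (d a * b) := by rw [← hd b]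
        _ = _ := by ring)).2
  have hsm : ∀ r b, d (algebraMap k R r * b) = algebraMap k R r * d b := fun r b => by
    rw [hmul, halg]; simp
  let c : R → ℕ → k := fun a n => χ (d^[n] a)
  have c0 : ∀ a, c a 0 = χ a := fun a => rfl
  have cs : ∀ a n, c a (n+1) = c (d a) n := fun a n => by simp [c, Function.iterate_succ_apply]
  have cadd : ∀ n a b, c (a + b) n = c a n + c b n := by
    intro n
    induction n with
    | zero => intro a b; simp [c0]
    | succ n ih => intro a b; rw [cs, cs, cs, hadd, ih]
  have csm : ∀ n r b, c (algebraMap k R r * b) n = r * c b n := by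
    intro n
    induction n with
    | zero => intro a b; simp [c0]
    | succ n ih => intro a b; rw [cs, cs, hsm, ih]
  let C : R → PowerSeries k := fun a => PowerSeries.mk (c a)
  have hC : ∀ a, C a = PowerSeries.C (χ a) + PowerSeries.X * C (d a) := by
    intro a
    ext n
    cases n with
    | zero => simp [C, c0]
    | succ n => simp [C, cs, PowerSeries.coeff_succ_X_mul, PowerSeries.coeff_C]
  have cmul : ∀ n a b, PowerSeries.coeff n (C (a * b)) = PowerSeries.coeff n (C a * C b) := by
    intro n
    induction n with
    | zero => intro a b; simp [C, c0]
    | succ n ih =>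
      intro a b
      have e1 : PowerSeries.coeff (n+1) (C (a * b)) = c (d (a * b)) n := by simp [C, cs]
      rw [e1, hmul, cadd, csm, hC a, add_mul, map_add, mul_assoc, PowerSeries.coeff_succ_X_mul, ← ih, PowerSeries.coeff_C_mul]
      simp [C, cs]
  have hC0 : C 0 = 0 := by ext n; simpa [C] using csm n 0 0
  have hCA : ∀ r, C (algebraMap k R r) = PowerSeries.C r := fun r => by
    rw [hC, halg, hC0]; simp
  let ψ : R →ₐ[k] PowerSeries k :=
    { toFun := C
      map_one' := by rw [← map_one (algebraMap k R), hCA, map_one]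
      map_mul' := fun a b => by ext n; exact cmul n a b
      map_zero' := hC0
      map_add' := fun a b => by ext n; simp [C, cadd]
      commutes' := fun r => hCA r }
  have hcc : ∀ a, PowerSeries.constantCoeff (ψ a) = χ a := fun a => by
    change PowerSeries.constantCoeff (C a) = _
    simp [C, c0]
  refine ⟨ψ, ?_, hcc⟩
  rw [injective_iff_map_eq_zero]
  intro a ha
  by_contra h0
  obtain ⟨n, u, hu⟩ := IsDiscreteValuationRing.associated_pow_irreducible h0 hp
  have h1 : ψ p = PowerSeries.X * ψ 1 := by
    have := hC p
    rw [hχp, (huniq p 1 0 (by simp)).2] at this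
    rw [map_zero, zero_add] at this
    exact this
  have h2 : ψ a * ψ u = PowerSeries.X ^ n := by
    rw [← map_mul, hu, map_pow, h1, map_one, mul_one]
  rw [ha, zero_mul] at h2
  exact pow_ne_zero n PowerSeries.X_ne_zero h2.symm
lemma quasi_section (B C : Type) [CommRing B] [CommRing C] [IsDomain B] [Algebra B C] [Algebra.FiniteType B C] (hi : Function.Injective (algebraMap B C)) :
    ∃ (κ : Type) (_ : Field κ) (_ : Algebra B κ) (_ : Algebra (FractionRing B) κ) (_ : IsScalarTower B (FractionRing B) κ),
      Module.Finite (FractionRing B) κ ∧ Nonempty (C →ₐ[B] κ) := by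
  let K := FractionRing B
  let T := K ⊗[B] C
  have : Nontrivial T := by
    have h1 : Function.Injective (Algebra.TensorProduct.map (AlgHom.id K K) (Algebra.ofId B C)) :=
      Module.Flat.lTensor_preserves_injective_linearMap (M := K) (Algebra.linearMap B C) hi
    have : Nontrivial (K ⊗[B] B) := (TensorProduct.rid B K).toEquiv.nontrivial
    exact h1.nontrivial
  obtain ⟨n, hn⟩ := Ideal.exists_maximal T
  let κ := T ⧸ n
  let : Field κ := Ideal.Quotient.field n
  have : Algebra.FiniteType K κ := Algebra.FiniteType.of_surjective (Ideal.Quotient.mkₐ K n) Ideal.Quotient.mk_surjective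
  refine ⟨κ, inferInstance, inferInstance, inferInstance, inferInstance, finite_of_finite_type_of_isJacobsonRing K κ, ⟨((Ideal.Quotient.mkₐ K n).restrictScalars B).comp Algebra.TensorProduct.includeRight⟩⟩

lemma multisection (B C : Type) [CommRing B] [CommRing C] [IsDomain B] [Algebra B C] [Algebra.FiniteType B C] (hi : Function.Injective (algebraMap B C)) :
    ∃ (b : B) (_ : b ≠ 0) (D : Type) (_ : CommRing D) (_ : IsDomain D) (_ : Algebra B D) (_ : Algebra (Localization.Away b) D) (_ : IsScalarTower B (Localization.Away b) D),
      Function.Injective (algebraMap (Localization.Away b) D) ∧ Algebra.IsIntegral (Localization.Away b) D ∧ Nonempty (C →ₐ[B] D) := by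
  obtain ⟨κ, _, _, _, _, hfin, ⟨γ⟩⟩ := quasi_section B C hi
  have hBκ : Function.Injective (algebraMap B κ) := by
    rw [IsScalarTower.algebraMap_eq B (FractionRing B) κ]
    exact (algebraMap (FractionRing B) κ).injective.comp (IsFractionRing.injective _ _)
  have halg : Algebra.IsAlgebraic B κ := by
    have : Algebra.IsAlgebraic (FractionRing B) κ := inferInstance
    exact (IsFractionRing.comap_isAlgebraic_iff (A := B) (K := FractionRing B) (C := κ)).mpr this
  obtain ⟨s, hs⟩ := (‹Algebra.FiniteType B C›).out
  have hm : ∀ c : C, ∃ b : B, b ≠ 0 ∧ IsIntegral B (algebraMap B κ b * γ c) := by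
    intro c
    obtain ⟨z, hz, h⟩ := (halg.isAlgebraic (γ c)).exists_integral_multiple
    exact ⟨z, hz, by rwa [← Algebra.smul_def]⟩
  choose β hβ0 hβ using hm
  let b := ∏ c ∈ s, β c
  have hb : b ≠ 0 := Finset.prod_ne_zero_iff.mpr fun c _ => hβ0 c
  let Bb := Localization.Away b
  let i : Bb →+* κ := IsLocalization.Away.lift (S := Bb) b (g := algebraMap B κ) (isUnit_iff_ne_zero.mpr fun h => hb (hBκ (by rw [h, map_zero])))
  let : Algebra Bb κ := i.toAlgebra
  have : IsScalarTower B Bb κ := IsScalarTower.of_algebraMap_eq' (IsLocalization.Away.lift_comp (S := Bb) b _).symm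
  have hinj : Function.Injective (algebraMap Bb κ) := by
    rw [injective_iff_map_eq_zero]
    intro x hx
    obtain ⟨⟨a, t⟩, h⟩ := IsLocalization.surj (Submonoid.powers b) x
    have h1 := congrArg (algebraMap Bb κ) h
    rw [map_mul, hx, zero_mul, ← IsScalarTower.algebraMap_apply] at h1
    have h2 : a = 0 := hBκ (by rw [← h1, map_zero])
    simp only [h2, map_zero] at h
    exact (IsLocalization.map_units Bb t).mul_left_eq_zero.mp h
  have hγ : ∀ c, IsIntegral Bb (γ c) := by
    let E : Subalgebra B C := ((integralClosure Bb κ).restrictScalars B).comap γ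
    suffices h : E = ⊤ by
      intro c
      have : c ∈ E := by rw [h]; trivial
      exact this
    rw [eq_top_iff, ← hs]
    refine Algebra.adjoin_le fun c hc => ?_
    change IsIntegral Bb (γ c)
    have hu : IsUnit (algebraMap B Bb (β c)) := by
      refine isUnit_of_dvd_unit (map_dvd _ (Finset.dvd_prod_of_mem β hc)) (IsLocalization.Away.algebraMap_isUnit b)
    obtain ⟨u, hu⟩ := hu
    have h1 : IsIntegral Bb (algebraMap B κ (β c) * γ c) := (hβ c).tower_top
    have h2 : γ c = algebraMap Bb κ (↑u⁻¹) * (algebraMap B κ (β c) * γ c) := by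
      rw [IsScalarTower.algebraMap_apply B Bb κ, ← hu, ← mul_assoc, ← map_mul]; simp
    rw [h2]
    exact isIntegral_algebraMap.mul h1
  refine ⟨b, hb, integralClosure Bb κ, inferInstance, inferInstance, inferInstance, inferInstance, inferInstance, ?_, inferInstance, ⟨?_⟩⟩
  · intro x y h
    exact hinj (congrArg Subtype.val h)
  · exact γ.codRestrict ((integralClosure Bb κ).restrictScalars B) hγ

end P12

section P13
variable {k : Type} [Field k]

lemma arc_ded [IsAlgClosed k] (S κ : Type) [CommRing S] [IsDedekindDomain S] [Algebra k S] [Algebra.FiniteType k S]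
    [Field κ] [Algebra S κ] [IsFractionRing S κ] [Algebra k κ] [IsScalarTower k S κ] (Q : Ideal S) [Q.IsMaximal] (hQ0 : Q ≠ ⊥) :
    ∃ (c : κ →ₐ[k] LaurentSeries k) (θ : S →ₐ[k] PowerSeries k), (∀ y, c (algebraMap S κ y) = psL k k (θ y)) ∧
      ∀ y ∈ Q, PowerSeries.constantCoeff (θ y) = 0 := by
  obtain ⟨χ, hχ⟩ := residue_char (k := k) (B := S) Q
  let R := Localization.AtPrime Q
  have : IsDiscreteValuationRing R := IsLocalization.AtPrime.isDiscreteValuationRing_of_dedekind_domain S hQ0 R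
  let χR : R →ₐ[k] k := IsLocalization.liftAlgHom (M := Q.primeCompl) (S := R) (f := χ) (fun y => isUnit_iff_ne_zero.mpr fun h => y.2 (by exact (hχ ▸ h : (y : S) ∈ Q)))
  have hχR : ∀ y, χR (algebraMap S R y) = χ y := fun y => IsLocalization.lift_eq _ _
  have hkR : RingHom.ker χR = IsLocalRing.maximalIdeal R := by
    refine IsLocalRing.eq_maximalIdeal (RingHom.ker_isMaximal_of_surjective χR fun y => ⟨algebraMap k R y, by simp⟩)
  obtain ⟨ψ, hψ, hψc⟩ := dvr_embed χR hkR
  let θ : S →ₐ[k] PowerSeries k := ψ.comp (IsScalarTower.toAlgHom k S R)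
  have hθ : Function.Injective θ := hψ.comp (IsLocalization.injective R (Ideal.primeCompl_le_nonZeroDivisors Q))
  let c : κ →ₐ[k] LaurentSeries k := IsFractionRing.liftAlgHom (A := S) (K := κ) (g := (psL k k).comp θ) ((psL_injective (k := k) (A := k)).comp hθ)
  have hc : ∀ y : S, c (algebraMap S κ y) = psL k k (θ y) := fun y => IsFractionRing.lift_algebraMap (A := S) (K := κ) (g := ((psL k k).comp θ).toRingHom) ((psL_injective (k := k) (A := k)).comp hθ) y
  refine ⟨c, θ, hc, fun y hy => ?_⟩
  change PowerSeries.constantCoeff (ψ (algebraMap S R y)) = 0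
  rw [hψc, hχR]
  rw [← hχ] at hy
  exact hy

lemma arc_curve [IsAlgClosed k] [CharZero k] (κ K0 : Type) [Field κ] [Field K0] [Algebra k κ] [Algebra (Polynomial k) κ] [IsScalarTower k (Polynomial k) κ]
    [Algebra (Polynomial k) K0] [IsFractionRing (Polynomial k) K0] [Algebra K0 κ] [IsScalarTower (Polynomial k) K0 κ]
    [Module.Finite K0 κ] {B : Type} [CommRing B] [Algebra k B] (β : B →ₐ[k] κ) (hβ : ∀ b, IsIntegral (Polynomial k) (β b))
    (x : B) (hx : β x = algebraMap (Polynomial k) κ Polynomial.X) (m : Ideal B) [m.IsMaximal] (hm : RingHom.ker β ≤ m) :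
    ∃ (c : κ →ₐ[k] LaurentSeries k) (e : B →ₐ[k] PowerSeries k), (∀ b, psL k k (e b) = c (β b)) ∧
      ∀ b ∈ m, PowerSeries.constantCoeff (e b) = 0 := by
  let S := integralClosure (Polynomial k) κ
  have : CharZero K0 := by
    exact charZero_of_injective_algebraMap (R := Polynomial k) (IsFractionRing.injective _ K0)
  have hded : IsDedekindDomain S := integralClosure.isDedekindDomain (Polynomial k) K0 κ
  have hfinS : Module.Finite (Polynomial k) S := IsIntegralClosure.finite (Polynomial k) K0 κ S
  have hfr : IsFractionRing S κ := integralClosure.isFractionRing_of_finite_extension K0 κ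
  have hft : Algebra.FiniteType k S := Algebra.FiniteType.trans (inferInstance : Algebra.FiniteType k (Polynomial k)) (inferInstance : Algebra.FiniteType (Polynomial k) S)
  have hinjS : Function.Injective (algebraMap (Polynomial k) S) := by
    intro a b h
    have h1 : algebraMap (Polynomial k) κ a = algebraMap (Polynomial k) κ b := congrArg Subtype.val h
    rw [IsScalarTower.algebraMap_apply (Polynomial k) K0 κ, IsScalarTower.algebraMap_apply (Polynomial k) K0 κ b] at h1
    exact IsFractionRing.injective _ K0 ((algebraMap K0 κ).injective h1)
  let β' : B →ₐ[k] S := β.codRestrict (S.restrictScalars k) hβ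
  have hintg : β'.toRingHom.IsIntegral := by
    have h1 : (β'.comp (Polynomial.aeval x)) = IsScalarTower.toAlgHom k (Polynomial k) S := by
      apply Polynomial.algHom_ext
      apply Subtype.ext
      simp
      exact hx
    have h2 : (IsScalarTower.toAlgHom k (Polynomial k) S).toRingHom.IsIntegral := by
      have : Algebra.IsIntegral (Polynomial k) S := inferInstance
      exact this.isIntegral
    rw [← h1] at h2
    exact RingHom.IsIntegral.tower_top (Polynomial.aeval x : _ →ₐ[k] B).toRingHom β'.toRingHom h2
  have hker : RingHom.ker β'.toRingHom ≤ m := by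
    intro b hb
    exact hm (congrArg Subtype.val hb)
  obtain ⟨Q, -, hQ, hQm⟩ : ∃ Q : Ideal S, ⊥ ≤ Q ∧ Q.IsPrime ∧ Q.comap β'.toRingHom = m := by
    let : Algebra B S := β'.toRingHom.toAlgebra
    have : Algebra.IsIntegral B S := ⟨hintg⟩
    exact Ideal.exists_ideal_over_prime_of_isIntegral (R := B) (S := S) m ⊥ hker
  have hQmax : Q.IsMaximal := by
    let : Algebra B S := β'.toRingHom.toAlgebra
    have : Algebra.IsIntegral B S := ⟨hintg⟩
    have h1 : (Q.comap (algebraMap B S)).IsMaximal := by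
      change (Q.comap β'.toRingHom).IsMaximal
      rw [hQm]; infer_instance
    exact Ideal.isMaximal_of_isIntegral_of_isMaximal_comap Q h1
  have hQ0 : Q ≠ ⊥ := by
    intro h
    rw [h] at hQmax
    have h1 : IsField S := by
      by_contra h2
      exact Ring.ne_bot_of_isMaximal_of_not_isField hQmax h2 rfl
    exact Polynomial.not_isField k (isField_of_isIntegral_of_isField (S := S) hinjS h1)
  obtain ⟨c, θ, hc, hθ⟩ := arc_ded (k := k) S κ Q hQ0
  refine ⟨c, θ.comp β', fun b => (hc (β' b)).symm, fun b hb => hθ _ ?_⟩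
  rw [← hQm] at hb; exact hb

lemma prime_over (B C : Type) [CommRing B] [CommRing C] [IsDomain B] [Algebra B C] [Algebra.FiniteType B C] (hi : Function.Injective (algebraMap B C)) :
    ∃ b : B, b ≠ 0 ∧ ∀ p : Ideal B, p.IsPrime → b ∉ p → ∃ P : Ideal C, P.IsPrime ∧ P.comap (algebraMap B C) = p := by
  obtain ⟨b, hb, D, _, _, _, _, _, hinj, hintg, ⟨γ⟩⟩ := multisection B C hi
  refine ⟨b, hb, fun p hp hbp => ?_⟩
  have hdisj : Disjoint (Submonoid.powers b : Set B) (p : Set B) := (Ideal.disjoint_powers_iff_notMem b hp.isRadical).mpr hbp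
  let p' := p.map (algebraMap B (Localization.Away b))
  have hp' : p'.IsPrime := IsLocalization.isPrime_of_isPrime_disjoint (Submonoid.powers b) _ p hp hdisj
  have hp'' : p'.comap (algebraMap B (Localization.Away b)) = p := IsLocalization.under_map_of_isPrime_disjoint (Submonoid.powers b) _ hp hdisj
  obtain ⟨Q, -, hQ, hQp⟩ := Ideal.exists_ideal_over_prime_of_isIntegral (R := Localization.Away b) (S := D) p' ⊥ (by
    rw [← RingHom.ker_eq_comap_bot, (RingHom.injective_iff_ker_eq_bot _).mp hinj]; exact bot_le)
  refine ⟨Q.comap γ, Ideal.IsPrime.comap _, ?_⟩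
  refine Ideal.ext fun x => ?_
  change γ (algebraMap B C x) ∈ Q ↔ x ∈ p
  rw [γ.commutes, ← hp'', Ideal.mem_comap, ← hQp, Ideal.mem_comap, ← IsScalarTower.algebraMap_apply]

lemma arc_alg [IsAlgClosed k] [CharZero k] (B C : Type) [CommRing B] [CommRing C] [IsDomain B] [Algebra k B] [Algebra k C]
    [Algebra.FiniteType k B] [Algebra.FiniteType k C] (ι : B →ₐ[k] C) (hi : Function.Injective ι) (m : Ideal B) [m.IsMaximal] :
    ∃ (c : C →ₐ[k] LaurentSeries k) (e : B →ₐ[k] PowerSeries k), (∀ b, psL k k (e b) = c (ι b)) ∧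
      ∀ b ∈ m, PowerSeries.constantCoeff (e b) = 0 := by
  let : Algebra B C := ι.toRingHom.toAlgebra
  have : IsScalarTower k B C := IsScalarTower.of_algebraMap_eq' ι.comp_algebraMap.symm
  have : Algebra.FiniteType B C := Algebra.FiniteType.of_restrictScalars_finiteType k B C
  obtain ⟨b, hb, hbP⟩ := prime_over B C hi
  obtain ⟨χ, hχ⟩ := residue_char (k := k) (B := B) m
  obtain ⟨s, g, hg, hgi⟩ := exists_integral_inj_algHom_of_fg k B
  cases s with
  | zero =>
    have hf : IsField B := by
      have h1 : (algebraMap k (MvPolynomial (Fin 0) k)).IsIntegral :=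
        RingHom.isIntegral_of_surjective _ (MvPolynomial.C_surjective (Fin 0))
      have h2 : (algebraMap k B).IsIntegral := by
        have := RingHom.IsIntegral.trans _ _ h1 hgi
        rwa [show g.toRingHom.comp (algebraMap k (MvPolynomial (Fin 0) k)) = algebraMap k B from g.comp_algebraMap] at this
      have : Algebra.IsIntegral k B := ⟨h2⟩
      exact isField_of_isIntegral_of_isField' (R := k) (Field.toIsField k)
    have : Nontrivial C := hi.nontrivial
    obtain ⟨M, hM⟩ := Ideal.exists_maximal C
    obtain ⟨χC, -⟩ := residue_char (k := k) (B := C) M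
    refine ⟨(Algebra.ofId k _).comp χC, ((Algebra.ofId k _).comp χC).comp ι, fun b => ?_, fun b hb => ?_⟩
    · exact (psL k k).commutes _
    · have : b = 0 := by
        by_contra h0
        obtain ⟨c, hc⟩ := hf.mul_inv_cancel h0
        exact Ideal.IsPrime.ne_top (inferInstance : m.IsPrime) ((Ideal.eq_top_iff_one _).mpr (hc ▸ m.mul_mem_right c hb))
      simp [this]
  | succ s =>
    let A := MvPolynomial (Fin (s+1)) k
    let : Algebra A B := g.toRingHom.toAlgebra
    have : IsScalarTower k A B := IsScalarTower.of_algebraMap_eq' g.comp_algebraMap.symm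
    have hAB : Algebra.IsIntegral A B := ⟨hgi⟩
    have : FaithfulSMul A B := (faithfulSMul_iff_algebraMap_injective A B).mpr hg
    obtain ⟨h, hh, hh0⟩ := Submodule.exists_mem_ne_zero_of_ne_bot (Ideal.comap_ne_bot_of_integral_mem (R := A) (I := Ideal.span {b}) hb (Ideal.mem_span_singleton_self b) (hAB.isIntegral b))
    let a : Fin (s+1) → k := fun i => χ (g (MvPolynomial.X i))
    obtain ⟨z, hz⟩ : ∃ z : Fin (s+1) → k, MvPolynomial.eval z (h * (MvPolynomial.X 0 - MvPolynomial.C (a 0))) ≠ 0 := by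
      by_contra! hcon
      have : h * (MvPolynomial.X 0 - MvPolynomial.C (a 0)) = 0 := MvPolynomial.funext fun z => by rw [hcon z, map_zero]
      rcases mul_eq_zero.mp this with h1 | h1
      · exact hh0 h1
      · have := congrArg (MvPolynomial.eval (fun _ => a 0 + 1)) h1
        simp at this
    rw [map_mul] at hz
    have hz1 := left_ne_zero_of_mul hz
    have hz2 := right_ne_zero_of_mul hz
    let v : Fin (s+1) → k := fun i => z i - a i
    have hv : v 0 ≠ 0 := by simpa using hz2
    let lam : A →ₐ[k] Polynomial k := MvPolynomial.aeval fun i => Polynomial.C (a i) + Polynomial.C (v i) * Polynomial.X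
    have hlX : ∀ i, lam (MvPolynomial.X i) = Polynomial.C (a i) + Polynomial.C (v i) * Polynomial.X := fun i => MvPolynomial.aeval_X _ i
    let y : A := MvPolynomial.C (v 0)⁻¹ * (MvPolynomial.X 0 - MvPolynomial.C (a 0))
    have hly : lam y = Polynomial.X := by
      have h1 : ∀ r, lam (MvPolynomial.C r) = Polynomial.C r := fun r => lam.commutes r
      rw [map_mul, map_sub, h1, h1, hlX, add_sub_cancel_left, ← mul_assoc, ← Polynomial.C_mul, inv_mul_cancel₀ hv]; simp
    have hlsurj : Function.Surjective lam := fun f => ⟨Polynomial.aeval y f, by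
      rw [← Polynomial.aeval_algHom_apply, hly]; simp⟩
    let q : Ideal A := RingHom.ker lam
    have hq : q.IsPrime := RingHom.ker_isPrime lam
    have hhq : h ∉ q := by
      intro hmem
      apply hz1
      have h1 : ((Polynomial.aeval (1:k)).comp lam) = MvPolynomial.aeval z := by
        apply MvPolynomial.algHom_ext; intro i
        simp [hlX, v]
      have h2 := DFunLike.congr_fun h1 h
      rw [AlgHom.comp_apply, (hmem : lam h = 0), map_zero, MvPolynomial.aeval_eq_eval] at h2
      exact h2.symm
    have hqm : q ≤ m.under A := by
      intro f hf
      change g f ∈ m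
      rw [← hχ]
      have h1 : χ.comp g = (Polynomial.aeval (0:k)).comp lam := by
        apply MvPolynomial.algHom_ext; intro i
        simp [hlX, a]
      have h2 := DFunLike.congr_fun h1 f
      rw [AlgHom.comp_apply, AlgHom.comp_apply, (hf : lam f = 0), map_zero] at h2
      exact h2
    obtain ⟨p, hpm, hp, hpq⟩ := Ideal.exists_ideal_le_liesOver_of_le (R := A) (S := B) (p := q) (q := m.under A) m hqm
    have hbp : b ∉ p := by
      intro hbp
      apply hhq
      rw [hpq.over]
      exact (Ideal.span_singleton_le_iff_mem p).mpr hbp hh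
    obtain ⟨P, hP, hPp⟩ := hbP p hp hbp
    let β0 : B →ₐ[k] C ⧸ P := (Ideal.Quotient.mkₐ k P).comp ι
    have hβ0 : ∀ x, β0 x = 0 ↔ x ∈ p := fun x => by
      rw [← hPp]; exact Ideal.Quotient.eq_zero_iff_mem
    let j : Polynomial k →ₐ[k] C ⧸ P := Polynomial.aeval (β0 (g y))
    have hgp : ∀ f, g f ∈ p ↔ lam f = 0 := fun f => by
      change f ∈ p.under A ↔ f ∈ q
      rw [← hpq.over]
    have hj : ∀ f : A, j (lam f) = β0 (g f) := by
      intro f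
      have h1 : lam (Polynomial.aeval y (lam f)) = lam f := by
        rw [← Polynomial.aeval_algHom_apply, hly]; simp
      have h2 : β0 (g (Polynomial.aeval y (lam f) - f)) = 0 := by
        rw [hβ0, hgp, map_sub, h1, sub_self]
      rw [map_sub, map_sub, sub_eq_zero, ← Polynomial.aeval_algHom_apply, ← Polynomial.aeval_algHom_apply] at h2
      exact h2
    have hjinj : Function.Injective j := by
      rw [injective_iff_map_eq_zero]
      intro f hf
      obtain ⟨f, rfl⟩ := hlsurj f
      rw [hj, hβ0, hgp] at hf
      exact hf
    let : Algebra (Polynomial k) (C ⧸ P) := j.toRingHom.toAlgebra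
    have : IsScalarTower k (Polynomial k) (C ⧸ P) := IsScalarTower.of_algebraMap_eq' j.comp_algebraMap.symm
    have : Algebra.FiniteType (Polynomial k) (C ⧸ P) := Algebra.FiniteType.of_restrictScalars_finiteType k (Polynomial k) (C ⧸ P)
    obtain ⟨κ, _, _, _, _, hfin, ⟨γ⟩⟩ := quasi_section (Polynomial k) (C ⧸ P) hjinj
    have hκinj : Function.Injective (algebraMap (Polynomial k) κ) := by
      rw [IsScalarTower.algebraMap_eq (Polynomial k) (FractionRing (Polynomial k)) κ]
      exact (algebraMap (FractionRing (Polynomial k)) κ).injective.comp (IsFractionRing.injective _ _)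
    let : Algebra k κ := ((algebraMap (Polynomial k) κ).comp (algebraMap k (Polynomial k))).toAlgebra
    have : IsScalarTower k (Polynomial k) κ := IsScalarTower.of_algebraMap_eq' rfl
    let β : B →ₐ[k] κ := (γ.restrictScalars k).comp β0
    have hβg : ∀ f : A, β (g f) = algebraMap (Polynomial k) κ (lam f) := fun f => by
      rw [← γ.commutes]
      exact congrArg γ (hj f).symm
    have hβi : ∀ x, IsIntegral (Polynomial k) (β x) := by
      intro x
      obtain ⟨F, hF, hF0⟩ := hgi x
      refine ⟨F.map lam.toRingHom, hF.map _, ?_⟩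
      rw [Polynomial.eval₂_map]
      have h1 := congrArg β hF0
      rw [map_zero] at h1
      rw [← h1]
      have h2 := Polynomial.hom_eval₂ F g.toRingHom β.toRingHom x
      refine Eq.trans ?_ h2.symm
      congr 1
      exact RingHom.ext fun f => (hβg f).symm
      
    have hker : RingHom.ker β ≤ p := by
      intro x hx
      by_contra hxp
      have hle : p ≤ RingHom.ker β := fun x hx => by
        change γ (β0 x) = 0
        rw [(hβ0 x).mpr hx, map_zero]
      have := Ideal.comap_lt_comap_of_integral_mem_sdiff (R := A) hle ⟨hx, hxp⟩ (hAB.isIntegral x)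
      refine absurd this.2 (not_not.mpr ?_)
      intro f hf
      change g f ∈ p
      rw [hgp]
      have h2 : β (g f) = 0 := hf
      rw [hβg] at h2
      exact hκinj (by rw [h2, map_zero])
    obtain ⟨c, e, hce, he⟩ := arc_curve (k := k) κ (FractionRing (Polynomial k)) β hβi (g y) (by rw [hβg, hly]) m (hker.trans hpm)
    exact ⟨(c.comp (γ.restrictScalars k)).comp (Ideal.Quotient.mkₐ k P), e, hce, he⟩
end P13

section P14
variable {k : Type} [Field k]

/-- open subscheme as an over-object -/
def opO (X : OverR k) (U : X.left.Opens) : OverR k := Over.mk (U.ι ≫ X.hom)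

def opι (X : OverR k) (U : X.left.Opens) : opO X U ⟶ X := Over.homMk U.ι rfl

instance (X : OverR k) (U : X.left.Opens) : IsOpenImmersion (opι X U).left :=
  inferInstanceAs (IsOpenImmersion U.ι)

lemma opι_range (X : OverR k) (U : X.left.Opens) : Set.range (opι X U).left = U := U.range_ι

lemma exists_chart_map {M Y : OverR k} (φ : M ⟶ Y) {B : Type} [CommRing B] [Algebra k B] (j : SO k B ⟶ Y) [IsOpenImmersion j.left]
    (x : M.left) (hx : φ.left x ∈ Set.range j.left) :
    ∃ (C : Type) (_ : CommRing C) (_ : Algebra k C) (jM : SO k C ⟶ M) (ι : B →ₐ[k] C), IsOpenImmersion jM.left ∧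
      x ∈ Set.range jM.left ∧ jM ≫ φ = SOmap ι ≫ j := by
  let U : M.left.Opens := φ.left ⁻¹ᵁ j.left.opensRange
  have hxU : x ∈ U := hx
  obtain ⟨C, _, _, j', hj', ⟨z, hz⟩⟩ := exists_chart (opO M U) (⟨x, hxU⟩ : U)
  have hr : ∀ z, (opι M U).left z ∈ U := fun z => by
    have : (opι M U).left z ∈ Set.range (opι M U).left := ⟨z, rfl⟩
    rw [opι_range] at this
    exact this
  obtain ⟨l, hl⟩ := liftChart j ((j' ≫ opι M U) ≫ φ) (by
    rintro _ ⟨z, rfl⟩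
    exact hr (j'.left z))
  refine ⟨C, _, _, j' ≫ opι M U, SOpre l, inferInstanceAs (IsOpenImmersion (j'.left ≫ (opι M U).left)), ⟨z, ?_⟩, ?_⟩
  · exact (congrArg (opι M U).left hz : _)
  · rw [SOmap_SOpre, hl]

lemma chart_domain {M : OverR k} [AlgebraicGeometry.IsIntegral M.left] {C : Type} [CommRing C] [Algebra k C] (j : SO k C ⟶ M) [IsOpenImmersion j.left]
    [Nontrivial C] : IsDomain C := by
  have h1 : Nonempty (SO k C).left := inferInstanceAs (Nonempty (PrimeSpectrum C))
  have h2 : AlgebraicGeometry.IsIntegral (SO k C).left := isIntegral_of_isOpenImmersion j.left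
  exact (affine_isIntegral_iff (CommRingCat.of C)).mp h2

lemma chart_nontrivial {M : OverR k} {C : Type} [CommRing C] [Algebra k C] (j : SO k C ⟶ M) {x : M.left} (h : x ∈ Set.range j.left) : Nontrivial C := by
  obtain ⟨z, -⟩ := h
  exact PrimeSpectrum.nontrivial (z : PrimeSpectrum C)

lemma arc [IsAlgClosed k] [CharZero k] {M Y : OverR k} [AlgebraicGeometry.IsIntegral M.left] [LocallyOfFiniteType M.hom] [LocallyOfFiniteType Y.hom]
    (φ : M ⟶ Y) (w : Pt Y k) (hw : w.cl ∈ closure (Set.range φ.left)) :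
    ∃ (c : Pt M (LaurentSeries k)) (e : Pt Y (PowerSeries k)), e.map (psL k k) = c ≫ φ ∧ e.cl = w.cl := by
  obtain ⟨B, _, _, j, hj, hwj⟩ := exists_chart Y w.cl
  have := chart_finiteType j
  obtain ⟨χ, hχ⟩ := kpt_chart j w hwj
  obtain ⟨_, hx, ⟨x, rfl⟩⟩ := mem_closure_iff.mp hw _ j.left.isOpenEmbedding.isOpen_range hwj
  obtain ⟨C, _, _, jM, ι, hjM, hxM, hcomm⟩ := exists_chart_map φ j x hx
  have := chart_finiteType jM
  have := chart_nontrivial jM hxM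
  have := chart_domain jM
  have hker : RingHom.ker ι ≤ RingHom.ker χ := by
    intro f hf
    by_contra hf2
    let O : Set Y.left := j.left '' (PrimeSpectrum.basicOpen f : Set (PrimeSpectrum B))
    have hO : IsOpen O := j.left.isOpenEmbedding.isOpenMap _ (PrimeSpectrum.basicOpen f).2
    have hwO : w.cl ∈ O := by
      rw [← hχ, cl_comp]
      refine ⟨_, ?_, rfl⟩
      change f ∉ Ideal.comap χ.toRingHom (IsLocalRing.maximalIdeal k)
      rw [Ideal.mem_comap, IsLocalRing.mem_maximalIdeal, mem_nonunits_iff, not_not, isUnit_iff_ne_zero]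
      exact hf2
    obtain ⟨_, hx', ⟨x', rfl⟩⟩ := mem_closure_iff.mp hw O hO hwO
    obtain ⟨x'', hx1, ⟨z, rfl⟩⟩ := nonempty_preirreducible_inter (hO.preimage φ.left.continuous) jM.left.isOpenEmbedding.isOpen_range ⟨x', hx'⟩ ⟨x, hxM⟩
    obtain ⟨u, hu, huz⟩ := hx1
    have h1 : φ.left (jM.left z) = j.left ((SOmap ι).left z) := congr(($hcomm).left z)
    have h2 : u = (SOmap ι).left z := j.left.isOpenEmbedding.injective (huz.trans h1)
    rw [h2] at hu
    apply hu
    change ι f ∈ (z : PrimeSpectrum C).asIdeal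
    rw [(hf : ι f = 0)]
    exact zero_mem _
  let B1 := B ⧸ RingHom.ker ι
  have : (RingHom.ker ι).IsPrime := RingHom.ker_isPrime ι
  have : IsDomain B1 := Ideal.Quotient.isDomain _
  let ι1 : B1 →ₐ[k] C := Ideal.kerLiftAlg ι
  let χ1 : B1 →ₐ[k] k := Ideal.Quotient.liftₐ _ χ (fun a ha => hker ha)
  have hm : (RingHom.ker χ1).IsMaximal := RingHom.ker_isMaximal_of_surjective χ1 fun r => ⟨algebraMap k B1 r, by simp⟩
  obtain ⟨c, e, hce, he⟩ := arc_alg B1 C ι1 (Ideal.kerLiftAlg_injective ι) (RingHom.ker χ1)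
  refine ⟨SOmap c ≫ jM, SOmap (e.comp (Ideal.Quotient.mkₐ k _)) ≫ j, ?_, ?_⟩
  · rw [Category.assoc, hcomm, Pt.map, ← Category.assoc, ← Category.assoc, ← SOmap_comp, ← SOmap_comp]
    congr 2
    ext b : 1
    exact hce (Ideal.Quotient.mk _ b)
  · rw [← hχ]
    refine centre_of j χ _ fun b hb => ?_
    have := he (Ideal.Quotient.mk _ b) hb
    rw [IsLocalRing.mem_maximalIdeal, mem_nonunits_iff, PowerSeries.isUnit_iff_constantCoeff]
    intro hu
    exact hu.ne_zero this

end P14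

section P15
variable {k : Type} [Field k]

lemma jac_pt [IsAlgClosed k] {W : OverR k} [LocallyOfFiniteType W.hom] (S : Set W.left) (hS : IsLocallyClosed S) (h : S.Nonempty) :
    ∃ p : Pt W k, p.cl ∈ S := by
  have : JacobsonSpace W.left := LocallyOfFiniteType.jacobsonSpace W.hom
  obtain ⟨x, hx, hc⟩ := nonempty_inter_closedPoints h hS
  obtain ⟨p, rfl⟩ := exists_kpt (X := W) x hc
  exact ⟨p, hx⟩

lemma qf_of_kpts [IsAlgClosed k] {W B : OverR k} [LocallyOfFiniteType W.hom] [LocallyOfFiniteType B.hom] (π : W ⟶ B)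
    [LocallyOfFiniteType π.left]
    (h : ∀ w w' : Pt W k, w ≫ π = w' ≫ π → w = w') : LocallyQuasiFinite π.left := by
  rw [← Scheme.Hom.quasiFiniteLocus_eq_top_iff]
  by_contra hne
  obtain ⟨p, hp⟩ := jac_pt (W := W) ((π.left.quasiFiniteLocus : Set W.left)ᶜ) π.left.quasiFiniteLocus.isOpen.isClosed_compl.isLocallyClosed (by
    rw [Set.nonempty_compl]
    intro h
    exact hne (TopologicalSpace.Opens.ext h))
  apply hp
  change π.left.QuasiFiniteAt p.cl
  rw [Scheme.Hom.quasiFiniteAt_iff_isOpen_singleton_asFiber]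
  have hF : ∀ z : W.left, π.left z = π.left p.cl → z = p.cl := by
    intro z hz
    by_contra hzp
    have hc : IsClosed {π.left p.cl} := by
      have := kpt_closed (X := B) (p ≫ π)
      rwa [cl_comp] at this
    obtain ⟨q, hq, hq'⟩ := jac_pt (W := W) (π.left ⁻¹' {π.left p.cl} ∩ {p.cl}ᶜ)
      ((hc.preimage π.left.continuous).isLocallyClosed.inter (kpt_closed p).isOpen_compl.isLocallyClosed) ⟨z, hz, hzp⟩
    apply hq'
    rw [h q p (kpt_ext (by rw [cl_comp, cl_comp]; exact hq))]
    rfl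
  have hs : Subsingleton (π.left.fiber (π.left p.cl)) := by
    refine ⟨fun a b => (π.left.fiberHomeo (π.left p.cl)).injective (Subtype.ext ?_)⟩
    exact (hF _ ((π.left.fiberHomeo (π.left p.cl)) a).2).trans (hF _ ((π.left.fiberHomeo (π.left p.cl)) b).2).symm
  convert isOpen_univ
  exact Set.eq_univ_of_forall fun y => Subsingleton.elim _ _

/-- limits in `Q` of arcs of `M` depend only on the limit in `B` -/
def SameLim {M B Q : OverR k} (b : M ⟶ B) (f : M ⟶ Q) : Prop :=
  ∀ (c c' : Pt M (LaurentSeries k)) (e e' : Pt B (PowerSeries k)) (q q' : Pt Q (PowerSeries k)),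
    e.map (psL k k) = c ≫ b → e'.map (psL k k) = c' ≫ b → e.cl = e'.cl →
    q.map (psL k k) = c ≫ f → q'.map (psL k k) = c' ≫ f → q.cl = q'.cl

lemma descend [IsAlgClosed k] [CharZero k] {M B Q : OverR k} [AlgebraicGeometry.IsIntegral M.left] [LocallyOfFiniteType M.hom]
    [LocallyOfFiniteType B.hom] [IsProper Q.hom] (b : M ⟶ B) (f : M ⟶ Q) [QuasiCompact b.left] [QuasiSeparated b.left]
    (h : SameLim b f) : ∃ F : b.left.normalization ⟶ Q.left, b.left.toNormalization ≫ F = f.left ∧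
      F ≫ Q.hom = b.left.fromNormalization ≫ B.hom := by
  let φ := liftO b f
  have h0 : IsProper (fstO B Q).left := inferInstanceAs (IsProper (pullback.fst B.hom Q.hom))
  have hqc : QuasiCompact φ.left := by
    have e : φ.left ≫ (fstO B Q).left = b.left := congr(($(liftO_fst b f)).left)
    have : QuasiCompact (φ.left ≫ (fstO B Q).left) := by rw [e]; infer_instance
    exact QuasiCompact.of_comp φ.left (fstO B Q).left
  let W : OverR k := Over.mk (φ.left.imageι ≫ (prodO B Q).hom)
  let i : W ⟶ prodO B Q := Over.homMk φ.left.imageι rfl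
  have hi : IsClosedImmersion i.left := inferInstanceAs (IsClosedImmersion φ.left.imageι)
  let τ : M ⟶ W := Over.homMk φ.left.toImage (by
    change _ ≫ _ ≫ _ = _
    rw [Scheme.Hom.toImage_imageι_assoc]
    exact Over.w φ)
  have hτi : τ ≫ i = φ := by ext1; exact Scheme.Hom.toImage_imageι _
  have hτd : IsDominant τ.left := inferInstanceAs (IsDominant φ.left.toImage)
  let π : W ⟶ B := i ≫ fstO B Q
  have hπ : IsProper π.left := inferInstanceAs (IsProper (i.left ≫ (fstO B Q).left))
  have hprod : LocallyOfFiniteType (prodO B Q).hom := inferInstanceAs (LocallyOfFiniteType (pullback.fst B.hom Q.hom ≫ B.hom))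
  have hW : LocallyOfFiniteType W.hom := inferInstanceAs (LocallyOfFiniteType (i.left ≫ (prodO B Q).hom))
  have hmono : Mono i := by
    have : Mono i.left := inferInstance
    exact Over.mono_of_mono_left i
  have hqf : LocallyQuasiFinite π.left := by
    refine qf_of_kpts π fun w w' hw => ?_
    obtain ⟨c, e, hce, he⟩ := arc τ w (by rw [hτd.1.closure_range]; trivial)
    obtain ⟨c', e', hce', he'⟩ := arc τ w' (by rw [hτd.1.closure_range]; trivial)
    have key := h c c' (e ≫ π) (e' ≫ π) (e ≫ i ≫ sndO B Q) (e' ≫ i ≫ sndO B Q)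
      (by rw [Pt.map_comp, hce, Category.assoc]; congr 1; rw [← Category.assoc, hτi, liftO_fst])
      (by rw [Pt.map_comp, hce', Category.assoc]; congr 1; rw [← Category.assoc, hτi, liftO_fst])
      (by rw [cl_comp, cl_comp, he, he', ← cl_comp, ← cl_comp, hw])
      (by rw [Pt.map_comp, hce, Category.assoc]; congr 1; rw [← Category.assoc, hτi, liftO_snd])
      (by rw [Pt.map_comp, hce', Category.assoc]; congr 1; rw [← Category.assoc, hτi, liftO_snd])
    rw [cl_comp, cl_comp, he, he', ← cl_comp, ← cl_comp] at key
    rw [← cancel_mono i]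
    apply prodO_ext
    · simpa [π] using hw
    · simpa using kpt_ext key
  have hfin : IsFinite π.left := IsFinite.of_isProper_of_locallyQuasiFinite _
  have hb : b.left = τ.left ≫ π.left := by
    have : b = τ ≫ π := by
      change b = τ ≫ i ≫ fstO B Q
      rw [← Category.assoc, hτi, liftO_fst]
    exact congr(($this).left)
  refine ⟨b.left.normalizationDesc τ.left π.left hb ≫ (i ≫ sndO B Q).left, ?_, ?_⟩
  · rw [← Category.assoc, Scheme.Hom.toNormalization_normalizationDesc]
    have : τ ≫ i ≫ sndO B Q = f := by rw [← Category.assoc, hτi, liftO_snd]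
    exact congr(($this).left)
  · rw [Category.assoc, Over.w, ← Over.w π, ← Category.assoc, Scheme.Hom.normalizationDesc_comp]

end P15

section P16
variable {k : Type} [Field k] {X : OverR k}

variable (k) in
/-- constants in power series -/
def CA (A : Type) [CommRing A] [Algebra k A] : A →ₐ[k] PowerSeries A :=
  { (PowerSeries.C (R := A)) with
    commutes' c := by
      rw [PowerSeries.algebraMap_apply]; rfl }

lemma ccA_CA (A : Type) [CommRing A] [Algebra k A] : (ccA k A).comp (CA k A) = AlgHom.id k A := by
  ext a
  exact PowerSeries.constantCoeff_C a

lemma ccA_mapA {A B : Type} [CommRing A] [Algebra k A] [CommRing B] [Algebra k B] (g : A →ₐ[k] B) :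
    (ccA k B).comp (mapA g) = g.comp (ccA k A) := by
  ext f
  change PowerSeries.constantCoeff (PowerSeries.map g.toRingHom f) = g (PowerSeries.constantCoeff f)
  rw [← PowerSeries.coeff_zero_eq_constantCoeff_apply, PowerSeries.coeff_map, PowerSeries.coeff_zero_eq_constantCoeff_apply]
  rfl

lemma mapA_CA {A B : Type} [CommRing A] [Algebra k A] [CommRing B] [Algebra k B] (g : A →ₐ[k] B) :
    (mapA g).comp (CA k A) = (CA k B).comp g := by
  ext1 f
  exact PowerSeries.map_C g.toRingHom f

variable (k) in
/-- power series in `t`, seen in `k[[s]][[t]]` -/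
def iD : PowerSeries k →ₐ[k] DD k := mapA (Algebra.ofId k (PowerSeries k))

lemma swap_CA : swapD.comp (CA k (PowerSeries k)) = iD k := by
  ext1 f
  refine DD_ext fun i j => ?_
  rw [AlgHom.comp_apply, cf_swapD]
  change PowerSeries.coeff j (PowerSeries.coeff i (PowerSeries.C f)) = PowerSeries.coeff i (PowerSeries.coeff j (PowerSeries.map _ f))
  rw [PowerSeries.coeff_map, PowerSeries.coeff_C]
  change _ = PowerSeries.coeff i (PowerSeries.C _)
  rw [PowerSeries.coeff_C]
  split_ifs <;> simp

lemma swap_iD : swapD.comp (iD k) = CA k (PowerSeries k) := by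
  rw [← swap_CA]
  ext1 f
  exact swapD_swapD (CA k (PowerSeries k) f)

lemma ccA_iD (f : PowerSeries k) : ccA k (PowerSeries k) (iD k f) = algebraMap k _ (ccA k k f) :=
  congr($(ccA_mapA (Algebra.ofId k (PowerSeries k))) f)

variable (Γ : GroupScheme k)

lemma map_mul_pt {R S : Type} [CommRing R] [Algebra k R] [CommRing S] [Algebra k S] (f : R →ₐ[k] S) (a b : Pt Γ.G R) :
    Pt.map f (Γ.mul a b) = Γ.mul (Pt.map f a) (Pt.map f b) := Γ.mul_natural _ _ _

lemma map_inv_pt {R S : Type} [CommRing R] [Algebra k R] [CommRing S] [Algebra k S] (f : R →ₐ[k] S) (a : Pt Γ.G R) :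
    Pt.map f (Γ.inv a) = Γ.inv (Pt.map f a) := Γ.inv_natural _ _

instance isLocalHom_ccA (A : Type) [CommRing A] [Algebra k A] : IsLocalHom (ccA k A).toRingHom :=
  ⟨fun _ h => PowerSeries.isUnit_iff_constantCoeff.2 h⟩

instance : IsLocalHom (Algebra.ofId k (PowerSeries k)).toRingHom := by
  constructor
  intro a h
  have : IsUnit (PowerSeries.constantCoeff (algebraMap k (PowerSeries k) a)) := IsUnit.map PowerSeries.constantCoeff h
  simpa using this

lemma cl_ccA {A : Type} [CommRing A] [Algebra k A] [IsLocalRing A] (y : Pt X (PowerSeries A)) : (y.map (ccA k A)).cl = y.cl :=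
  cl_map _ _

lemma cl_field {F F' : Type} [Field F] [Field F'] [Algebra k F] [Algebra k F'] (f : F →ₐ[k] F') (y : Pt X F) :
    (y.map f).cl = y.cl := by
  have : IsLocalHom f.toRingHom := ⟨fun a h => by
    have : f a ≠ 0 := h.ne_zero
    exact isUnit_iff_ne_zero.2 fun h0 => this (by rw [h0, map_zero])⟩
  exact cl_map f y

/-- a `DD`-point of `G` whose restriction to `t = 0` is generically in `V` -/
lemma lim_open {M G : OverR k} (i : M ⟶ G) [IsOpenImmersion i.left] (g : M ⟶ X) (h : Pt G (DD k)) (e : Pt G (PowerSeries k))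
    (he : h.map (ccA k _) = e) (c : Pt M (LaurentSeries k)) (hc : e.map (psL k k) = c ≫ i)
    (q : Pt X (PowerSeries k)) (hq : q.map (psL k k) = c ≫ g) :
    ∃ v : Pt M (LL k), v ≫ i = h.map (IsScalarTower.toAlgHom k (DD k) (LL k)) ∧ Lim (v ≫ g) (q.map (ccA k k)) := by
  have hm : Mono i := Over.mono_of_mono_left i
  have e1 : (h.map sideD).map (ccA k (LaurentSeries k)) = c ≫ i := by
    rw [Pt.map_map, ← hc, ← he, Pt.map_map]
    congr 1
  have h1 : (h.map sideD).cl ∈ Set.range i.left := by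
    rw [← cl_ccA, e1, cl_comp]
    exact ⟨_, rfl⟩
  obtain ⟨v1, hv1⟩ := liftChart_local i _ h1
  have e2 : (h.map (IsScalarTower.toAlgHom k (DD k) (LL k))).map sideL = (h.map sideD).map (psL k _) := by
    rw [Pt.map_map, Pt.map_map]
    congr 1
    ext1 f
    exact sideL_algebraMap f
  have h2 : (h.map (IsScalarTower.toAlgHom k (DD k) (LL k))).cl ∈ Set.range i.left := by
    rw [← cl_field sideL, e2, ← hv1, Pt.map_comp, cl_comp]
    exact ⟨_, rfl⟩
  obtain ⟨v, hv⟩ := liftChart_local i _ h2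
  refine ⟨v, hv, v1 ≫ g, q, ?_, ?_, (cl_ccA q).symm⟩
  · rw [Pt.map_comp, Pt.map_comp]
    congr 1
    rw [← cancel_mono i, ← Pt.map_comp, ← Pt.map_comp, hv, hv1, e2]
  · rw [Pt.map_comp, hq]
    congr 1
    rw [← cancel_mono i, ← Pt.map_comp, hv1, e1]

lemma group_sameLim [IsAlgClosed k] [LocallyOfFiniteType Γ.G.hom] [IsProper X.hom] (hX : NR X) {M : OverR k} (i : M ⟶ Γ.G) [IsOpenImmersion i.left]
    (g : M ⟶ X) : SameLim i g := by
  intro c c' e e' q q' he he' hee hq hq'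
  have hm : Mono i := Over.mono_of_mono_left i
  let p : Pt Γ.G k := e.map (ccA k k)
  have hp : e'.map (ccA k k) = p := kpt_ext (by rw [cl_ccA, cl_ccA, hee])
  let h : Pt Γ.G (DD k) := Γ.mul (e.map (CA k _)) (Γ.mul (Γ.inv (p.map (Algebra.ofId k _))) (e'.map (iD k)))
  have hcc : ∀ f : Pt Γ.G (PowerSeries k), (f.map (CA k (PowerSeries k))).map (ccA k (PowerSeries k)) = f := fun f => by
    rw [Pt.map_map, ccA_CA, Pt.map_id]
  have hci : ∀ f : Pt Γ.G (PowerSeries k), (f.map (iD k)).map (ccA k (PowerSeries k)) = (f.map (ccA k k)).map (Algebra.ofId k _) := fun f => by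
    rw [Pt.map_map, Pt.map_map]
    congr 1
  have hco : ∀ {R S : Type} [CommRing R] [Algebra k R] [CommRing S] [Algebra k S] (f : R →ₐ[k] S) (p : Pt Γ.G k),
      (p.map (Algebra.ofId k R)).map f = p.map (Algebra.ofId k S) := fun f p => by
    rw [Pt.map_map]
    congr 1
    ext
  have h1 : h.map (ccA k _) = e := by
    rw [map_mul_pt, map_mul_pt, map_inv_pt, hcc, hci, hco, hp, Γ.inv_mul, Γ.mul_one']
  have h2 : (h.map swapD).map (ccA k _) = e' := by
    have hs : h.map swapD = Γ.mul (e.map (iD k)) (Γ.mul (Γ.inv (p.map (Algebra.ofId k _))) (e'.map (CA k _))) := by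
      have hs1 : (e.map (CA k (PowerSeries k))).map swapD = e.map (iD k) := (Pt.map_map _ _ e).trans (by rw [swap_CA])
      have hs2 : (e'.map (iD k)).map swapD = e'.map (CA k (PowerSeries k)) := (Pt.map_map _ _ e').trans (by rw [swap_iD])
      rw [map_mul_pt, map_mul_pt, map_inv_pt, hco, hs1, hs2]
    rw [hs, map_mul_pt, map_mul_pt, map_inv_pt, hcc, hci, hco, ← Γ.mul_assoc]
    change Γ.mul (Γ.mul (p.map _) _) _ = _
    rw [Γ.mul_inv', Γ.one_mul]
  obtain ⟨v, hv, hL⟩ := lim_open i g h e h1 c he q hq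
  obtain ⟨v', hv', hL'⟩ := lim_open i g _ e' h2 c' he' q' hq'
  have hvv : v.map swapL = v' := by
    rw [← cancel_mono i, ← Pt.map_comp, hv, hv', Pt.map_map, Pt.map_map]
    congr 1
    ext1 f
    exact swapL_algebraMap f
  have := lemmaS hX hL (x' := q'.map (ccA k k)) (by rw [Pt.map_comp, hvv]; exact hL')
  rw [← cl_ccA, ← cl_ccA q', this]

lemma group_integral [IsAlgClosed k] [CharZero k] (hΓ : Γ.IsFiniteTypeConnected) : AlgebraicGeometry.IsIntegral Γ.G.left := by
  obtain ⟨_, _, _⟩ := hΓ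
  have : IrreducibleSpace Γ.G.left := homog_irreducible Γ.homog
  have : IsReduced Γ.G.left := cartier Γ
  exact isIntegral_of_irreducibleSpace_of_isReduced _

lemma extend_group [IsAlgClosed k] [CharZero k] (hΓ : Γ.IsFiniteTypeConnected) [IsProper X.hom] (hX : NR X) (V : Γ.G.left.Opens)
    [Nonempty V] (g : opO Γ.G V ⟶ X) : ∃ f : Γ.G ⟶ X, opι Γ.G V ≫ f = g := by
  have := group_integral Γ hΓ
  obtain ⟨_, _, _⟩ := hΓ
  have : IsLocallyNoetherian Γ.G.left := LocallyOfFiniteType.isLocallyNoetherian Γ.G.hom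
  have : QuasiCompact V.ι := inferInstance
  have : AlgebraicGeometry.IsIntegral (opO Γ.G V).left := inferInstanceAs (AlgebraicGeometry.IsIntegral V.toScheme)
  have : LocallyOfFiniteType (opO Γ.G V).hom := inferInstanceAs (LocallyOfFiniteType (V.ι ≫ Γ.G.hom))
  have : QuasiCompact (opι Γ.G V).left := inferInstanceAs (QuasiCompact V.ι)
  obtain ⟨F, hF1, hF2⟩ := descend (opι Γ.G V) g (group_sameLim Γ hX _ _)
  have hiso : IsIso (opι Γ.G V).left.fromNormalization := norm_open_iso (homog_normal Γ.homog) V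
  refine ⟨Over.homMk (inv (opι Γ.G V).left.fromNormalization ≫ F) ?_, ?_⟩
  · rw [Category.assoc, hF2, IsIso.inv_hom_id_assoc]
  · ext1
    change (opι Γ.G V).left ≫ inv (opι Γ.G V).left.fromNormalization ≫ F = g.left
    rw [← hF1]
    nth_rw 1 [← (opι Γ.G V).left.toNormalization_fromNormalization]
    rw [Category.assoc, IsIso.hom_inv_id_assoc]

end P16

section P17
variable {k : Type} [Field k] {X Y Z W : OverR k}

/-- factorization through a closed immersion from a reduced source -/
lemma closed_lift {S : OverR k} (i : Z ⟶ W) [IsClosedImmersion i.left] (s : S ⟶ W) [IsReduced S.left]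
    (h : Set.range s.left ⊆ Set.range i.left) : ∃ z : S ⟶ Z, z ≫ i = s := by
  have hs : Surjective (pullback.snd i.left s.left) := by
    constructor
    rw [← Set.range_eq_univ, Scheme.Pullback.range_snd, Set.eq_univ_iff_forall]
    exact fun x => h ⟨x, rfl⟩
  have := isIso_of_isClosedImmersion_of_surjective (pullback.snd i.left s.left)
  have e : (inv (pullback.snd i.left s.left) ≫ pullback.fst i.left s.left) ≫ i.left = s.left := by
    rw [Category.assoc, pullback.condition, IsIso.inv_hom_id_assoc]
  refine ⟨Over.homMk (inv (pullback.snd i.left s.left) ≫ pullback.fst i.left s.left) ?_, ?_⟩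
  · rw [← Over.w i, ← Category.assoc, e, Over.w]
  · ext1; exact e

/-- locus where two morphisms agree -/
def eqL (u v : W ⟶ Y) : Set W.left := (liftO u v).left ⁻¹' Set.range (liftO (𝟙 Y) (𝟙 Y)).left

instance diag_closed [IsSeparated Y.hom] : IsClosedImmersion (liftO (𝟙 Y) (𝟙 Y)).left :=
  inferInstanceAs (IsClosedImmersion (pullback.diagonal Y.hom))

lemma eqL_closed [IsSeparated Y.hom] (u v : W ⟶ Y) : IsClosed (eqL u v) :=
  (IsClosedImmersion.isClosedEmbedding (liftO (𝟙 Y) (𝟙 Y)).left).isClosed_range.preimage (liftO u v).left.continuous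

lemma eqL_comp {V : OverR k} (u v : W ⟶ Y) (p : Y ⟶ V) : eqL u v ⊆ eqL (u ≫ p) (v ≫ p) := by
  rintro x ⟨z, hz⟩
  refine ⟨p.left z, ?_⟩
  have e1 : liftO u v ≫ liftO (fstO Y Y ≫ p) (sndO Y Y ≫ p) = liftO (u ≫ p) (v ≫ p) := by
    rw [comp_liftO, liftO_fst_assoc, liftO_snd_assoc]
  have e2 : liftO (𝟙 Y) (𝟙 Y) ≫ liftO (fstO Y Y ≫ p) (sndO Y Y ≫ p) = p ≫ liftO (𝟙 V) (𝟙 V) := by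
    rw [comp_liftO, comp_liftO, liftO_fst_assoc, liftO_snd_assoc, Category.id_comp, Category.comp_id]
  have h1 : (liftO (u ≫ p) (v ≫ p)).left x = (liftO (fstO Y Y ≫ p) (sndO Y Y ≫ p)).left ((liftO u v).left x) := congr(($e1).left x).symm
  have h2 : (liftO (𝟙 V) (𝟙 V)).left (p.left z) = (liftO (fstO Y Y ≫ p) (sndO Y Y ≫ p)).left ((liftO (𝟙 Y) (𝟙 Y)).left z) := congr(($e2).left z).symm
  rw [h1, h2, hz]

lemma eqL_pre {V : OverR k} (u v : W ⟶ Y) (s : V ⟶ W) : eqL (s ≫ u) (s ≫ v) = s.left ⁻¹' eqL u v := by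
  unfold eqL
  rw [← comp_liftO]
  rfl

lemma range_eqL {S : OverR k} (u v : W ⟶ Y) (s : S ⟶ W) (h : s ≫ u = s ≫ v) : Set.range s.left ⊆ eqL u v := by
  rintro _ ⟨x, rfl⟩
  refine ⟨(s ≫ u).left x, ?_⟩
  have e : (s ≫ u) ≫ liftO (𝟙 Y) (𝟙 Y) = s ≫ liftO u v := by
    rw [comp_liftO, comp_liftO, Category.comp_id, h]
  exact congr(($e).left x)

lemma of_range_eqL [IsSeparated Y.hom] {S : OverR k} [IsReduced S.left] (u v : W ⟶ Y) (s : S ⟶ W) (h : Set.range s.left ⊆ eqL u v) :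
    s ≫ u = s ≫ v := by
  obtain ⟨z, hz⟩ := closed_lift (liftO (𝟙 Y) (𝟙 Y)) (s ≫ liftO u v) (by
    rintro _ ⟨x, rfl⟩
    exact h ⟨x, rfl⟩)
  have h1 : s ≫ u = z := by
    have := congr($hz ≫ fstO Y Y)
    rw [Category.assoc, Category.assoc, liftO_fst, liftO_fst, Category.comp_id] at this
    exact this.symm
  have h2 : s ≫ v = z := by
    have := congr($hz ≫ sndO Y Y)
    rw [Category.assoc, Category.assoc, liftO_snd, liftO_snd, Category.comp_id] at this
    exact this.symm
  rw [h1, h2]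

instance SO_reduced {R : Type} [CommRing R] [Algebra k R] [IsReduced R] : IsReduced (SO k R).left :=
  inferInstanceAs (IsReduced (Spec (CommRingCat.of R)))

lemma cl_range (p : Pt X k) : Set.range p.left = {p.cl} := by
  ext x
  constructor
  · rintro ⟨y, rfl⟩
    have : Subsingleton (SO k k).left := inferInstanceAs (Subsingleton (PrimeSpectrum k))
    rw [Subsingleton.elim y (IsLocalRing.closedPoint k)]
    rfl
  · rintro rfl
    exact ⟨_, rfl⟩

lemma cl_eqL [IsSeparated Y.hom] (u v : W ⟶ Y) (p : Pt W k) : p.cl ∈ eqL u v ↔ p ≫ u = p ≫ v := by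
  constructor
  · intro h
    refine of_range_eqL u v p ?_
    rw [cl_range]
    simpa using h
  · intro h
    exact range_eqL u v p h ⟨_, rfl⟩

lemma pt_of_cl {S : OverR k} [IsReduced S.left] [IsSeparated Y.hom] (p : Pt Y k) (y : S ⟶ Y) (h : Set.range y.left ⊆ {p.cl}) :
    y = constO S p := by
  have : IsClosedImmersion p.left := by
    have : IsClosedImmersion (p.left ≫ Y.hom) := by rw [kpt_w]; infer_instance
    exact IsClosedImmersion.of_comp p.left Y.hom
  obtain ⟨z, hz⟩ := closed_lift p y (by rwa [cl_range])
  rw [← hz, ← comp_constO z p, constO_k]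

/-- proper without rational curves -/
structure Good (Y : OverR k) : Prop where
  proper : IsProper Y.hom
  nr : NR Y

lemma Good.prod (hX : Good X) (hY : Good Y) : Good (prodO X Y) := by
  have := hX.1
  have := hY.1
  refine ⟨inferInstanceAs (IsProper (pullback.fst X.hom Y.hom ≫ X.hom)), fun y => ?_⟩
  obtain ⟨a, ha⟩ := hX.2 (y ≫ fstO X Y)
  obtain ⟨b, hb⟩ := hY.2 (y ≫ sndO X Y)
  refine ⟨liftO a b, prodO_ext ?_ ?_⟩
  · rw [ha, ← Pt.map_comp, liftO_fst]
  · rw [hb, ← Pt.map_comp, liftO_snd]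

lemma Good.finite [IsAlgClosed k] (hY : Good Y) (i : Z ⟶ Y) [IsFinite i.left] : Good Z := by
  have := hY.1
  have hp : IsProper Z.hom := by
    rw [← Over.w i]; infer_instance
  refine ⟨hp, fun y => ?_⟩
  obtain ⟨x, hx⟩ := hY.2 (y ≫ i)
  have hcl : i.left y.cl = x.cl := by
    rw [← cl_comp, hx, cl_field]
  have hc : IsClosed {y.cl} := by
    have hd := (i.left.isDiscrete_preimage_singleton x.cl).to_subtype
    have h1 : IsClosed (i.left ⁻¹' {x.cl}) := (kpt_closed x).preimage i.left.continuous
    have := h1.isClosedEmbedding_subtypeVal.isClosedMap {⟨y.cl, hcl⟩} (isClosed_discrete _)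
    simpa using this
  obtain ⟨p, hp⟩ := exists_kpt (X := Z) y.cl hc
  refine ⟨p, ?_⟩
  rw [← constO_pt]
  refine pt_of_cl p y ?_
  rintro _ ⟨z, rfl⟩
  have : Subsingleton (SO k (RatFunc k)).left := inferInstanceAs (Subsingleton (PrimeSpectrum (RatFunc k)))
  rw [hp, Subsingleton.elim z (IsLocalRing.closedPoint (RatFunc k))]
  rfl

/-- `P` sees at least as much as every morphism to a good scheme -/
def Minl {G Y : OverR k} (P : G ⟶ Y) : Prop :=
  ∀ (Q : OverR k), Good Q → ∀ (f : G ⟶ Q) (a b : Pt G k), a ≫ P = b ≫ P → a ≫ f = b ≫ f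

lemma exists_minl [IsAlgClosed k] (G : OverR k) [LocallyOfFiniteType G.hom] [QuasiCompact G.hom] (Y₀ : OverR k) (h₀ : Good Y₀) (f₀ : G ⟶ Y₀) :
    ∃ (Y : OverR k) (_ : Good Y) (P : G ⟶ Y), Minl P := by
  have h1 : LocallyOfFiniteType (prodO G G).hom := inferInstanceAs (LocallyOfFiniteType (pullback.fst G.hom G.hom ≫ G.hom))
  have h2 : QuasiCompact (prodO G G).hom := inferInstanceAs (QuasiCompact (pullback.fst G.hom G.hom ≫ G.hom))
  have : IsLocallyNoetherian (prodO G G).left := LocallyOfFiniteType.isLocallyNoetherian (prodO G G).hom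
  have : CompactSpace (prodO G G).left := QuasiCompact.compactSpace_of_compactSpace (prodO G G).hom
  have : IsNoetherian (prodO G G).left := {}
  have : TopologicalSpace.NoetherianSpace (prodO G G).left := inferInstance
  have hwf : WellFoundedLT (TopologicalSpace.Closeds (prodO G G).left) := inferInstance
  let 𝒮 : Set (TopologicalSpace.Closeds (prodO G G).left) :=
    {E | ∃ (Y : OverR k) (_ : Good Y) (P : G ⟶ Y), (E : Set (prodO G G).left) = eqL (fstO G G ≫ P) (sndO G G ≫ P)}
  have hmk : ∀ (Y : OverR k) (_ : Good Y) (P : G ⟶ Y), ∃ E ∈ 𝒮, (E : Set (prodO G G).left) = eqL (fstO G G ≫ P) (sndO G G ≫ P) := by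
    intro Y hY P
    have := hY.1
    exact ⟨⟨_, eqL_closed _ _⟩, ⟨Y, hY, P, rfl⟩, rfl⟩
  obtain ⟨E, ⟨Y, hY, P, hE⟩, hmin⟩ := WellFounded.has_min hwf.wf 𝒮 (by obtain ⟨E, h, _⟩ := hmk Y₀ h₀ f₀; exact ⟨E, h⟩)
  refine ⟨Y, hY, P, fun Q hQ f a b hab => ?_⟩
  have := hY.1
  have := hQ.1
  have := (hY.prod hQ).1
  obtain ⟨E', hE', hE'2⟩ := hmk _ (hY.prod hQ) (liftO P f)
  have hle : (E' : Set (prodO G G).left) ⊆ E := by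
    rw [hE, hE'2]
    have := eqL_comp (fstO G G ≫ liftO P f) (sndO G G ≫ liftO P f) (fstO Y Q)
    rwa [Category.assoc, Category.assoc, liftO_fst] at this
  have : ¬ E' < E := hmin E' hE'
  have hEE : (E : Set (prodO G G).left) ⊆ E' := by
    by_contra hne
    exact this (lt_of_le_of_ne hle fun h => hne (by rw [h]))
  have h3 : Pt.cl (liftO a b : Pt (prodO G G) k) ∈ (E : Set (prodO G G).left) := by
    rw [hE, cl_eqL, ← Category.assoc, ← Category.assoc, liftO_fst, liftO_snd, hab]
  have h4 := hEE h3
  rw [hE'2, cl_eqL, ← Category.assoc, ← Category.assoc, liftO_fst, liftO_snd, comp_liftO, comp_liftO] at h4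
  have := congr($h4 ≫ sndO Y Q)
  rwa [liftO_snd, liftO_snd] at this

lemma prodO_lft [LocallyOfFiniteType X.hom] [LocallyOfFiniteType Y.hom] : LocallyOfFiniteType (prodO X Y).hom :=
  inferInstanceAs (LocallyOfFiniteType (pullback.fst X.hom Y.hom ≫ X.hom))

lemma Minl.param [IsAlgClosed k] {G T Q : OverR k} [LocallyOfFiniteType G.hom] [LocallyOfFiniteType T.hom] {P : G ⟶ Y} (hP : Minl P)
    (hY : IsSeparated Y.hom) (hQ : Good Q) (F : prodO T G ⟶ Q) {S : OverR k} [IsReduced S.left] (τ : S ⟶ T) (a b : S ⟶ G) (h : a ≫ P = b ≫ P) :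
    liftO τ a ≫ F = liftO τ b ≫ F := by
  have := hQ.1
  have : LocallyOfFiniteType (prodO G G).hom := prodO_lft
  have hl : LocallyOfFiniteType (prodO T (prodO G G)).hom := prodO_lft
  let W := prodO T (prodO G G)
  obtain ⟨a', ha'⟩ : ∃ a' : W ⟶ G, a' = sndO T (prodO G G) ≫ fstO G G := ⟨_, rfl⟩
  obtain ⟨b', hb'⟩ : ∃ b' : W ⟶ G, b' = sndO T (prodO G G) ≫ sndO G G := ⟨_, rfl⟩
  obtain ⟨t', ht'⟩ : ∃ t' : W ⟶ T, t' = fstO T (prodO G G) := ⟨_, rfl⟩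
  have hsub : eqL (a' ≫ P) (b' ≫ P) ⊆ eqL (liftO t' a' ≫ F) (liftO t' b' ≫ F) := by
    intro x hx
    by_contra hx'
    obtain ⟨p, hp, hp'⟩ := jac_pt (W := W) (eqL (a' ≫ P) (b' ≫ P) ∩ (eqL (liftO t' a' ≫ F) (liftO t' b' ≫ F))ᶜ)
      ((eqL_closed _ _).isLocallyClosed.inter (eqL_closed _ _).isOpen_compl.isLocallyClosed) ⟨x, hx, hx'⟩
    apply hp'
    rw [cl_eqL] at hp ⊢
    rw [← Category.assoc, ← Category.assoc] at hp
    have := hP Q hQ (liftO (constO G (p ≫ t')) (𝟙 G) ≫ F) (p ≫ a') (p ≫ b') hp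
    rw [← Category.assoc, ← Category.assoc, comp_liftO, comp_liftO, comp_constO, comp_constO, constO_k, Category.comp_id, Category.comp_id] at this
    rw [← Category.assoc, ← Category.assoc, comp_liftO, comp_liftO, this]
  let s : S ⟶ W := liftO τ (liftO a b)
  have ha : s ≫ a' = a := by simp [s, ha']
  have hb : s ≫ b' = b := by simp [s, hb']
  have ht : s ≫ t' = τ := by simp [s, ht']
  have := of_range_eqL (liftO t' a' ≫ F) (liftO t' b' ≫ F) s ((range_eqL (a' ≫ P) (b' ≫ P) s (by
    rw [← Category.assoc, ← Category.assoc, ha, hb, h])).trans hsub)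
  rwa [← Category.assoc, ← Category.assoc, comp_liftO, comp_liftO, ha, hb, ht] at this

lemma image_integral {A B : Scheme} (f : A ⟶ B) [QuasiCompact f] [AlgebraicGeometry.IsIntegral A] : AlgebraicGeometry.IsIntegral f.image := by
  have hA : Nonempty A := inferInstance
  have hd : IsDominant f.toImage := inferInstance
  refine ⟨⟨f.toImage hA.some⟩, fun U hU => ?_⟩
  have : Nonempty (f.toImage ⁻¹ᵁ U) := by
    obtain ⟨x, hx⟩ := hd.1.exists_mem_open U.2 (Set.nonempty_coe_sort.1 hU)
    exact ⟨⟨x, hx⟩⟩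
  have h := (TopCat.Presheaf.app_injective_iff_stalkFunctor_map_injective (F := f.image.sheaf) f.toImage.c).1 fun x => f.stalkFunctor_toImage_injective x
  have h' : Function.Injective (f.toImage.app U).hom := h U
  exact h'.isDomain (f.toImage.app U).hom

/-- minimal, good, dominant, integral target -/
structure MinG {G Y : OverR k} (P : G ⟶ Y) : Prop where
  good : Good Y
  int : AlgebraicGeometry.IsIntegral Y.left
  dom : IsDominant P.left
  min : Minl P

lemma exists_minG [IsAlgClosed k] (G : OverR k) [LocallyOfFiniteType G.hom] [QuasiCompact G.hom] [AlgebraicGeometry.IsIntegral G.left]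
    (Y₀ : OverR k) (h₀ : Good Y₀) (f₀ : G ⟶ Y₀) :
    ∃ (Y : OverR k) (P : G ⟶ Y), MinG P := by
  obtain ⟨Y, hY, P, hP⟩ := exists_minl G Y₀ h₀ f₀
  have := hY.1
  have hqc : QuasiCompact P.left := by
    have : QuasiCompact (P.left ≫ Y.hom) := by rw [Over.w]; infer_instance
    exact QuasiCompact.of_comp P.left Y.hom
  let W : OverR k := Over.mk (P.left.imageι ≫ Y.hom)
  let i : W ⟶ Y := Over.homMk P.left.imageι rfl
  have hi : IsClosedImmersion i.left := inferInstanceAs (IsClosedImmersion P.left.imageι)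
  let τ : G ⟶ W := Over.homMk P.left.toImage (by
    change _ ≫ _ ≫ _ = _
    rw [Scheme.Hom.toImage_imageι_assoc, Over.w])
  have hτ : τ ≫ i = P := by
    ext1
    exact P.left.toImage_imageι
  refine ⟨W, τ, hY.finite i, ?_, inferInstanceAs (IsDominant P.left.toImage), ?_⟩
  · exact image_integral P.left
  · intro Q hQ f a b hab
    refine hP Q hQ f a b ?_
    rw [← hτ, ← Category.assoc, hab, Category.assoc]

end P17

section P18
variable {k : Type} [Field k] {X : OverR k}

/-- `t ↦ u τ` -/
def sg {A : Type} [CommRing A] [Algebra k A] (u : A) : PowerSeries k →ₐ[k] PowerSeries A :=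
  { (PowerSeries.rescale u).comp (mapA (Algebra.ofId k A)).toRingHom with
    commutes' c := by
      change PowerSeries.rescale u (mapA (Algebra.ofId k A) (algebraMap k _ c)) = _
      rw [AlgHom.commutes]
      ext n
      rw [PowerSeries.coeff_rescale, PowerSeries.algebraMap_apply, PowerSeries.coeff_C]
      split_ifs with h
      · rw [h, pow_zero, one_mul]
      · rw [mul_zero] }

lemma coeff_sg {A : Type} [CommRing A] [Algebra k A] (u : A) (f : PowerSeries k) (n : ℕ) :
    PowerSeries.coeff n (sg u f) = u ^ n * algebraMap k A (PowerSeries.coeff n f) := by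
  change PowerSeries.coeff n (PowerSeries.rescale u (mapA (Algebra.ofId k A) f)) = _
  rw [PowerSeries.coeff_rescale, mapA_apply, PowerSeries.coeff_map]
  rfl

lemma mapA_sg {A B : Type} [CommRing A] [Algebra k A] [CommRing B] [Algebra k B] (g : A →ₐ[k] B) (u : A) :
    (mapA g).comp (sg u) = sg (g u) := by
  ext1 f
  ext n
  rw [AlgHom.comp_apply, mapA_apply, PowerSeries.coeff_map, coeff_sg, coeff_sg]
  change g _ = _
  rw [map_mul, map_pow, AlgHom.commutes]

lemma sg_injective {A : Type} [CommRing A] [IsDomain A] [Algebra k A] (u : A) (hu : u ≠ 0) : Function.Injective (sg (k := k) u) := by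
  intro f g h
  ext n
  have := congr(PowerSeries.coeff n $h)
  rw [coeff_sg, coeff_sg] at this
  exact (algebraMap k A).injective (mul_left_cancel₀ (pow_ne_zero n hu) this)

/-- extension to Laurent series -/
def liftQ {A F : Type} [Field A] [Algebra k A] [Field F] [Algebra k F] (g : PowerSeries A →ₐ[k] F) (hg : Function.Injective g) :
    LaurentSeries A →ₐ[k] F :=
  { IsFractionRing.lift (A := PowerSeries A) (K := LaurentSeries A) (g := g.toRingHom) hg with
    commutes' c := by
      change IsFractionRing.lift (A := PowerSeries A) (K := LaurentSeries A) (g := g.toRingHom) hg _ = _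
      rw [← (psL k A).commutes c, psL_apply, IsFractionRing.lift_algebraMap (g := g.toRingHom) hg]
      exact g.commutes c }

lemma liftQ_psL {A F : Type} [Field A] [Algebra k A] [Field F] [Algebra k F] (g : PowerSeries A →ₐ[k] F) (hg : Function.Injective g) :
    (liftQ g hg).comp (psL k A) = g := by
  ext1 f
  exact IsFractionRing.lift_algebraMap (g := g.toRingHom) hg f

lemma laurent_ext {A F : Type} [Field A] [Algebra k A] [CommRing F] [Algebra k F] {a b : LaurentSeries A →ₐ[k] F}
    (h : a.comp (psL k A) = b.comp (psL k A)) : a = b := by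
  have : a.toRingHom = b.toRingHom := by
    refine IsLocalization.ringHom_ext (nonZeroDivisors (PowerSeries A)) ?_
    ext1 f
    exact congr($h f)
  ext1 f
  exact congr($this f)

lemma extend_ps [IsProper X.hom] {A : Type} [Field A] [Algebra k A] (y : Pt X (LaurentSeries A)) : ∃ z : Pt X (PowerSeries A), z.map (psL k A) = y := by
  have h : @IsScalarTower k (PowerSeries A) (LaurentSeries A) Algebra.toSMul Algebra.toSMul Algebra.toSMul :=
    IsScalarTower.of_algebraMap_eq (R := k) (S := PowerSeries A) (A := LaurentSeries A) fun c => ((psL k A).commutes c).symm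
  exact Pt.exists_extend (R := PowerSeries A) (F := LaurentSeries A) y

/-- lifting along an integral extension, up to domination by a valuation ring -/
lemma int_lift (B D O : Type) [CommRing B] [Algebra k B] [CommRing D] [Algebra k D] [CommRing O] [IsDomain O] [IsLocalRing O] [Algebra k O]
    (i : B →ₐ[k] D) (hi : Function.Injective i) (hintg : i.toRingHom.IsIntegral) (β : B →ₐ[k] O) :
    ∃ (R : Type) (_ : CommRing R) (_ : IsDomain R) (_ : ValuationRing R) (_ : Algebra k R) (η : O →ₐ[k] R) (_ : Function.Injective η)
      (_ : IsLocalHom η.toRingHom) (δ : D →ₐ[k] R), δ.comp i = η.comp β := by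
  let F := AlgebraicClosure (FractionRing O)
  let io : O →ₐ[k] F := IsScalarTower.toAlgHom k O F
  have hio : Function.Injective io := by
    have h1 := IsFractionRing.injective O (FractionRing O)
    have h2 : Function.Injective (algebraMap (FractionRing O) F) := (algebraMap (FractionRing O) F).injective
    intro a b hab
    apply h1
    apply h2
    rw [← IsScalarTower.algebraMap_apply, ← IsScalarTower.algebraMap_apply]
    exact hab
  -- the map on `D`
  obtain ⟨δ, hδ⟩ : ∃ δ : D →+* F, δ.comp i.toRingHom = io.toRingHom.comp β.toRingHom := by
    let _ := i.toRingHom.toAlgebra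
    have : Algebra.IsIntegral B D := ⟨hintg⟩
    let φ : B →+* F := io.toRingHom.comp β.toRingHom
    have hp : (RingHom.ker φ).IsPrime := RingHom.ker_isPrime φ
    obtain ⟨Q, _, hQ, hQc⟩ := Ideal.exists_ideal_over_prime_of_isIntegral (S := D) (RingHom.ker φ) ⊥ (by
      intro b hb
      have : i b = 0 := hb
      have : b = 0 := hi (by rw [this, map_zero])
      rw [this]; exact zero_mem _)
    let B' := B ⧸ RingHom.ker φ
    let D' := D ⧸ Q
    let j : B' →+* D' := Ideal.quotientMap Q i.toRingHom hQc.ge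
    have hj : Function.Injective j := Ideal.quotientMap_injective' hQc.le
    have hjint : j.IsIntegral := by
      intro x
      obtain ⟨d, rfl⟩ := Ideal.Quotient.mk_surjective x
      obtain ⟨p, hp, hp0⟩ := hintg d
      refine ⟨p.map (Ideal.Quotient.mk _), hp.map _, ?_⟩
      rw [Polynomial.eval₂_map]
      have h1 := congr(Ideal.Quotient.mk Q $hp0)
      rw [Polynomial.hom_eval₂, map_zero] at h1
      exact h1
    let _ : Algebra B' D' := j.toAlgebra
    let _ : Algebra B' F := (RingHom.kerLift φ).toAlgebra
    have : Algebra.IsIntegral B' D' := ⟨hjint⟩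
    have : Module.IsTorsionFree B' D' := Module.isTorsionFree_iff_algebraMap_injective.2 hj
    have : Module.IsTorsionFree B' F := Module.isTorsionFree_iff_algebraMap_injective.2 (RingHom.kerLift_injective φ)
    let ξ : D' →ₐ[B'] F := IsAlgClosed.lift
    refine ⟨ξ.toRingHom.comp (Ideal.Quotient.mk Q), ?_⟩
    ext1 b
    exact ξ.commutes (Ideal.Quotient.mk _ b)
  obtain ⟨V, hV⟩ := (LocalSubring.range io.toRingHom).exists_le_valuationSubring
  let _ : Algebra k V := ((algebraMap k F).codRestrict V fun c => hV.1 ⟨algebraMap k O c, io.commutes c⟩).toAlgebra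
  let η : O →ₐ[k] V := { io.toRingHom.codRestrict V fun c => hV.1 ⟨c, rfl⟩ with
    commutes' c := Subtype.ext (io.commutes c) }
  have hmem : ∀ d, δ d ∈ V := by
    intro d
    obtain ⟨p, hp, hp0⟩ := hintg d
    have h3 : IsIntegral V (δ d) := by
      refine ⟨p.map (η.comp β).toRingHom, hp.map _, ?_⟩
      rw [Polynomial.eval₂_map]
      have h1 := congr(δ $hp0)
      rw [Polynomial.hom_eval₂, hδ, map_zero] at h1
      exact h1
    obtain ⟨v, hv⟩ := IsIntegrallyClosed.isIntegral_iff.1 h3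
    rw [← hv]
    exact v.2
  let δ' : D →ₐ[k] V := { δ.codRestrict V hmem with
    commutes' c := Subtype.ext (by
      change δ (algebraMap k D c) = algebraMap k F c
      rw [← i.commutes]
      refine congr($hδ (algebraMap k B c)).trans ?_
      change io (β _) = _
      rw [AlgHom.commutes, AlgHom.commutes]) }
  refine ⟨V, inferInstance, inferInstance, inferInstance, inferInstance, η, ?_, ?_, δ', ?_⟩
  · intro a b hab
    exact hio congr(($hab : F))
  · refine ⟨fun a ha => ?_⟩
    have hl : IsLocalHom (Subring.inclusion hV.1) := hV.2
    have h1 : IsUnit (⟨io a, ⟨a, rfl⟩⟩ : (LocalSubring.range io.toRingHom).toSubring) := by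
      refine hl.map_nonunit _ ?_
      exact ha
    obtain ⟨⟨b, ⟨c, hc⟩⟩, hb⟩ := h1.exists_right_inv
    refine IsUnit.of_mul_eq_one c (hio ?_)
    rw [map_mul, map_one]
    have h2 : io a * b = 1 := congr(($hb : F))
    rw [← h2]
    exact congrArg _ hc
  · ext1 b
    exact Subtype.ext congr($hδ b)

end P18

section P19
variable {k : Type} [Field k]

lemma sg_one : sg (k := k) (1 : PowerSeries k) = iD k := by
  ext1 f
  ext1 n
  rw [coeff_sg, one_pow, one_mul]
  change _ = PowerSeries.coeff n (PowerSeries.map _ f)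
  rw [PowerSeries.coeff_map]
  rfl

/-- `t ↦ u τ` on Laurent series -/
def LQ {A : Type} [Field A] [Algebra k A] (u : A) (hu : u ≠ 0) : LaurentSeries k →ₐ[k] LaurentSeries A :=
  liftQ ((psL k A).comp (sg u)) ((psL_injective (k := k) (A := A)).comp (sg_injective u hu))

lemma LQ_psL {A : Type} [Field A] [Algebra k A] (u : A) (hu : u ≠ 0) : (LQ u hu).comp (psL k k) = (psL k A).comp (sg u) :=
  liftQ_psL _ _

def dL : DD k →ₐ[k] LL k := IsScalarTower.toAlgHom k (DD k) (LL k)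

lemma dL_injective : Function.Injective (dL (k := k)) := IsFractionRing.injective (DD k) (LL k)

def MM (u : PowerSeries k) (hu : u ≠ 0) : LaurentSeries k →ₐ[k] LL k :=
  liftQ (dL.comp (sg u)) (dL_injective.comp (sg_injective u hu))

lemma MM_psL (u : PowerSeries k) (hu : u ≠ 0) : (MM u hu).comp (psL k k) = dL.comp (sg u) :=
  liftQ_psL _ _

lemma sideL_dL : (sideL (k := k)).comp dL = (psL k _).comp sideD := by
  ext1 f
  exact sideL_algebraMap f

lemma swapL_dL : (swapL (k := k)).comp dL = dL.comp swapD := by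
  ext1 f
  exact swapL_algebraMap f

lemma psL_ne {u : PowerSeries k} (hu : u ≠ 0) : psL k k u ≠ 0 := fun h => hu (psL_injective (k := k) (A := k) (by rw [h, map_zero]))

lemma sideL_MM (u : PowerSeries k) (hu : u ≠ 0) : sideL.comp (MM u hu) = LQ (psL k k u) (psL_ne hu) := by
  apply laurent_ext
  rw [AlgHom.comp_assoc, MM_psL, LQ_psL, ← AlgHom.comp_assoc, sideL_dL, AlgHom.comp_assoc]
  congr 1
  exact mapA_sg (psL k k) u

/-- `t ↦ u(s) t` into `k((t))[[s]]` -/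
def sw (u : PowerSeries k) : PowerSeries k →ₐ[k] PowerSeries (LaurentSeries k) := (sideD.comp swapD).comp (sg u)

/-- the same on Laurent series -/
def SW (u : PowerSeries k) (hu : u ≠ 0) : LaurentSeries k →ₐ[k] LaurentSeries (LaurentSeries k) := (sideL.comp swapL).comp (MM u hu)

lemma SW_psL (u : PowerSeries k) (hu : u ≠ 0) : (SW u hu).comp (psL k k) = (psL k _).comp (sw u) := by
  rw [SW, AlgHom.comp_assoc, MM_psL]
  ext1 f
  refine (congrArg sideL congr($(swapL_dL) (sg u f))).trans ?_
  exact congr($(sideL_dL) (swapD (sg u f)))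

lemma SW_one : SW (1 : PowerSeries k) one_ne_zero = (psL k _).comp (CA k _) := by
  apply laurent_ext
  rw [SW_psL, AlgHom.comp_assoc]
  congr 1
  rw [sw, sg_one, AlgHom.comp_assoc, swap_iD]
  exact mapA_CA (psL k k)

lemma ccA_sideD : (ccA k _).comp (sideD (k := k)) = (psL k k).comp (ccA k _) := ccA_mapA (psL k k)

lemma ccA_swap_sg (u f : PowerSeries k) (n : ℕ) :
    PowerSeries.coeff n (ccA k _ (swapD (sg u f))) = (ccA k k u) ^ n * PowerSeries.coeff n f := by
  have h1 : PowerSeries.coeff n (ccA k _ (swapD (sg u f))) = cf (swapD (sg u f)) n 0 := by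
    rw [cf, PowerSeries.coeff_zero_eq_constantCoeff_apply]
    rfl
  rw [h1, cf_swapD, cf, coeff_sg, PowerSeries.coeff_zero_eq_constantCoeff_apply]
  change ccA k k _ = _
  rw [map_mul, map_pow, AlgHom.commutes]
  rfl

lemma ccA_sw_apply (u f : PowerSeries k) : ccA k _ (sw u f) = psL k k (ccA k _ (swapD (sg u f))) := congr($(ccA_sideD) (swapD (sg u f)))

lemma ccA_sw_unit (u : PowerSeries k) (hu : ccA k k u = 1) : (ccA k _).comp (sw u) = psL k k := by
  ext1 f
  rw [AlgHom.comp_apply, ccA_sw_apply]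
  congr 1
  ext n
  rw [ccA_swap_sg, hu, one_pow, one_mul]

lemma sw_injective (u : PowerSeries k) (hu : u ≠ 0) : Function.Injective (sw u) :=
  sideD_injective.comp (swapD_injective.comp (sg_injective u hu))

lemma sw_local (u : PowerSeries k) (hu : ccA k k u = 0) : IsLocalHom (sw u).toRingHom := by
  refine ⟨fun f hf => ?_⟩
  rw [PowerSeries.isUnit_iff_constantCoeff, isUnit_iff_ne_zero]
  intro h0
  have h1 : IsUnit (ccA k _ (sw u f)) := IsUnit.map (ccA k _) hf
  have h2 : ccA k _ (swapD (sg u f)) = 0 := by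
    ext n
    rw [ccA_swap_sg, hu]
    rcases n with _ | n
    · rw [PowerSeries.coeff_zero_eq_constantCoeff_apply, h0, mul_zero, map_zero]
    · rw [zero_pow (Nat.succ_ne_zero n), zero_mul, map_zero]
  rw [ccA_sw_apply, h2, map_zero] at h1
  exact not_isUnit_zero h1

/-- for unit `u` with `u(0) = 1` the map extends -/
lemma exists_rho (u : PowerSeries k) (hu : ccA k k u = 1) : ∃ ρ : LaurentSeries k →ₐ[k] PowerSeries (LaurentSeries k),
    ρ.comp (psL k k) = sw u ∧ (ccA k _).comp ρ = AlgHom.id k _ := by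
  have h0 : ∀ y : nonZeroDivisors (PowerSeries k), IsUnit ((sw u).toRingHom y) := by
    intro y
    rw [PowerSeries.isUnit_iff_constantCoeff, isUnit_iff_ne_zero]
    have h1 : ccA k _ (sw u y) = psL k k y := congr($(ccA_sw_unit u hu) y)
    change ccA k _ (sw u y) ≠ 0
    rw [h1]
    exact psL_ne (nonZeroDivisors.ne_zero y.2)
  have hl : ∀ f, IsLocalization.lift (S := LaurentSeries k) h0 (psL k k f) = sw u f := fun f => by
    rw [psL_apply]
    exact IsLocalization.lift_eq h0 f
  refine ⟨{ IsLocalization.lift (S := LaurentSeries k) h0 with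
    commutes' c := by
      change IsLocalization.lift (S := LaurentSeries k) h0 _ = _
      rw [← (psL k k).commutes c, hl, AlgHom.commutes] }, ?_, ?_⟩
  · ext1 f
    exact hl f
  · apply laurent_ext
    ext1 f
    refine (congrArg (ccA k _) (hl f)).trans ?_
    exact congr($(ccA_sw_unit u hu) f)

lemma exists_ratfunc (u : PowerSeries k) (hu : u = PowerSeries.X ∨ u = 1 + PowerSeries.X) :
    ∃ g : RatFunc k →ₐ[k] LaurentSeries k, g RatFunc.X = psL k k u := by
  have hX : Function.Injective (Polynomial.aeval (R := k) (PowerSeries.X : PowerSeries k)) := by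
    intro p q h
    have h1 : ∀ p : Polynomial k, Polynomial.aeval (R := k) (PowerSeries.X : PowerSeries k) p = (p : PowerSeries k) := by
      intro p
      have : Polynomial.aeval (R := k) (PowerSeries.X : PowerSeries k) = Polynomial.coeToPowerSeries.algHom k := by
        apply Polynomial.algHom_ext
        rw [Polynomial.aeval_X, Polynomial.coeToPowerSeries.algHom_apply]
        simp
      rw [this, Polynomial.coeToPowerSeries.algHom_apply]
      simp
    rw [h1, h1] at h
    exact Polynomial.coe_injective k h
  have hu' : Function.Injective (Polynomial.aeval (R := k) u) := by
    rcases hu with rfl | rfl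
    · exact hX
    · have : Polynomial.aeval (R := k) (1 + PowerSeries.X : PowerSeries k) = (Polynomial.aeval (R := k) (PowerSeries.X : PowerSeries k)).comp
          (Polynomial.algEquivAevalXAddC (1 : k)).toAlgHom := by
        apply Polynomial.algHom_ext
        simp [add_comm]
      rw [this]
      exact hX.comp (Polynomial.algEquivAevalXAddC (1 : k)).injective
  let φ : Polynomial k →ₐ[k] LaurentSeries k := (psL k k).comp (Polynomial.aeval u)
  have hφ : Function.Injective φ := (psL_injective (k := k) (A := k)).comp hu'
  refine ⟨RatFunc.liftAlgHom φ (nonZeroDivisors_le_comap_nonZeroDivisors_of_injective φ hφ), ?_⟩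
  rw [RatFunc.liftAlgHom_apply, RatFunc.num_X, RatFunc.denom_X, map_one, div_one]
  exact congrArg (psL k k) (Polynomial.aeval_X u)

end P19

section P20
variable {k : Type} [Field k] (Γ : GroupScheme k) {Y : OverR k}

/-- `c(α) c(β)⁻¹ x₀` -/
def hh {R : Type} [CommRing R] [Algebra k R] {K : Type} [CommRing K] [Algebra k K] (c : Pt Γ.G K) (x0 : Pt Γ.G k) (α β : K →ₐ[k] R) : Pt Γ.G R :=
  Γ.mul (Γ.mul (c.map α) (Γ.inv (c.map β))) (x0.map (Algebra.ofId k R))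

lemma ofId_map {X : OverR k} {R S : Type} [CommRing R] [Algebra k R] [CommRing S] [Algebra k S] (f : R →ₐ[k] S) (x : Pt X k) :
    (x.map (Algebra.ofId k R)).map f = x.map (Algebra.ofId k S) := by
  rw [Pt.map_map]
  congr 1
  exact Subsingleton.elim _ _

lemma hh_map {R S : Type} [CommRing R] [Algebra k R] [CommRing S] [Algebra k S] {K : Type} [CommRing K] [Algebra k K] (c : Pt Γ.G K) (x0 : Pt Γ.G k) (α β : K →ₐ[k] R)
    (f : R →ₐ[k] S) : (hh Γ c x0 α β).map f = hh Γ c x0 (f.comp α) (f.comp β) := by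
  rw [hh, hh, map_mul_pt, map_mul_pt, map_inv_pt, Pt.map_map, Pt.map_map, ofId_map]

lemma hh_mapP {R S : Type} [CommRing R] [Algebra k R] [CommRing S] [Algebra k S] {K : Type} [CommRing K] [Algebra k K] (c : Pt Γ.G K) (x0 : Pt Γ.G k) (α β : K →ₐ[k] R)
    (f : R →ₐ[k] S) (P : Γ.G ⟶ Y) : Pt.map f (hh Γ c x0 α β ≫ P : Pt Y R) = hh Γ c x0 (f.comp α) (f.comp β) ≫ P := by
  rw [Pt.map_comp, hh_map]

lemma hh_self {R : Type} [CommRing R] [Algebra k R] {K : Type} [CommRing K] [Algebra k K] (c : Pt Γ.G K) (x0 : Pt Γ.G k) (α : K →ₐ[k] R) :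
    hh Γ c x0 α α = x0.map (Algebra.ofId k R) := by
  rw [hh, Γ.mul_inv', Γ.one_mul]

lemma cl_ofId {X : OverR k} {R : Type} [CommRing R] [Algebra k R] [IsLocalRing R] (x : Pt X k) : (x.map (Algebra.ofId k R)).cl = x.cl := by
  have : IsLocalHom (Algebra.ofId k R).toRingHom := ⟨fun a h => by
    refine isUnit_iff_ne_zero.2 fun h0 => ?_
    rw [h0, map_zero] at h
    exact not_isUnit_zero h⟩
  exact cl_map _ x

lemma vl_lim1 (c : Pt Γ.G (LaurentSeries k)) (x0 : Pt Γ.G k) (P : Γ.G ⟶ Y) (θ : Pt Y (PowerSeries (RatFunc k)))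
    (hθ : θ.map (psL k _) = hh Γ c x0 (LQ RatFunc.X RatFunc.X_ne_zero) (LQ 1 one_ne_zero) ≫ P) (x : Pt Y k)
    (hx : θ.map (ccA k _) = x.map (Algebra.ofId k _)) (u : PowerSeries k) (hu0 : u ≠ 0) (hu : u = PowerSeries.X ∨ u = 1 + PowerSeries.X) :
    Lim (hh Γ c x0 (MM u hu0) (MM 1 one_ne_zero) ≫ P : Pt Y (LL k)) x := by
  obtain ⟨g, hg⟩ := exists_ratfunc u hu
  refine ⟨θ.map (mapA g), x.map (Algebra.ofId k _), ?_, ?_, cl_ofId x⟩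
  · let Lg : LaurentSeries (RatFunc k) →ₐ[k] LaurentSeries (LaurentSeries k) := liftQ ((psL k _).comp (mapA g))
      ((psL_injective (k := k) (A := LaurentSeries k)).comp (mapA_injective g g.toRingHom.injective))
    have hL : Lg.comp (psL k _) = (psL k _).comp (mapA g) := liftQ_psL _ _
    have hQ : ∀ (v : RatFunc k) (hv : v ≠ 0) (w : PowerSeries k) (hw : w ≠ 0), g v = psL k k w → Lg.comp (LQ v hv) = sideL.comp (MM w hw) := by
      intro v hv w hw h
      rw [sideL_MM]
      apply laurent_ext
      rw [AlgHom.comp_assoc, LQ_psL, LQ_psL, ← AlgHom.comp_assoc, hL, AlgHom.comp_assoc, mapA_sg, h]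
    rw [Pt.map_map, ← hL, ← Pt.map_map, hθ, hh_mapP, hh_mapP, hQ _ _ u hu0 hg, hQ 1 one_ne_zero 1 one_ne_zero (by rw [map_one, map_one])]
  · rw [Pt.map_map, ccA_mapA, ← Pt.map_map, hx, ofId_map, ofId_map]

lemma vl_lim2 (c : Pt Γ.G (LaurentSeries k)) (x0 : Pt Γ.G k) (P : Γ.G ⟶ Y) (u : PowerSeries k) (hu0 : u ≠ 0) (hu : ccA k k u = 1) :
    Lim (Pt.map swapL (hh Γ c x0 (MM u hu0) (MM 1 one_ne_zero) ≫ P : Pt Y (LL k))) (x0 ≫ P) := by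
  obtain ⟨ρ, h1, h2⟩ := exists_rho u hu
  refine ⟨hh Γ c x0 ρ (CA k _) ≫ P, Pt.map (Algebra.ofId k _) (x0 ≫ P : Pt Y k), ?_, ?_, cl_ofId _⟩
  · rw [Pt.map_map, hh_mapP, hh_mapP]
    change _ = hh Γ c x0 (SW u hu0) (SW 1 one_ne_zero) ≫ P
    rw [SW_one]
    congr 2
    apply laurent_ext
    rw [SW_psL, AlgHom.comp_assoc, h1]
  · rw [hh_mapP, h2, ccA_CA, hh_self, ofId_map, Pt.map_comp]

lemma vl_chart [IsAlgClosed k] (hY : Good Y) (c : Pt Γ.G (LaurentSeries k)) (x0 : Pt Γ.G k) (P : Γ.G ⟶ Y)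
    {B : Type} [CommRing B] [Algebra k B] (j : SO k B ⟶ Y) [IsOpenImmersion j.left] (hx0 : Pt.cl (x0 ≫ P : Pt Y k) ∈ Set.range j.left) :
    ∃ z : B →ₐ[k] PowerSeries (LaurentSeries k), Pt.map (psL k _) (SOmap z ≫ j : Pt Y _) =
      hh Γ c x0 (SW PowerSeries.X PowerSeries.X_ne_zero) ((psL k _).comp (CA k _)) ≫ P := by
  have := hY.1
  obtain ⟨θ, hθ⟩ := extend_ps (hh Γ c x0 (LQ RatFunc.X RatFunc.X_ne_zero) (LQ 1 one_ne_zero) ≫ P : Pt Y (LaurentSeries (RatFunc k)))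
  obtain ⟨x, hx⟩ := hY.2 (θ.map (ccA k _))
  have hcc : ccA k k (1 + PowerSeries.X) = 1 := by
    change PowerSeries.constantCoeff (1 + PowerSeries.X) = 1
    simp
  have hne : (1 + PowerSeries.X : PowerSeries k) ≠ 0 := fun h => by
    rw [h, map_zero] at hcc
    exact zero_ne_one hcc
  have hxx : x = x0 ≫ P := lemmaS hY.2 (vl_lim1 Γ c x0 P θ hθ x hx _ hne (Or.inr rfl)) (vl_lim2 Γ c x0 P _ hne hcc)
  have hl := vl_lim1 Γ c x0 P θ hθ x hx _ PowerSeries.X_ne_zero (Or.inl rfl)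
  obtain ⟨y2, h2⟩ := extend_ps (hh Γ c x0 (SW PowerSeries.X PowerSeries.X_ne_zero) (SW 1 one_ne_zero) ≫ P : Pt Y _)
  obtain ⟨e2, he⟩ := extend_ps (y2.map (ccA k _))
  have hl2 : Lim (Pt.map swapL (hh Γ c x0 (MM PowerSeries.X PowerSeries.X_ne_zero) (MM 1 one_ne_zero) ≫ P : Pt Y (LL k))) (e2.map (ccA k _)) := by
    refine ⟨y2, e2, ?_, he.symm, (cl_ccA e2).symm⟩
    rw [h2, Pt.map_map, hh_mapP]
    rfl
  have h3 := lemmaS hY.2 hl hl2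
  rw [hxx] at h3
  have h4 : e2.cl ∈ Set.range j.left := by
    rw [← cl_ccA e2, ← h3]
    exact hx0
  have h5 : y2.cl ∈ Set.range j.left := by
    rw [← cl_ccA y2, ← he]
    exact range_subset_of_cl e2 _ j.left.isOpenEmbedding.isOpen_range h4 ⟨(SOmap (psL k k)).left (IsLocalRing.closedPoint _), rfl⟩
  obtain ⟨z, hz⟩ := liftChart_local j y2 h5
  refine ⟨SOpre z, ?_⟩
  rw [SOmap_SOpre, hz, h2, SW_one]

lemma dom_chart {G : OverR k} (P : G ⟶ Y) [AlgebraicGeometry.IsIntegral G.left] (hP : IsDominant P.left)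
    {B C : Type} [CommRing B] [IsDomain B] [Algebra k B] [CommRing C] [Nontrivial C] [Algebra k C] (j : SO k B ⟶ Y) [IsOpenImmersion j.left]
    (jM : SO k C ⟶ G) [IsOpenImmersion jM.left] (ι : B →ₐ[k] C) (h : jM ≫ P = SOmap ι ≫ j) : Function.Injective ι := by
  rw [injective_iff_map_eq_zero]
  intro b hb
  by_contra hb0
  let U : Set Y.left := j.left '' (PrimeSpectrum.basicOpen b : Set (PrimeSpectrum B))
  have hU : IsOpen U := j.left.isOpenEmbedding.isOpenMap _ (PrimeSpectrum.basicOpen b).isOpen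
  have hUn : U.Nonempty := by
    refine Set.Nonempty.image _ ⟨(⟨⊥, Ideal.isPrime_bot⟩ : PrimeSpectrum B), ?_⟩
    change b ∉ (⊥ : Ideal B)
    exact hb0
  obtain ⟨y, hy⟩ := hP.1.inter_open_nonempty U hU hUn
  obtain ⟨hyU, ⟨g, rfl⟩⟩ := hy
  have hn : (Set.range jM.left).Nonempty := by
    have h1 : Nonempty (SO k C).left := inferInstanceAs (Nonempty (PrimeSpectrum C))
    exact Set.range_nonempty _
  have hirr : PreirreducibleSpace G.left := inferInstance
  obtain ⟨_, hz1, ⟨z, rfl⟩⟩ := nonempty_preirreducible_inter (hU.preimage P.left.continuous) jM.left.isOpenEmbedding.isOpen_range ⟨g, hyU⟩ hn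
  have hz2 : j.left ((SOmap ι).left z) ∈ U := by
    have h1 : P.left (jM.left z) = j.left ((SOmap ι).left z) := congr(($h).left z)
    rw [← h1]
    exact hz1
  obtain ⟨w, hw, hwz⟩ := hz2
  have hw2 : w = (SOmap ι).left z := j.left.isOpenEmbedding.injective hwz
  rw [hw2] at hw
  apply hw
  change ι b ∈ (z : PrimeSpectrum C).asIdeal
  rw [hb]
  exact zero_mem _

lemma mult_alg {B C : Type} [CommRing B] [IsDomain B] [Algebra k B] [CommRing C] [Algebra k C] (ι : B →ₐ[k] C) (hι : Function.Injective ι)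
    [Algebra.FiniteType k C] : ∃ (b : B) (_ : b ≠ 0) (D : Type) (_ : CommRing D) (_ : Algebra k D) (i : Localization.Away b →ₐ[k] D) (_ : Function.Injective i)
      (_ : i.toRingHom.IsIntegral) (γ : C →ₐ[k] D), γ.comp ι = i.comp (IsScalarTower.toAlgHom k B (Localization.Away b)) := by
  let _ : Algebra B C := ι.toRingHom.toAlgebra
  have : IsScalarTower k B C := IsScalarTower.of_algebraMap_eq fun c => (ι.commutes c).symm
  have : Algebra.FiniteType B C := Algebra.FiniteType.of_restrictScalars_finiteType k B C
  obtain ⟨b, hb, D, _, _, _, _, _, h1, h2, ⟨γ⟩⟩ := multisection B C hι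
  let _ : Algebra k D := ((algebraMap B D).comp (algebraMap k B)).toAlgebra
  have h3 : IsScalarTower k B D := IsScalarTower.of_algebraMap_eq fun c => rfl
  have h4 : IsScalarTower k (Localization.Away b) D := IsScalarTower.of_algebraMap_eq fun c => by
    rw [IsScalarTower.algebraMap_apply k B (Localization.Away b), ← IsScalarTower.algebraMap_apply B (Localization.Away b) D]
    rfl
  refine ⟨b, hb, D, _, _, IsScalarTower.toAlgHom k (Localization.Away b) D, h1, h2.1, γ.restrictScalars k, ?_⟩
  ext1 x
  refine (γ.commutes x).trans ?_
  exact IsScalarTower.algebraMap_apply B (Localization.Away b) D x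

/-- a quasi-finite affine cover of an open of the target, mapping to the source -/
lemma mult_chart {G : OverR k} (P : G ⟶ Y) (hY : AlgebraicGeometry.IsIntegral Y.left) [LocallyOfFiniteType G.hom] [LocallyOfFiniteType Y.hom]
    [AlgebraicGeometry.IsIntegral G.left] (hP : IsDominant P.left) : 
    ∃ (B D : Type) (_ : CommRing B) (_ : IsDomain B) (_ : Algebra k B) (_ : CommRing D) (_ : Algebra k D) (j : SO k B ⟶ Y) (_ : IsOpenImmersion j.left)
      (i : B →ₐ[k] D) (_ : Function.Injective i) (_ : i.toRingHom.IsIntegral) (jD : SO k D ⟶ G), jD ≫ P = SOmap i ≫ j := by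
  obtain ⟨g⟩ : Nonempty G.left := inferInstance
  obtain ⟨B, _, _, j, hj, hjP⟩ := exists_chart Y (P.left g)
  have := chart_nontrivial j hjP
  have := chart_domain j
  obtain ⟨C, _, _, jM, ι, hjM, hg, hc⟩ := exists_chart_map P j g hjP
  have := chart_nontrivial jM hg
  have := chart_finiteType jM
  obtain ⟨b, hb, D, _, _, i, hi, hintg, γ, hγ⟩ := mult_alg ι (dom_chart P hP j jM ι hc)
  have h1 : IsOpenImmersion (SOmap (IsScalarTower.toAlgHom k B (Localization.Away b))).left :=
    inferInstanceAs (IsOpenImmersion (Spec.map (CommRingCat.ofHom (algebraMap B (Localization.Away b)))))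
  refine ⟨Localization.Away b, D, _, IsLocalization.isDomain_localization (powers_le_nonZeroDivisors_of_noZeroDivisors hb), _, _, _,
    SOmap (IsScalarTower.toAlgHom k B (Localization.Away b)) ≫ j, inferInstanceAs (IsOpenImmersion ((SOmap (IsScalarTower.toAlgHom k B (Localization.Away b))).left ≫ j.left)),
    i, hi, hintg, SOmap γ ≫ jM, ?_⟩
  rw [Category.assoc, hc, ← Category.assoc, ← Category.assoc, ← SOmap_comp, ← SOmap_comp, hγ]

end P20

section P21
variable {k : Type} [Field k] (Γ : GroupScheme k) {Y : OverR k}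

lemma exists_frac (R : Type) [CommRing R] [IsDomain R] [Algebra k R] :
    ∃ (F : Type) (_ : Field F) (_ : Algebra k F) (ε : R →ₐ[k] F), Function.Injective ε :=
  ⟨FractionRing R, inferInstance, inferInstance, IsScalarTower.toAlgHom k R _, IsFractionRing.injective R _⟩

set_option maxHeartbeats 1000000 in
lemma vl [IsAlgClosed k] [LocallyOfFiniteType Γ.G.hom] [AlgebraicGeometry.IsIntegral Γ.G.left] {P : Γ.G ⟶ Y} (hP : MinG P)
    (c : Pt Γ.G (LaurentSeries k)) (e : Pt Y (PowerSeries k)) (he : e.map (psL k k) = c ≫ P) :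
    ∃ (R : Type) (_ : CommRing R) (_ : IsDomain R) (_ : ValuationRing R) (_ : Algebra k R) (ψ : PowerSeries k →ₐ[k] R) (_ : Function.Injective ψ)
      (_ : IsLocalHom ψ.toRingHom) (y : Pt Γ.G R), y ≫ P = e.map ψ := by
  have hY := hP.good
  have := hY.1
  have := hP.int
  obtain ⟨B, D, _, _, _, _, _, j, hj, i, hi, hintg, jD, hjD⟩ := mult_chart P hP.int hP.dom
  obtain ⟨x0, hx0⟩ := jac_pt (W := Γ.G) (P.left ⁻¹' Set.range j.left) (j.left.isOpenEmbedding.isOpen_range.preimage P.left.continuous).isLocallyClosed (by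
    have : Nontrivial D := hi.nontrivial
    obtain ⟨z⟩ : Nonempty (SO k D).left := inferInstanceAs (Nonempty (PrimeSpectrum D))
    refine ⟨jD.left z, ⟨(SOmap i).left z, ?_⟩⟩
    exact congr(($hjD).left z).symm)
  have hx0' : Pt.cl (x0 ≫ P : Pt Y k) ∈ Set.range j.left := by rw [cl_comp]; exact hx0
  obtain ⟨z, hz⟩ := vl_chart Γ hY c x0 P j hx0'
  obtain ⟨R, _, _, _, _, η, hη, hηl, δ, hδ⟩ := int_lift B D (PowerSeries (LaurentSeries k)) i hi hintg z
  have hXl : ccA k k PowerSeries.X = 0 := PowerSeries.constantCoeff_X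
  have hsl := sw_local (k := k) PowerSeries.X hXl
  obtain ⟨g2, hg2⟩ : ∃ g2 : Pt Γ.G R, g2 = SOmap δ ≫ jD := ⟨_, rfl⟩
  have hg2P : g2 ≫ P = Pt.map η (SOmap z ≫ j : Pt Y _) := by
    rw [hg2, Category.assoc, hjD, ← Category.assoc, ← SOmap_comp, hδ, SOmap_comp, Category.assoc]
    rfl
  let τ : Pt Γ.G R := Γ.mul (Γ.inv (x0.map (Algebra.ofId k R))) (c.map (η.comp (CA k _)))
  have hinj : Function.Injective (η.comp (sw PowerSeries.X)) := by
    rw [AlgHom.coe_comp]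
    exact hη.comp (sw_injective _ PowerSeries.X_ne_zero)
  have hloc : IsLocalHom (η.comp (sw PowerSeries.X)).toRingHom := RingHom.isLocalHom_comp η.toRingHom (sw PowerSeries.X).toRingHom
  refine ⟨R, _, ‹_›, ‹_›, _, η.comp (sw PowerSeries.X), hinj, hloc, Γ.mul g2 τ, ?_⟩
  obtain ⟨F, _, _, ε, hε⟩ := exists_frac (k := k) R
  obtain ⟨lam, hlam⟩ : ∃ lam : LaurentSeries (LaurentSeries k) →ₐ[k] F, lam.comp (psL k _) = ε.comp η := ⟨_, liftQ_psL (ε.comp η) (hε.comp hη)⟩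
  apply Pt.map_injective ε hε
  have h1 : g2.map ε ≫ P = hh Γ c x0 (lam.comp (SW PowerSeries.X PowerSeries.X_ne_zero)) ((ε.comp η).comp (CA k _)) ≫ P := by
    rw [← Pt.map_comp, hg2P, Pt.map_map, ← hlam, ← Pt.map_map, hz, hh_mapP]
    rfl
  let Fm : prodO Γ.G Γ.G ⟶ Y := liftO (sndO Γ.G Γ.G) (fstO Γ.G Γ.G) ≫ Γ.m ≫ P
  have hFm : ∀ (a b : Pt Γ.G F), liftO a b ≫ Fm = Γ.mul b a ≫ P := by
    intro a b
    rw [← Category.assoc, comp_liftO, liftO_fst, liftO_snd, ← Category.assoc, GroupScheme.liftO_m]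
  have h2 := hP.min.param (Q := Y) inferInstance hY Fm (τ.map ε) _ _ h1
  rw [hFm, hFm] at h2
  rw [Pt.map_comp, map_mul_pt, h2, hh, map_mul_pt, map_inv_pt, ofId_map, Pt.map_map]
  have h3 : ∀ (a b x : Pt Γ.G F), Γ.mul (Γ.mul (Γ.mul a (Γ.inv b)) x) (Γ.mul (Γ.inv x) b) = a := by
    intro a b x
    let := Γ.grp (SO k F)
    change a * b⁻¹ * x * (x⁻¹ * b) = a
    group
  have h4 : ε.comp (η.comp (CA k (LaurentSeries k))) = (ε.comp η).comp (CA k _) := rfl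
  rw [h4, h3, ← Pt.map_comp, ← he, Pt.map_map, Pt.map_map, AlgHom.comp_assoc, SW_psL, ← AlgHom.comp_assoc, hlam]
  rfl

end P21

section P22
variable {k : Type} [Field k] (Γ : GroupScheme k) {Y : OverR k}

lemma residue_factor {R : Type} [CommRing R] [IsLocalRing R] [Algebra k R] (ψ : PowerSeries k →ₐ[k] R) [hl : IsLocalHom ψ.toRingHom] :
    (IsScalarTower.toAlgHom k R (IsLocalRing.ResidueField R)).comp ψ = (Algebra.ofId k _).comp (ccA k k) := by
  ext1 f
  change IsLocalRing.residue R (ψ f) = algebraMap k _ (ccA k k f)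
  have h1 : IsLocalRing.residue R (ψ (f - algebraMap k _ (ccA k k f))) = 0 := by
    rw [IsLocalRing.residue_eq_zero_iff, IsLocalRing.mem_maximalIdeal]
    intro h
    have h2 := hl.map_nonunit _ h
    rw [PowerSeries.isUnit_iff_constantCoeff, isUnit_iff_ne_zero] at h2
    apply h2
    change ccA k k _ = 0
    rw [map_sub, AlgHom.commutes]
    exact sub_self _
  rw [map_sub, AlgHom.commutes, map_sub, sub_eq_zero] at h1
  exact h1

/-- the closed fibre of a point over a local ring -/
lemma cl_residue {X : OverR k} {R : Type} [CommRing R] [IsLocalRing R] [Algebra k R] (y : Pt X R) :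
    (y.map (IsScalarTower.toAlgHom k R (IsLocalRing.ResidueField R))).cl = y.cl := by
  have : IsLocalHom (IsScalarTower.toAlgHom k R (IsLocalRing.ResidueField R)).toRingHom :=
    inferInstanceAs (IsLocalHom (IsLocalRing.residue R))
  exact cl_map _ y

lemma exists_lift_pt [IsAlgClosed k] {G : OverR k} [LocallyOfFiniteType G.hom] [LocallyOfFiniteType Y.hom] (P : G ⟶ Y) (y : Pt Y k) {κ : Type} [Field κ] [Algebra k κ]
    (z : Pt G κ) (h : z ≫ P = y.map (Algebra.ofId k κ)) : ∃ x : Pt G k, x ≫ P = y := by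
  obtain ⟨x, hx⟩ := jac_pt (W := G) (P.left ⁻¹' {y.cl}) ((kpt_closed y).preimage P.left.continuous).isLocallyClosed ⟨z.cl, by
    change P.left z.cl = y.cl
    rw [← cl_comp, h, cl_ofId]⟩
  refine ⟨x, kpt_ext ?_⟩
  rw [cl_comp]
  exact hx

lemma param_lim [IsAlgClosed k] [LocallyOfFiniteType Γ.G.hom] [AlgebraicGeometry.IsIntegral Γ.G.left] {P : Γ.G ⟶ Y} (hP : MinG P)
    {T Q : OverR k} [LocallyOfFiniteType T.hom] (hQ : Good Q) (F : prodO T Γ.G ⟶ Q) (c : Pt (prodO T Γ.G) (LaurentSeries k))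
    (eT : Pt T (PowerSeries k)) (heT : eT.map (psL k k) = c ≫ fstO _ _) (eY : Pt Y (PowerSeries k)) (heY : eY.map (psL k k) = (c ≫ sndO _ _) ≫ P)
    (q : Pt Q (PowerSeries k)) (hq : q.map (psL k k) = c ≫ F) :
    (∃ x1 : Pt Γ.G k, x1 ≫ P = eY.map (ccA k k)) ∧ ∀ x1 : Pt Γ.G k, x1 ≫ P = eY.map (ccA k k) → q.cl = Pt.cl (liftO (eT.map (ccA k k)) x1 ≫ F : Pt Q k) := by
  have hY := hP.good
  have := hY.1
  have := hQ.1
  obtain ⟨R, _, _, _, _, ψ, hψ, hψl, y, hy⟩ := vl Γ hP (c ≫ sndO _ _) eY heY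
  obtain ⟨F', _, _, ε, hε⟩ := exists_frac (k := k) R
  obtain ⟨lam, hlam⟩ : ∃ lam : LaurentSeries k →ₐ[k] F', lam.comp (psL k _) = ε.comp ψ := ⟨_, liftQ_psL (ε.comp ψ) (hε.comp hψ)⟩
  have h1 : q.map ψ = liftO (eT.map ψ) y ≫ F := by
    apply Pt.map_injective ε hε
    have h2 : Pt.map ε (liftO (eT.map ψ) y ≫ F : Pt Q R) = liftO ((eT.map ψ).map ε) (y.map ε) ≫ F := by
      rw [Pt.map_comp]
      congr 1
      exact comp_liftO _ _ _
    have h3 : c.map lam = liftO ((eT.map ψ).map ε) (Pt.map lam (c ≫ sndO _ _ : Pt Γ.G _)) := by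
      rw [Pt.map_map, ← hlam, ← Pt.map_map, heT, ← liftO_eta (c.map lam), Pt.map_comp, Pt.map_comp]
    rw [h2, Pt.map_map, ← hlam, ← Pt.map_map, hq, Pt.map_comp, h3]
    refine hP.min.param inferInstance hQ F _ _ _ ?_
    rw [← Pt.map_comp, ← heY, Pt.map_map, hlam, ← Pt.map_map, ← hy, Pt.map_comp]
  let π := IsScalarTower.toAlgHom k R (IsLocalRing.ResidueField R)
  have hπ : π.comp ψ = (Algebra.ofId k _).comp (ccA k k) := residue_factor ψ
  have h4 : y.map π ≫ P = (eY.map (ccA k k)).map (Algebra.ofId k _) := by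
    rw [← Pt.map_comp, hy, Pt.map_map, hπ, Pt.map_map]
  refine ⟨exists_lift_pt P _ _ h4, fun x1 hx1 => ?_⟩
  have h5 : q.cl = Pt.cl (Pt.map π (liftO (eT.map ψ) y ≫ F : Pt Q R)) := by
    rw [← h1, cl_residue, cl_map]
  have h6 : Pt.map π (liftO (eT.map ψ) y ≫ F : Pt Q R) = Pt.map (Algebra.ofId k _) (liftO (eT.map (ccA k k)) x1 ≫ F : Pt Q k) := by
    have h2 : Pt.map π (liftO (eT.map ψ) y ≫ F : Pt Q R) = liftO ((eT.map ψ).map π) (y.map π) ≫ F := by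
      rw [Pt.map_comp]
      congr 1
      exact comp_liftO _ _ _
    have h3 : Pt.map (Algebra.ofId k (IsLocalRing.ResidueField R)) (liftO (eT.map (ccA k k)) x1 ≫ F : Pt Q k) =
        liftO ((eT.map (ccA k k)).map (Algebra.ofId k _)) (x1.map (Algebra.ofId k _)) ≫ F := by
      rw [Pt.map_comp]
      congr 1
      exact comp_liftO _ _ _
    rw [h2, h3, Pt.map_map, hπ, ← Pt.map_map]
    refine hP.min.param inferInstance hQ F _ _ _ ?_
    rw [h4, ← hx1, Pt.map_comp]
  rw [h5, h6, cl_ofId]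

/-- the base change of `P` -/
def bc {G : OverR k} (T : OverR k) (P : G ⟶ Y) : prodO T G ⟶ prodO T Y := liftO (fstO T G) (sndO T G ≫ P)

lemma bc_fst {G : OverR k} (T : OverR k) (P : G ⟶ Y) : bc T P ≫ fstO T Y = fstO T G := liftO_fst _ _
lemma bc_snd {G : OverR k} (T : OverR k) (P : G ⟶ Y) : bc T P ≫ sndO T Y = sndO T G ≫ P := liftO_snd _ _

lemma bc_sameLim [IsAlgClosed k] [LocallyOfFiniteType Γ.G.hom] [AlgebraicGeometry.IsIntegral Γ.G.left] {P : Γ.G ⟶ Y} (hP : MinG P)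
    {T Q : OverR k} [LocallyOfFiniteType T.hom] (hQ : Good Q) (F : prodO T Γ.G ⟶ Q) : SameLim (bc T P) F := by
  have := hP.good.1
  have : LocallyOfFiniteType (prodO T Y).hom := prodO_lft
  have key : ∀ (c : Pt (prodO T Γ.G) (LaurentSeries k)) (e : Pt (prodO T Y) (PowerSeries k)), e.map (psL k k) = c ≫ bc T P →
      Pt.map (psL k k) (e ≫ fstO _ _ : Pt T _) = c ≫ fstO _ _ ∧ Pt.map (psL k k) (e ≫ sndO _ _ : Pt Y _) = (c ≫ sndO _ _) ≫ P := by
    intro c e h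
    rw [Pt.map_comp, Pt.map_comp, h, Category.assoc, Category.assoc, Category.assoc, bc_fst, bc_snd]
    exact ⟨rfl, rfl⟩
  intro c c' e e' q q' h h' hee hq hq'
  obtain ⟨a1, a2⟩ := key c e h
  obtain ⟨b1, b2⟩ := key c' e' h'
  have h0 : e.map (ccA k k) = e'.map (ccA k k) := kpt_ext (by rw [cl_ccA, cl_ccA, hee])
  obtain ⟨⟨x1, hx1⟩, H⟩ := param_lim Γ hP hQ F c _ a1 _ a2 q hq
  obtain ⟨-, H'⟩ := param_lim Γ hP hQ F c' _ b1 _ b2 q' hq'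
  rw [H x1 hx1, H' x1 (by rw [hx1, Pt.map_comp, Pt.map_comp, h0]), Pt.map_comp, Pt.map_comp, h0]

lemma minG_surj [IsAlgClosed k] [CharZero k] [LocallyOfFiniteType Γ.G.hom] [AlgebraicGeometry.IsIntegral Γ.G.left] {P : Γ.G ⟶ Y} (hP : MinG P) (y : Pt Y k) :
    ∃ x : Pt Γ.G k, x ≫ P = y := by
  have := hP.good.1
  obtain ⟨c, e, he, hcl⟩ := arc P y (by rw [hP.dom.1.closure_range]; trivial)
  obtain ⟨R, _, _, _, _, ψ, hψ, hψl, z, hz⟩ := vl Γ hP c e he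
  have h0 : e.map (ccA k k) = y := kpt_ext (by rw [cl_ccA, hcl])
  refine exists_lift_pt P y (z.map (IsScalarTower.toAlgHom k R (IsLocalRing.ResidueField R))) ?_
  rw [← Pt.map_comp, hz, Pt.map_map, residue_factor, ← Pt.map_map, h0]

end P22

section P23
variable {k : Type} [Field k]

lemma intclos_finite_gen [CharZero k] (B E C : Type) [CommRing B] [IsDomain B] [Algebra k B] [Algebra.FiniteType k B]
    [CommRing E] [Algebra B E] [CommRing C] [IsDomain C] [Algebra B C] [Algebra.FiniteType B C]
    (hi : Function.Injective (algebraMap B C)) (r : E →ₐ[B] C) (hr : Function.Injective r) :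
    Module.Finite B (integralClosure B E) := by
  obtain ⟨κ, _, _, _, _, hfin, ⟨γ⟩⟩ := quasi_section B C hi
  have hBκ : Function.Injective (algebraMap B κ) := by
    rw [IsScalarTower.algebraMap_eq B (FractionRing B) κ]
    exact (algebraMap (FractionRing B) κ).injective.comp (IsFractionRing.injective _ _)
  have h1 := intclos_finite (k := k) B (FractionRing B) κ
  have : IsNoetherianRing B := Algebra.FiniteType.isNoetherianRing k B
  let φ : integralClosure B E →ₗ[B] integralClosure B κ :=
    { toFun := fun x => ⟨γ (r x.1), (x.2.map r).map γ⟩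
      map_add' := fun x y => by ext; simp
      map_smul' := fun b x => by ext; simp }
  refine Module.Finite.of_injective φ ?_
  rw [injective_iff_map_eq_zero]
  intro x hx
  by_contra hne
  have hrx : r x.1 ≠ 0 := by
    intro h
    exact hne (Subtype.ext (hr (by rw [h, ZeroMemClass.coe_zero, map_zero])))
  have hintg : IsIntegral B (r x.1) := x.2.map r
  have : Nontrivial B := inferInstance
  obtain ⟨b, hb, d, hd⟩ := hintg.isAlgebraic.exists_nonzero_dvd (mem_nonZeroDivisors_of_ne_zero hrx)
  have h2 : γ (r x.1) = 0 := congrArg Subtype.val hx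
  apply hb
  apply hBκ
  rw [map_zero, ← γ.commutes, hd, map_mul, h2, zero_mul]

lemma affine_finiteType {Y : OverR k} [LocallyOfFiniteType Y.hom] {U : Y.left.Opens} (hU : IsAffineOpen U) :
    ∃ _ : Algebra k Γ(Y.left, U), Algebra.FiniteType k Γ(Y.left, U) := by
  have h : LocallyOfFiniteType (hU.fromSpec ≫ Y.hom) := inferInstance
  obtain ⟨φ, hφ⟩ := Spec.map_surjective (hU.fromSpec ≫ Y.hom)
  rw [← hφ, HasRingHomProperty.Spec_iff (P := @LocallyOfFiniteType)] at h
  let : Algebra k Γ(Y.left, U) := φ.hom.toAlgebra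
  exact ⟨this, h⟩

lemma norm_finite [CharZero k] {G Y : OverR k} [LocallyOfFiniteType Y.hom] [LocallyOfFiniteType G.hom]
    [AlgebraicGeometry.IsIntegral G.left] [AlgebraicGeometry.IsIntegral Y.left] (P : G ⟶ Y) [IsDominant P.left]
    [QuasiCompact P.left] [QuasiSeparated P.left] : IsFinite P.left.fromNormalization := by
  have hlft : LocallyOfFiniteType P.left := by
    have : LocallyOfFiniteType (P.left ≫ Y.hom) := by rw [Over.w]; infer_instance
    exact locallyOfFiniteType_of_comp P.left Y.hom
  constructor
  intro U hU
  rw [Scheme.Hom.fromNormalization_app _ hU]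
  let : Algebra Γ(Y.left, U) Γ(G.left, P.left ⁻¹ᵁ U) := (P.left.app U).hom.toAlgebra
  rw [CommRingCat.hom_comp]
  refine RingHom.Finite.comp (RingHom.Finite.of_surjective _ (ConcreteCategory.bijective_of_isIso (P.left.normalizationObjIso hU).inv).2) ?_
  rw [CommRingCat.hom_ofHom, RingHom.finite_algebraMap]
  by_cases hne : Nonempty U
  · obtain ⟨u, hu⟩ := hne
    have hUne : Nonempty U := ⟨⟨u, hu⟩⟩
    obtain ⟨g, hg⟩ := P.left.denseRange.exists_mem_open U.2 ⟨u, hu⟩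
    obtain ⟨_, ⟨W, hW, rfl⟩, hgW, hWU⟩ := G.left.isBasis_affineOpens.exists_subset_of_mem_open
      (show g ∈ (P.left ⁻¹ᵁ U : G.left.Opens) from hg) (P.left ⁻¹ᵁ U).2
    have hWU : W ≤ P.left ⁻¹ᵁ U := hWU
    have : Nonempty W := ⟨⟨g, hgW⟩⟩
    have : Nonempty (P.left ⁻¹ᵁ U : G.left.Opens) := ⟨⟨g, hg⟩⟩
    obtain ⟨_, hft⟩ := affine_finiteType hU
    have h1 := P.left.finiteType_appLE hU hW hWU
    let : Algebra Γ(Y.left, U) Γ(G.left, W) := (P.left.appLE U W hWU).hom.toAlgebra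
    have h2 : Algebra.FiniteType Γ(Y.left, U) Γ(G.left, W) := h1
    have hres : Function.Injective (G.left.presheaf.map (homOfLE hWU).op) := map_injective_of_isIntegral _ _
    have : IsSchemeTheoreticallyDominant P.left := .of_isDominant _
    have happ := P.left.app_injective U
    refine intclos_finite_gen (k := k) Γ(Y.left, U) Γ(G.left, P.left ⁻¹ᵁ U) Γ(G.left, W) ?_
      { toRingHom := (G.left.presheaf.map (homOfLE hWU).op).hom, commutes' := fun b => rfl } hres
    exact hres.comp happ
  · have hb : U = ⊥ := by
      ext x; exact ⟨fun h => (hne ⟨⟨x, h⟩⟩).elim, fun h => h.elim⟩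
    subst hb
    have : Subsingleton Γ(Y.left, ⊥) := inferInstance
    have : Subsingleton (integralClosure Γ(Y.left, ⊥) Γ(G.left, P.left ⁻¹ᵁ ⊥)) := Module.subsingleton Γ(Y.left, ⊥) _
    infer_instance

/-- the relative normalization over `k` -/
def nmA {G Y : OverR k} (P : G ⟶ Y) [QuasiCompact P.left] [QuasiSeparated P.left] : OverR k :=
  Over.mk (P.left.fromNormalization ≫ Y.hom)

def nmTo {G Y : OverR k} (P : G ⟶ Y) [QuasiCompact P.left] [QuasiSeparated P.left] : G ⟶ nmA P :=
  Over.homMk P.left.toNormalization ((P.left.toNormalization_fromNormalization_assoc _).trans (Over.w P))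

def nmFr {G Y : OverR k} (P : G ⟶ Y) [QuasiCompact P.left] [QuasiSeparated P.left] : nmA P ⟶ Y :=
  Over.homMk P.left.fromNormalization rfl

lemma nm_fac {G Y : OverR k} (P : G ⟶ Y) [QuasiCompact P.left] [QuasiSeparated P.left] : nmTo P ≫ nmFr P = P := by
  ext1; exact P.left.toNormalization_fromNormalization

lemma nm_minG [IsAlgClosed k] [CharZero k] {G Y : OverR k} [LocallyOfFiniteType G.hom]
    [AlgebraicGeometry.IsIntegral G.left] (P : G ⟶ Y) [QuasiCompact P.left] [QuasiSeparated P.left] (hP : MinG P) :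
    MinG (nmTo P) := by
  have := hP.good.1
  have := hP.int
  have := hP.dom
  have hf : IsFinite (nmFr P).left := norm_finite P
  refine ⟨hP.good.finite (nmFr P), inferInstanceAs (AlgebraicGeometry.IsIntegral P.left.normalization),
    inferInstanceAs (IsDominant P.left.toNormalization), fun Q hQ f a b hab => hP.min Q hQ f a b ?_⟩
  rw [← nm_fac P, ← Category.assoc, hab, Category.assoc]

end P23

section P24
variable {k : Type} [Field k] {Y : OverR k}

lemma SameLim.precomp {M M' B Q : OverR k} {b : M ⟶ B} {f : M ⟶ Q} (h : SameLim b f) (e : M' ⟶ M) :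
    SameLim (e ≫ b) (e ≫ f) := by
  intro c c' x x' q q' h1 h2 h3 h4 h5
  exact h (c ≫ e) (c' ≫ e) x x' q q' (h1.trans (Category.assoc _ _ _).symm) (h2.trans (Category.assoc _ _ _).symm) h3
    (h4.trans (Category.assoc _ _ _).symm) (h5.trans (Category.assoc _ _ _).symm)

lemma bc_comp {G Z : OverR k} (T : OverR k) (P : G ⟶ Y) (Q : Y ⟶ Z) : bc T P ≫ bc T Q = bc T (P ≫ Q) := by
  apply prodO_ext
  · rw [Category.assoc, bc_fst, bc_fst, bc_fst]
  · rw [Category.assoc, bc_snd, ← Category.assoc, bc_snd, bc_snd, Category.assoc]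

lemma prod_integral {X Y : OverR k} [IsAlgClosed k] [LocallyOfFiniteType X.hom] [LocallyOfFiniteType Y.hom]
    [AlgebraicGeometry.IsIntegral X.left] [AlgebraicGeometry.IsIntegral Y.left] : AlgebraicGeometry.IsIntegral (prodO X Y).left := by
  have : IsReduced (prodO X Y).left := prod_reduced
  have : IrreducibleSpace (prodO X Y).left := prod_irreducible
  exact isIntegral_of_irreducibleSpace_of_isReduced _

lemma norm_pull_fac {X S Y Q C Z : Scheme.{0}} (f : X ⟶ S) [QuasiCompact f] [QuasiSeparated f] (g : Y ⟶ S) [Smooth g]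
    (D : (pullback.snd f g).normalization ⟶ Q) (u : Z ⟶ f.normalization) (v : Z ⟶ Y) (h : u ≫ f.fromNormalization = v ≫ g)
    (q : Q ⟶ C) (y : Y ⟶ C) (hq : D ≫ q = (pullback.snd f g).fromNormalization ≫ y) :
    ∃ F : Z ⟶ Q, F ≫ q = v ≫ y ∧ ∀ (w : pullback f g ⟶ Z), w ≫ u = pullback.fst f g ≫ f.toNormalization →
      w ≫ v = pullback.snd f g → w ≫ F = (pullback.snd f g).toNormalization ≫ D := by
  refine ⟨pullback.lift u v h ≫ inv (f.normalizationPullback g) ≫ D, ?_, fun w h1 h2 => ?_⟩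
  · rw [Category.assoc, Category.assoc, hq, ← f.normalizationPullback_snd g, Category.assoc, IsIso.inv_hom_id_assoc,
      pullback.lift_snd_assoc]
  · have h9 : w ≫ pullback.lift u v h = (pullback.snd f g).toNormalization ≫ f.normalizationPullback g := by
      apply pullback.hom_ext
      · rw [Category.assoc, pullback.lift_fst, Category.assoc, f.toNormalization_normalizationPullback_fst g, h1]
      · rw [Category.assoc, pullback.lift_snd, Category.assoc, f.normalizationPullback_snd g,
          Scheme.Hom.toNormalization_fromNormalization, h2]
    rw [← Category.assoc, h9, Category.assoc, IsIso.hom_inv_id_assoc]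

lemma univ_fac [IsAlgClosed k] [CharZero k] (Γ : GroupScheme k) [LocallyOfFiniteType Γ.G.hom]
    [AlgebraicGeometry.IsIntegral Γ.G.left] {P : Γ.G ⟶ Y} (hP : MinG P) [QuasiCompact P.left] [QuasiSeparated P.left]
    (T : OverR k) [LocallyOfFiniteType T.hom] [AlgebraicGeometry.IsIntegral T.left] [Smooth T.hom]
    {Q : OverR k} (hQ : Good Q) (F : prodO T Γ.G ⟶ Q) : ∃ F' : prodO T (nmA P) ⟶ Q, bc T (nmTo P) ≫ F' = F := by
  have := hP.good.1
  have := hQ.1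
  let g := (sndO T Y).left
  have hg : Smooth g := inferInstanceAs (Smooth (pullback.snd T.hom Y.hom))
  have hwg : g ≫ Y.hom = (prodO T Y).hom := Over.w (sndO T Y)
  let M : OverR k := Over.mk (pullback.snd P.left g ≫ (prodO T Y).hom)
  let b : M ⟶ prodO T Y := Over.homMk (pullback.snd P.left g) rfl
  let s : M ⟶ Γ.G := Over.homMk (pullback.fst P.left g) (by
    rw [← Over.w P]
    refine (Category.assoc _ _ _).symm.trans ?_
    rw [pullback.condition, Category.assoc, hwg]; rfl)
  let e : M ⟶ prodO T Γ.G := liftO (b ≫ fstO T Y) s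
  have hsP : s ≫ P = b ≫ sndO T Y := by
    ext1; exact pullback.condition
  have heb : e ≫ bc T P = b := by
    apply prodO_ext
    · rw [Category.assoc, bc_fst]; exact liftO_fst _ _
    · rw [Category.assoc, bc_snd, ← Category.assoc, show e ≫ sndO _ _ = s from liftO_snd _ _, hsP]
  have h2 : (sndO T Γ.G).left ≫ P.left = (bc T P).left ≫ g := congr(($(bc_snd T P)).left).symm
  let e' : prodO T Γ.G ⟶ M := Over.homMk (pullback.lift (sndO T Γ.G).left (bc T P).left h2) (by
    refine (Category.assoc _ _ _).symm.trans ?_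
    rw [pullback.lift_snd]; exact Over.w (bc T P))
  have he's : e' ≫ s = sndO T Γ.G := by ext1; exact pullback.lift_fst _ _ _
  have he'b : e' ≫ b = bc T P := by ext1; exact pullback.lift_snd _ _ _
  have h3 : e' ≫ e = 𝟙 _ := by
    apply prodO_ext
    · rw [Category.assoc, show e ≫ fstO _ _ = b ≫ fstO T Y from liftO_fst _ _, ← Category.assoc, he'b, bc_fst, Category.id_comp]
    · rw [Category.assoc, show e ≫ sndO _ _ = s from liftO_snd _ _, he's, Category.id_comp]
  have h4 : e ≫ e' = 𝟙 _ := by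
    ext1
    apply pullback.hom_ext
    · have : (e ≫ e') ≫ s = 𝟙 _ ≫ s := by
        rw [Category.assoc, he's, Category.id_comp]; exact liftO_snd _ _
      exact congr(($this).left)
    · have : (e ≫ e') ≫ b = 𝟙 _ ≫ b := by
        rw [Category.assoc, he'b, Category.id_comp, heb]
      exact congr(($this).left)
  have hiso : IsIso e := ⟨e', h4, h3⟩
  have : IsIso e.left := inferInstanceAs (IsIso ((Over.forget _).map e))
  have hTG : AlgebraicGeometry.IsIntegral (prodO T Γ.G).left := prod_integral
  have hlTG : LocallyOfFiniteType (prodO T Γ.G).hom := prodO_lft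
  have hlTY : LocallyOfFiniteType (prodO T Y).hom := prodO_lft
  have hlM : LocallyOfFiniteType M.hom := by rw [← Over.w e]; infer_instance
  have : Nonempty M.left := ⟨e'.left (Nonempty.some inferInstance)⟩
  have hM : AlgebraicGeometry.IsIntegral M.left := isIntegral_of_isOpenImmersion e.left
  have hqc : QuasiCompact b.left := inferInstanceAs (QuasiCompact (pullback.snd P.left g))
  have hqs : QuasiSeparated b.left := inferInstanceAs (QuasiSeparated (pullback.snd P.left g))
  have hSL : SameLim b (e ≫ F) := by
    have := (bc_sameLim Γ hP hQ F).precomp e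
    rwa [heb] at this
  obtain ⟨D, hD1, hD2⟩ := descend b (e ≫ F) hSL
  have h5 : (sndO T (nmA P)).left ≫ P.left.fromNormalization = (bc T (nmFr P)).left ≫ g := congr(($(bc_snd T (nmFr P))).left).symm
  obtain ⟨F', hF1, hF2⟩ := norm_pull_fac P.left g D (sndO T (nmA P)).left (bc T (nmFr P)).left h5 Q.hom (prodO T Y).hom hD2
  refine ⟨Over.homMk F' (hF1.trans (Over.w (bc T (nmFr P)))), ?_⟩
  rw [← cancel_epi e]
  ext1
  have h10 : (e ≫ bc T (nmTo P)) ≫ sndO _ _ = s ≫ nmTo P := by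
    rw [Category.assoc, bc_snd, ← Category.assoc]
    congr 1; exact liftO_snd _ _
  have h11 : (e ≫ bc T (nmTo P)) ≫ bc T (nmFr P) = b := by
    rw [Category.assoc, bc_comp, nm_fac, heb]
  refine Eq.trans ?_ ((hF2 (e ≫ bc T (nmTo P)).left congr(($h10).left) congr(($h11).left)).trans hD1)
  exact (Category.assoc _ _ _).symm

end P24

section P25
variable {k : Type} [Field k]

lemma dominant_of_pts [IsAlgClosed k] {X Y : OverR k} [LocallyOfFiniteType Y.hom] (d : X ⟶ Y)
    (h : ∀ y : Pt Y k, ∃ x : Pt X k, x ≫ d = y) : IsDominant d.left := by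
  refine ⟨?_⟩
  rw [DenseRange, dense_iff_inter_open]
  intro U hU hne
  obtain ⟨p, hp⟩ := jac_pt U hU.isLocallyClosed hne
  obtain ⟨x, rfl⟩ := h p
  exact ⟨_, hp, x.cl, (cl_comp _ _).symm⟩

lemma ext_pts [IsAlgClosed k] {Y C : OverR k} [LocallyOfFiniteType Y.hom] [IsReduced Y.left] [IsSeparated C.hom]
    {f g : Y ⟶ C} (h : ∀ y : Pt Y k, y ≫ f = y ≫ g) : f = g := by
  let E : OverR k := Over.mk (equalizer.ι f.left g.left ≫ Y.hom)
  let d : E ⟶ Y := Over.homMk (equalizer.ι f.left g.left) rfl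
  have hd : IsDominant d.left := dominant_of_pts d (fun y => by
    refine ⟨Over.homMk (equalizer.lift y.left congr(($(h y)).left)) ?_, ?_⟩
    · refine (Category.assoc _ _ _).symm.trans ?_
      rw [equalizer.lift_ι]; exact Over.w y
    · ext1; exact equalizer.lift_ι _ _)
  refine ext_dominant d ?_
  ext1
  exact equalizer.condition _ _

lemma fac_one {G A Q : OverR k} (o : Pt G k) (p : G ⟶ A)
    (hu : ∀ F : prodO G G ⟶ Q, ∃ F' : prodO G A ⟶ Q, bc G p ≫ F' = F) (f : G ⟶ Q) : ∃ f' : A ⟶ Q, p ≫ f' = f := by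
  obtain ⟨F', hF⟩ := hu (sndO G G ≫ f)
  refine ⟨liftO (constO A o) (𝟙 A) ≫ F', ?_⟩
  have h1 : p ≫ liftO (constO A o) (𝟙 A) = liftO (constO G o) (𝟙 G) ≫ bc G p := by
    apply prodO_ext
    · rw [Category.assoc, Category.assoc, liftO_fst, bc_fst, liftO_fst, comp_constO]
    · rw [Category.assoc, Category.assoc, liftO_snd, bc_snd, ← Category.assoc, liftO_snd, Category.id_comp, Category.comp_id]
  rw [← Category.assoc, h1, Category.assoc, hF, ← Category.assoc, liftO_snd, Category.id_comp]

lemma pt_bc {G A T : OverR k} {S : OverR k} (p : G ⟶ A) (t : S ⟶ T) (x : S ⟶ G) : liftO t x ≫ bc T p = liftO t (x ≫ p) := by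
  apply prodO_ext
  · rw [Category.assoc, bc_fst, liftO_fst, liftO_fst]
  · rw [Category.assoc, bc_snd, ← Category.assoc, liftO_snd, liftO_snd]

lemma group_desc [IsAlgClosed k] (Γ : GroupScheme k) [LocallyOfFiniteType Γ.G.hom] [AlgebraicGeometry.IsIntegral Γ.G.left]
    {A : OverR k} [LocallyOfFiniteType A.hom] [IsSeparated A.hom] [AlgebraicGeometry.IsIntegral A.left] (p : Γ.G ⟶ A)
    (hs : ∀ y : Pt A k, ∃ x : Pt Γ.G k, x ≫ p = y)
    (hu : ∀ (T : OverR k) [LocallyOfFiniteType T.hom] [AlgebraicGeometry.IsIntegral T.left] [Smooth T.hom] (F : prodO T Γ.G ⟶ A),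
      ∃ F' : prodO T A ⟶ A, bc T p ≫ F' = F) : ∃ Δ : GroupScheme k, Δ.G = A := by
  have hsm : Smooth Γ.G.hom := homog_smooth Γ.homog
  obtain ⟨F1, hF1⟩ := hu Γ.G (Γ.m ≫ p)
  have hF1' : ∀ x y : Pt Γ.G k, liftO x (y ≫ p) ≫ F1 = Γ.mul x y ≫ p := by
    intro x y
    rw [← pt_bc, Category.assoc, hF1, ← Category.assoc, GroupScheme.liftO_m]
  -- homogeneity
  let τ : Pt Γ.G k → (A ⟶ A) := fun a => liftO (constO A a) (𝟙 A) ≫ F1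
  have hτ : ∀ a x : Pt Γ.G k, (x ≫ p) ≫ τ a = Γ.mul a x ≫ p := by
    intro a x
    have h1 : (x ≫ p) ≫ liftO (constO A a) (𝟙 A) = liftO a (x ≫ p) := by
      rw [comp_liftO, comp_constO, constO_k, Category.comp_id]
    rw [← hF1', ← h1]; exact (Category.assoc _ _ _).symm
  have hττ : ∀ a b : Pt Γ.G k, Γ.mul b a = Γ.one _ → τ a ≫ τ b = 𝟙 A := by
    intro a b hab
    apply ext_pts
    intro y
    obtain ⟨x, rfl⟩ := hs y
    rw [← Category.assoc, hτ, hτ, ← Γ.mul_assoc, hab, Γ.one_mul, Category.comp_id]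
  have hhom : Homog A := by
    intro x y
    obtain ⟨x, rfl⟩ := hs x
    obtain ⟨y, rfl⟩ := hs y
    refine ⟨τ (Γ.mul y (Γ.inv x)), ?_, ?_⟩
    · have : IsIso (τ (Γ.mul y (Γ.inv x))) :=
        ⟨τ (Γ.inv (Γ.mul y (Γ.inv x))), hττ _ _ (Γ.inv_mul _), hττ _ _ (Γ.mul_inv' _)⟩
      exact inferInstanceAs (IsIso ((Over.forget _).map (τ (Γ.mul y (Γ.inv x)))))
    · rw [hτ, Γ.mul_assoc, Γ.inv_mul, Γ.mul_one']
  have hsmA : Smooth A.hom := homog_smooth hhom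
  obtain ⟨F2, hF2⟩ := hu A (liftO (sndO A Γ.G) (fstO A Γ.G) ≫ F1)
  let μ : prodO A A ⟶ A := liftO (sndO A A) (fstO A A) ≫ F2
  have hμ : ∀ x y : Pt Γ.G k, liftO (x ≫ p) (y ≫ p) ≫ μ = Γ.mul x y ≫ p := by
    intro x y
    have h1 : liftO (x ≫ p) (y ≫ p) ≫ liftO (sndO A A) (fstO A A) = liftO (y ≫ p) x ≫ bc A p := by
      rw [pt_bc, comp_liftO, liftO_fst, liftO_snd]
    have h2 : liftO (y ≫ p) x ≫ liftO (sndO A Γ.G) (fstO A Γ.G) = liftO x (y ≫ p) := by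
      rw [comp_liftO, liftO_fst, liftO_snd]
    rw [← Category.assoc, h1, Category.assoc, hF2, ← Category.assoc, h2, hF1']
  clear_value μ
  obtain ⟨ι, hι⟩ := fac_one (Γ.one _) p (hu Γ.G) (Γ.inv (𝟙 _) ≫ p)
  have hι' : ∀ x : Pt Γ.G k, (x ≫ p) ≫ ι = Γ.inv x ≫ p := by
    intro x
    rw [Category.assoc, hι, ← Category.assoc, Γ.inv_natural, Category.comp_id]
  let o : Pt A k := Γ.one (SO k k) ≫ p
  have hlAA : LocallyOfFiniteType (prodO A A).hom := prodO_lft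
  have hiAA : AlgebraicGeometry.IsIntegral (prodO A A).left := prod_integral
  have hlAAA : LocallyOfFiniteType (prodO (prodO A A) A).hom := prodO_lft
  have hiAAA : AlgebraicGeometry.IsIntegral (prodO (prodO A A) A).left := prod_integral
  have E1 : liftO (fstO (prodO A A) A ≫ μ) (sndO (prodO A A) A) ≫ μ =
      liftO (fstO (prodO A A) A ≫ fstO A A) (liftO (fstO (prodO A A) A ≫ sndO A A) (sndO (prodO A A) A) ≫ μ) ≫ μ := by
    apply ext_pts
    intro z
    obtain ⟨w, c, rfl⟩ : ∃ w c, z = liftO w c := ⟨_, _, (liftO_eta z).symm⟩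
    obtain ⟨a, b, rfl⟩ : ∃ a b, w = liftO a b := ⟨_, _, (liftO_eta w).symm⟩
    obtain ⟨a, rfl⟩ := hs a
    obtain ⟨b, rfl⟩ := hs b
    obtain ⟨c, rfl⟩ := hs c
    rw [← Category.assoc, ← Category.assoc, comp_liftO, comp_liftO]
    simp only [← Category.assoc, comp_liftO, liftO_fst, liftO_snd]
    rw [hμ, hμ, hμ, hμ, Γ.mul_assoc]
  have E2 : liftO (constO A o) (𝟙 A) ≫ μ = 𝟙 A := by
    apply ext_pts
    intro z
    obtain ⟨a, rfl⟩ := hs z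
    rw [← Category.assoc, comp_liftO, comp_constO, constO_k, Category.comp_id, hμ, Γ.one_mul]
  have E3 : liftO ι (𝟙 A) ≫ μ = constO A o := by
    apply ext_pts
    intro z
    obtain ⟨a, rfl⟩ := hs z
    rw [← Category.assoc, comp_liftO, comp_constO, constO_k, Category.comp_id, hι', hμ, Γ.inv_mul]
  refine ⟨{ G := A, mul := fun a b => liftO a b ≫ μ, one := fun T => constO T o, inv := fun a => a ≫ ι,
            mul_assoc := ?_, one_mul := ?_, inv_mul := ?_, mul_natural := ?_, one_natural := ?_ }, rfl⟩
  · intro T a b c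
    have := congr(liftO (liftO a b) c ≫ $E1)
    rw [← Category.assoc, ← Category.assoc, comp_liftO, comp_liftO] at this
    simpa only [← Category.assoc, comp_liftO, liftO_fst, liftO_snd] using this
  · intro T a
    have := congr(a ≫ $E2)
    rwa [← Category.assoc, comp_liftO, comp_constO, Category.comp_id] at this
  · intro T a
    have := congr(a ≫ $E3)
    rwa [← Category.assoc, comp_liftO, comp_constO, Category.comp_id] at this
  · intro T T' f a b
    rw [← Category.assoc, comp_liftO]
  · intro T T' f
    exact comp_constO _ _

end P25

section P26
variable {k : Type} [Field k]

def groupOfGrpObj (G : OverR k) [GrpObj G] : GroupScheme k where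
  G := G
  mul a b := (Hom.group (X := _) (G := G)).mul a b
  one T := (Hom.group (X := T) (G := G)).one
  inv a := (Hom.group (X := _) (G := G)).inv a
  mul_assoc a b c := (Hom.group (X := _) (G := G)).mul_assoc a b c
  one_mul a := (Hom.group (X := _) (G := G)).one_mul a
  inv_mul a := (Hom.group (X := _) (G := G)).inv_mul_cancel a
  mul_natural f a b := MonObj.comp_mul f a b
  one_natural f := MonObj.comp_one f

lemma gm_group (k : Type) [Field k] : ∃ Δ : GroupScheme k, Δ.G = GmO k := by
  have h : GrpObj ((Spec (CommRingCat.of (LaurentPolynomial k))).asOver (Spec (CommRingCat.of k))) :=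
    instGrpObjSpecAsOverSpec (R := CommRingCat.of k) (A := CommRingCat.of (LaurentPolynomial k))
  exact ⟨@groupOfGrpObj k _ _ h, rfl⟩

lemma gm_ft (k : Type) [Field k] : LocallyOfFiniteType (GmO k).hom ∧ QuasiCompact (GmO k).hom ∧ ConnectedSpace (GmO k).left := by
  refine ⟨?_, ?_, ?_⟩
  · change LocallyOfFiniteType (Spec.map (CommRingCat.ofHom (algebraMap k (LaurentPolynomial k))))
    rw [HasRingHomProperty.Spec_iff (P := @LocallyOfFiniteType)]
    have : Algebra.FiniteType k (LaurentPolynomial k) := 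
      inferInstanceAs (Algebra.FiniteType k (AddMonoidAlgebra k ℤ))
    simpa [RingHom.finiteType_algebraMap]
  · exact inferInstanceAs (QuasiCompact (Spec.map (CommRingCat.ofHom (algebraMap k (LaurentPolynomial k)))))
  · have : IsDomain (CommRingCat.of (LaurentPolynomial k)) := inferInstanceAs (IsDomain (LaurentPolynomial k))
    have : IrreducibleSpace (Spec (CommRingCat.of (LaurentPolynomial k))) := inferInstance
    exact inferInstanceAs (ConnectedSpace (Spec (CommRingCat.of (LaurentPolynomial k))))

lemma one_two_aux {X : OverR k} (h : GrouplessModulo k X ∅) {A : OverR k} (hA : ∃ Δ : GroupScheme k, Δ.G = A)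
    (hf : LocallyOfFiniteType A.hom ∧ QuasiCompact A.hom ∧ ConnectedSpace A.left) (f : A ⟶ X) : IsConstant f := by
  obtain ⟨Γ, rfl⟩ := hA
  have hiso : IsIso (⊤ : Γ.G.left.Opens).ι := inferInstanceAs (IsIso (Γ.G.left.topIso).hom)
  by_contra hn
  have := h Γ hf ⊤ (by simp) (by intro z hz; simp at hz) ((⊤ : Γ.G.left.Opens).ι ≫ f.left)
    (by rw [Category.assoc]; exact congr(_ ≫ $(Over.w f))) (by
      rintro ⟨y, hy⟩
      refine hn ⟨y, ?_⟩
      rw [Category.assoc] at hy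
      exact (cancel_epi _).mp hy)
  obtain ⟨_, _, hc⟩ := hf
  obtain ⟨x⟩ := hc.toNonempty
  exact this ⟨⟨x, trivial⟩, rfl⟩

lemma two_three [IsAlgClosed k] [CharZero k] (X : OverR k) [IsProper X.hom] (h : IsGroupless k X)
    (Γ : GroupScheme k) (hΓ : Γ.IsFiniteTypeConnected) (V : Γ.G.left.Opens) (hV : Dense (V : Set Γ.G.left))
    (g : V.toScheme ⟶ X.left) (hg : g ≫ X.hom = V.ι ≫ Γ.G.hom) : IsConstantHom (V.ι ≫ Γ.G.hom) g := by
  have hnr : NR X := nr_of_gm h.1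
  have hintg := group_integral Γ hΓ
  have hne : Nonempty V := hV.nonempty.to_subtype
  obtain ⟨f, hf⟩ := extend_group Γ hΓ hnr V (Over.homMk g hg)
  obtain ⟨_, _, _⟩ := hΓ
  have hsepG := Γ.separated
  have hsm : Smooth Γ.G.hom := homog_smooth Γ.homog
  obtain ⟨Y, P, hP⟩ := exists_minG Γ.G X ⟨inferInstance, hnr⟩ f
  have := hP.good.1
  have hqc : QuasiCompact P.left := by
    have : QuasiCompact (P.left ≫ Y.hom) := by rw [Over.w]; infer_instance
    exact QuasiCompact.of_comp P.left Y.hom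
  have hsP : IsSeparated P.left := by
    have : IsSeparated (P.left ≫ Y.hom) := by rw [Over.w]; infer_instance
    exact IsSeparated.of_comp P.left Y.hom
  have hN := nm_minG P hP
  have hpA := hN.good.1
  have hiA := hN.int
  have hgr : ∃ Δ : GroupScheme k, Δ.G = nmA P :=
    group_desc Γ (nmTo P) (minG_surj Γ hN) (fun T _ _ _ F => univ_fac Γ hP T hN.good F)
  obtain ⟨f', hf'⟩ := fac_one (Γ.one _) (nmTo P) (fun F => univ_fac Γ hP Γ.G (Q := X) ⟨inferInstance, hnr⟩ F) f
  have key : ∀ A : OverR k, (∃ Δ : GroupScheme k, Δ.G = A) → IsProper A.hom → AlgebraicGeometry.IsIntegral A.left →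
      ∀ f : A ⟶ X, IsConstant f := by
    rintro _ ⟨Δ, rfl⟩ h1 h2 f
    exact h.2 Δ ⟨⟨inferInstance, inferInstance, inferInstance⟩, h1⟩ f
  obtain ⟨y, hy⟩ := key _ hgr hpA hiA f'
  refine ⟨y, ?_⟩
  have e1 : g = V.ι ≫ f.left := congr(($hf).left).symm
  have e2 : f.left = (nmTo P).left ≫ f'.left := congr(($hf').left).symm
  rw [e1, e2, hy, Category.assoc, ← Over.w (nmTo P), Category.assoc]

end P26

/-- Let `k` be an algebraically closed field of characteristic zero and
let `X` be a proper scheme over `k`. The following are equivalent: (1) `X` is groupless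
modulo the empty subset; (2) `X` is groupless; (3) for every finite type connected group
scheme `G` over `k` and every dense open `V ⊆ G`, every morphism `V ⟶ X` over `k` is
constant. -/
theorem stmt_8 (k : Type) [Field k] [IsAlgClosed k] [CharZero k]
    (X : OverR k) (hproper : IsProper X.hom) :
    List.TFAE [
      GrouplessModulo k X ∅,
      IsGroupless k X,
      ∀ (Γ : GroupScheme k), Γ.IsFiniteTypeConnected →
        ∀ (V : Γ.G.left.Opens), Dense (V : Set Γ.G.left) →
          ∀ g : V.toScheme ⟶ X.left, g ≫ X.hom = V.ι ≫ Γ.G.hom →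
            IsConstantHom (V.ι ≫ Γ.G.hom) g] := by
  tfae_have 1 → 2 := fun h => ⟨fun f => one_two_aux h (gm_group k) (gm_ft k) f,
    fun Γ hΓ f => one_two_aux h ⟨Γ, rfl⟩ hΓ.1 f⟩
  tfae_have 2 → 3 := fun h Γ hΓ V hV g hg => two_three X h Γ hΓ V hV g hg
  tfae_have 3 → 1 := fun h Γ hΓ U hU _ g hg hn => absurd (h Γ hΓ U hU g hg) hn
  tfae_finish

end
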